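/- Let Π_n := sup_{x∈S^d} a_κ ∫_{S^d} |P_n(h_κ²;x,y)| h_κ²(y) dω(y), which is the operator norm of the orthogonal projection proj_n(h_κ²) on L^∞(h_κ²;S^d) (and on L¹(h_κ²;S^d)). Then there exist constants c₁, c₂ > 0, depending only on d and κ, such that c₁ n^{σ_κ} ≤ Π_n ≤ c₂ n^{σ_κ} for all integers n ≥ 1. -/

import Mathlib

open MeasureTheory Finset Real

/-- Generalized binomial coefficient `C(x, k) = x (x-1) ⋯ (x-k+1) / k!`. -/
noncomputable def genBinom (x : ℝ) (k : ℕ) : ℝ :=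
  (∏ i ∈ Finset.range k, (x - i)) / (Nat.factorial k)

/-- Jacobi polynomial `P_n^{(a,b)}(t)`. -/
noncomputable def jacobiP (n : ℕ) (a b t : ℝ) : ℝ :=
  ∑ m ∈ Finset.range (n + 1),
    genBinom (n + a) (n - m) * genBinom (n + b) m * ((t - 1) / 2) ^ m * ((t + 1) / 2) ^ (n - m)

/-- Pochhammer symbol `(a)_n`. -/
noncomputable def poch (a : ℝ) (n : ℕ) : ℝ := ∏ i ∈ Finset.range n, (a + i)

/-- Gegenbauer polynomial `C_n^λ(t)`. -/
noncomputable def gegenC (n : ℕ) (l t : ℝ) : ℝ :=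
  (poch (2 * l) n / poch (l + 1 / 2) n) * jacobiP n (l - 1 / 2) (l - 1 / 2) t

/-- Cesàro coefficient `A_m^δ = C(m+δ, m)`. -/
noncomputable def cesA (δ : ℝ) (m : ℕ) : ℝ := genBinom (m + δ) m

/-- The cube `[-1,1]^m`. -/
def cube (m : ℕ) : Set (Fin m → ℝ) := Set.univ.pi fun _ => Set.Icc (-1) 1

/-- The weight `∏ (1+t_i)(1-t_i²)^{κ_i-1}` on the cube. -/
noncomputable def wprod {m : ℕ} (κ : Fin m → ℝ) (t : Fin m → ℝ) : ℝ :=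
  ∏ i, (1 + t i) * (1 - t i ^ 2) ^ (κ i - 1)

/-- `λ_κ = |κ| + (d-1)/2`. -/
noncomputable def lamK (d : ℕ) (κ : Fin (d + 1) → ℝ) : ℝ := (∑ i, κ i) + ((d : ℝ) - 1) / 2

/-- The reproducing kernel `P_n(h_κ²; x, y)` on the sphere. -/
noncomputable def hP (d : ℕ) (κ : Fin (d + 1) → ℝ) (n : ℕ)
    (x y : EuclideanSpace ℝ (Fin (d + 1))) : ℝ :=
  (∫ t in cube (d + 1), wprod κ t)⁻¹ * ((n + lamK d κ) / lamK d κ) *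
    ∫ t in cube (d + 1), gegenC n (lamK d κ) (∑ i, x i * y i * t i) * wprod κ t

/-- The Cesàro `(C,δ)` kernel `K_n^δ(h_κ²; x, y)` on the sphere. -/
noncomputable def hK (d : ℕ) (κ : Fin (d + 1) → ℝ) (δ : ℝ) (n : ℕ)
    (x y : EuclideanSpace ℝ (Fin (d + 1))) : ℝ :=
  (cesA δ n)⁻¹ * ∑ k ∈ Finset.range (n + 1), cesA δ (n - k) * hP d κ k x y

/-- `z̄ = (|z_1|, …, |z_{d+1}|)`. -/
noncomputable def ebar {m : ℕ} (z : EuclideanSpace ℝ (Fin m)) : EuclideanSpace ℝ (Fin m) :=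
  (EuclideanSpace.equiv (Fin m) ℝ).symm fun i => |z i|

/-- `h_κ²(y) = ∏ |y_i|^{2κ_i}`. -/
noncomputable def hsq {m : ℕ} (κ : Fin m → ℝ) (y : EuclideanSpace ℝ (Fin m)) : ℝ :=
  ∏ i, |y i| ^ (2 * κ i)

/-- `σ_κ = (d-1)/2 + |κ| - min_i κ_i`. -/
noncomputable def sigmaK (d : ℕ) (κ : Fin (d + 1) → ℝ) : ℝ :=
  ((d : ℝ) - 1) / 2 + (∑ i, κ i) - Finset.univ.inf' (Finset.univ_nonempty) κ

/-- The surface measure `dω` on the unit sphere `S^d`. -/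
noncomputable def sphereMeas (d : ℕ) :
    Measure (Metric.sphere (0 : EuclideanSpace ℝ (Fin (d + 1))) 1) :=
  (volume : Measure (EuclideanSpace ℝ (Fin (d + 1)))).toSphere

open Polynomial in
/-- The Gegenbauer differential operator applied to a polynomial. -/
noncomputable def gegOp (n : ℕ) (l : ℝ) (p : ℝ[X]) : ℝ[X] :=
  (1 - X ^ 2) * derivative (derivative p) - C (2 * l + 1) * X * derivative p
    + C (n * (n + 2 * l)) * p

/-- The coefficient of `t^(n-2k)` in the Gegenbauer polynomial. -/
noncomputable def gegCoef (n : ℕ) (l : ℝ) (k : ℕ) : ℝ :=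
  (-1) ^ k * poch l (n - k) * 2 ^ (n - 2 * k) / (k.factorial * (n - 2 * k).factorial)

open Polynomial in
/-- The Gegenbauer polynomial in the monomial basis. -/
noncomputable def gegPoly (n : ℕ) (l : ℝ) : ℝ[X] :=
  ∑ k ∈ range (n / 2 + 1), monomial (n - 2 * k) (gegCoef n l k)

open Polynomial in
/-- The Jacobi polynomial with equal parameters, as a polynomial. -/
noncomputable def jacPoly (n : ℕ) (a : ℝ) : ℝ[X] :=
  ∑ m ∈ range (n + 1), C (genBinom (n + a) (n - m) * genBinom (n + a) m) *
    ((C (1 / 2) * (X - 1)) ^ m * (C (1 / 2) * (X + 1)) ^ (n - m))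

theorem poch_zero (a : ℝ) : poch a 0 = 1 := by simp [poch]

theorem poch_succ (a : ℝ) (n : ℕ) : poch a (n + 1) = poch a n * (a + n) := by
  simp [poch, prod_range_succ]

theorem poch_succ' (a : ℝ) (n : ℕ) : poch a (n + 1) = a * poch (a + 1) n := by
  simp only [poch, prod_range_succ']
  rw [mul_comm]
  simp only [Nat.cast_zero, add_zero]
  congr 1
  refine prod_congr rfl fun i _ => ?_
  push_cast; ring

theorem poch_pos {a : ℝ} (ha : 0 < a) (n : ℕ) : 0 < poch a n :=
  prod_pos fun i _ => by positivity

theorem poch_add (a : ℝ) (m n : ℕ) : poch a (m + n) = poch a m * poch (a + m) n := by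
  induction n with
  | zero => simp [poch_zero]
  | succ n ih => rw [← add_assoc, poch_succ, ih, poch_succ]; push_cast; ring

theorem poch_two_mul (a : ℝ) (n : ℕ) :
    poch (2 * a) (2 * n) = 4 ^ n * poch a n * poch (a + 1 / 2) n := by
  induction n with
  | zero => simp [poch_zero]
  | succ n ih =>
    rw [show 2 * (n + 1) = 2 * n + 1 + 1 by ring, poch_succ, poch_succ, ih, poch_succ, poch_succ]
    push_cast; ring

theorem poch_vandermonde (a b : ℝ) (n : ℕ) :
    poch (a + b) n = ∑ k ∈ range (n + 1), n.choose k * poch a (n - k) * poch b k := by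
  induction n generalizing a b with
  | zero => simp [poch_zero]
  | succ n ih =>
    rw [sum_range_succ']
    have h1 : ∀ k ∈ range (n + 1), ((n + 1).choose (k + 1) : ℝ) * poch a (n + 1 - (k + 1)) *
        poch b (k + 1) = b * (n.choose k * poch a (n - k) * poch (b + 1) k) +
          n.choose (k + 1) * poch a (n - k) * poch b (k + 1) := by
      intro k _
      rw [Nat.choose_succ_succ, Nat.add_sub_add_right]
      nth_rw 1 [poch_succ' b k]
      rw [poch_succ' b k]; push_cast; ring
    rw [sum_congr rfl h1, sum_add_distrib, ← mul_sum, ← ih a (b + 1), add_assoc]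
    have h2 : ∑ k ∈ range (n + 1), (n.choose (k + 1) : ℝ) * poch a (n - k) * poch b (k + 1)
        + ((n + 1).choose 0 : ℕ) * poch a (n + 1 - 0) * poch b 0 =
        ∑ k ∈ range (n + 1), a * (n.choose k * poch (a + 1) (n - k) * poch b k) := by
      rw [sum_range_succ, sum_range_succ' _ n]
      simp only [Nat.choose_succ_self, Nat.cast_zero, zero_mul, add_zero, Nat.choose_zero_right,
        Nat.sub_zero, poch_zero, mul_one, poch_succ' a n]
      congr 1
      · refine sum_congr rfl fun k hk => ?_
        have : n - k = (n - (k + 1)) + 1 := by have := mem_range.1 hk; omega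
        rw [this, poch_succ']; ring
      · ring
    rw [h2, ← mul_sum, ← ih (a + 1) b, poch_succ']
    rw [show a + (b + 1) = a + b + 1 by ring, show a + 1 + b = a + b + 1 by ring]
    ring

theorem genBinom_eq_poch (x : ℝ) (k : ℕ) : genBinom x k = poch (x - k + 1) k / k.factorial := by
  unfold genBinom poch
  congr 1
  rw [← prod_range_reflect]
  refine prod_congr rfl fun i hi => ?_
  have : i + 1 ≤ k := mem_range.1 hi
  rw [show k - 1 - i = k - (i + 1) by omega, Nat.cast_sub this]; push_cast; ring

theorem genBinom_succ_mul (x : ℝ) (k : ℕ) :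
    genBinom x (k + 1) * (k + 1) = genBinom x k * (x - k) := by
  unfold genBinom
  rw [prod_range_succ, Nat.factorial_succ]; push_cast
  field_simp

section
open Polynomial

theorem gegOp_add (n : ℕ) (l : ℝ) (p q : ℝ[X]) : gegOp n l (p + q) = gegOp n l p + gegOp n l q := by
  simp only [gegOp, derivative_add]; ring

theorem gegOp_C_mul (n : ℕ) (l c : ℝ) (p : ℝ[X]) : gegOp n l (C c * p) = C c * gegOp n l p := by
  simp only [gegOp, derivative_C_mul]; ring

theorem gegOp_sum {ι : Type*} (n : ℕ) (l : ℝ) (s : Finset ι) (f : ι → ℝ[X]) :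
    gegOp n l (∑ i ∈ s, f i) = ∑ i ∈ s, gegOp n l (f i) := by
  simp only [gegOp, derivative_sum, mul_sum, sum_add_distrib, sum_sub_distrib]

theorem coeff_gegOp (n : ℕ) (l : ℝ) (p : ℝ[X]) (j : ℕ) :
    (gegOp n l p).coeff j = (j + 2) * (j + 1) * p.coeff (j + 2)
      + (n - j) * (n + j + 2 * l) * p.coeff j := by
  have e1 : (X ^ 2 * derivative (derivative p)).coeff j = j * (j - 1) * p.coeff j := by
    rcases j with _ | _ | j
    · simp
    · simp [coeff_X_pow_mul']
    · rw [coeff_X_pow_mul, coeff_derivative, coeff_derivative]; push_cast; ring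
  have e2 : (X * derivative p).coeff j = j * p.coeff j := by
    rcases j with _ | j
    · simp
    · rw [coeff_X_mul, coeff_derivative]; push_cast; ring
  rw [gegOp, coeff_add, coeff_sub, sub_mul, one_mul, coeff_sub, e1, mul_assoc (C (2 * l + 1)),
    coeff_C_mul, coeff_C_mul, e2, coeff_derivative, coeff_derivative]
  push_cast; ring

theorem eq_zero_of_gegOp_eq_zero {n : ℕ} {l : ℝ} (hl : 0 < l) {p : ℝ[X]}
    (hp : gegOp n l p = 0) (hd : p.natDegree ≤ n) (hn : p.coeff n = 0) : p = 0 := by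
  have key : ∀ i j : ℕ, n ≤ j + i → p.coeff j = 0 := by
    intro i
    induction i using Nat.strong_induction_on with
    | _ i ih =>
      intro j hj
      rcases lt_trichotomy n j with h | h | h
      · exact coeff_eq_zero_of_natDegree_lt (by omega)
      · rw [← h, hn]
      · have h2 : p.coeff (j + 2) = 0 := ih (i - 1) (by omega) _ (by omega)
        have h3 := coeff_gegOp n l p j
        rw [hp, h2, coeff_zero, mul_zero, zero_add] at h3
        have h4 : (0:ℝ) < n - j := by rw [sub_pos]; exact_mod_cast h
        have h5 : (0:ℝ) < (n - j) * (n + j + 2 * l) := by positivity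
        exact (mul_eq_zero.1 h3.symm).resolve_left h5.ne'
  ext j
  rw [key n j (by omega), coeff_zero]

theorem gegOp_half_pow (m k : ℕ) (a : ℝ) (x y : ℝ[X])
    (hx : x = C (1 / 2) * (X - 1)) (hy : y = C (1 / 2) * (X + 1)) :
    gegOp (m + k) (a + 1 / 2) (x ^ m * y ^ k) =
      C (((m + k : ℝ)) * (m + k + 2 * a + 1) - (2 * m * k + (a + 1) * (m + k))) * (x ^ m * y ^ k)
      - C (m * (m + a)) * (x ^ (m - 1) * y ^ (k + 1))
      - C (k * (k + a)) * (x ^ (m + 1) * y ^ (k - 1)) := by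
  have hx' : derivative x = C (1 / 2) := by rw [hx]; simp
  have hy' : derivative y = C (1 / 2) := by rw [hy]; simp
  have hh : (C (1 / 2) : ℝ[X]) * 2 = 1 := by
    rw [← C_ofNat, ← C_mul]; norm_num
  have hX : (X : ℝ[X]) = x + y := by
    rw [hx, hy]; linear_combination -X * hh
  have h1 : (1 : ℝ[X]) = y - x := by
    rw [hx, hy]; linear_combination -hh
  have hq : (1 : ℝ[X]) - X ^ 2 = - 4 * (x * y) := by
    rw [hX]
    calc (1 : ℝ[X]) - (x + y) ^ 2 = 1 ^ 2 - (x + y) ^ 2 := by ring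
      _ = _ := by rw [h1]; ring
  have hD : ∀ m k : ℕ, derivative (x ^ m * y ^ k) =
      C (1 / 2) * (C (m : ℝ) * (x ^ (m - 1) * y ^ k) + C (k : ℝ) * (x ^ m * y ^ (k - 1))) := by
    intro m k
    rw [derivative_mul, derivative_pow, derivative_pow, hx', hy']; ring
  have e1 : ∀ (x : ℝ[X]) (m : ℕ), C (m : ℝ) * (x * x ^ (m - 1)) = C (m : ℝ) * x ^ m := by
    rintro x (_ | m)
    · simp
    · rw [Nat.add_sub_cancel, pow_succ']
  have e2 : ∀ (m : ℕ), C (m : ℝ) * C ((m - 1 : ℕ) : ℝ) = C (m : ℝ) * (C (m : ℝ) - 1) := by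
    rintro (_ | m)
    · simp
    · rw [Nat.add_sub_cancel]; push_cast; simp
  rw [gegOp, hq, hD, derivative_C_mul, derivative_add, derivative_C_mul, derivative_C_mul, hD, hD,
    hX]
  have ex1 := e1 x m
  have ex2 := e1 x (m - 1)
  have ey1 := e1 y k
  have ey2 := e1 y (k - 1)
  have em := e2 m
  have ek := e2 k
  have hC2 : (C (2:ℝ) : ℝ[X]) = 2 := C_ofNat 2
  have c1 : (C (2 * (a + 1 / 2) + 1) : ℝ[X]) = 2 * (C a + 1) := by
    rw [show 2 * (a + 1 / 2) + 1 = 2 * (a + 1) by ring]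
    simp only [C_mul, C_add, C_1, hC2]
  have c2 : (C (((m + k : ℕ) : ℝ) * ((m + k : ℕ) + 2 * (a + 1 / 2))) : ℝ[X]) =
      (C (m : ℝ) + C (k : ℝ)) * (C (m : ℝ) + C (k : ℝ) + 2 * C a + 1) := by
    rw [show 2 * (a + 1 / 2) = 2 * a + 1 by ring]
    simp only [C_mul, C_add, C_1, hC2, Nat.cast_add]; ring
  have c3 : (C (((m + k : ℝ)) * (m + k + 2 * a + 1) - (2 * m * k + (a + 1) * (m + k))) : ℝ[X]) =
      (C (m : ℝ) + C (k : ℝ)) * (C (m : ℝ) + C (k : ℝ) + 2 * C a + 1)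
        - (2 * C (m : ℝ) * C (k : ℝ) + (C a + 1) * (C (m : ℝ) + C (k : ℝ))) := by
    simp only [C_mul, C_add, C_sub, C_1, hC2]
  rw [c1, c2, c3, C_mul, C_mul, C_add, C_add, pow_succ' y, pow_succ' x]
  generalize (C (m : ℝ) : ℝ[X]) = M at *
  generalize (C (k : ℝ) : ℝ[X]) = K at *
  generalize (C ((m - 1 : ℕ) : ℝ) : ℝ[X]) = M' at *
  generalize (C ((k - 1 : ℕ) : ℝ) : ℝ[X]) = K' at *
  generalize (C (1 / 2 : ℝ) : ℝ[X]) = h at *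
  generalize (C a : ℝ[X]) = A at *
  generalize x ^ (m - 1 - 1) = x2 at *
  generalize y ^ (k - 1 - 1) = y2 at *
  generalize x ^ (m - 1) = x1 at *
  generalize y ^ (k - 1) = y1 at *
  generalize x ^ m = x0 at *
  generalize y ^ k = y0 at *
  have s1 : -4 * (x * y) * (h * (M * (h * (M' * (x2 * y0) + K * (x1 * y1))) +
      K * (h * (M * (x1 * y1) + K' * (x0 * y2))))) =
      -(x * y) * (M * M' * x2 * y0 + 2 * M * K * x1 * y1 + K * K' * x0 * y2) := by
    linear_combination -(x * y) * (M * M' * x2 * y0 + 2 * M * K * x1 * y1 + K * K' * x0 * y2) *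
      (h * 2 + 1) * hh
  have s2 : 2 * (A + 1) * (x + y) * (h * (M * (x1 * y0) + K * (x0 * y1))) =
      (A + 1) * (x + y) * (M * (x1 * y0) + K * (x0 * y1)) := by
    linear_combination (A + 1) * (x + y) * (M * (x1 * y0) + K * (x0 * y1)) * hh
  rw [s1, s2]
  have t1 : (x * y) * (M * M' * x2 * y0) = M * (M - 1) * x1 * y * y0 := by
    linear_combination M * y * y0 * ex2 + x1 * y * y0 * em
  have t2 : (x * y) * (K * K' * x0 * y2) = K * (K - 1) * x0 * x * y1 := by
    linear_combination K * x * x0 * ey2 + y1 * x * x0 * ek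
  have t3 : (x * y) * (M * K * x1 * y1) = M * K * x0 * y0 := by
    linear_combination K * y * y1 * ex1 + M * x0 * ey1
  linear_combination -t1 - t2 - 2 * t3 - (A + 1) * y0 * ex1 - (A + 1) * x0 * ey1

theorem gegOp_jacPoly (n : ℕ) (a : ℝ) : gegOp n (a + 1 / 2) (jacPoly n a) = 0 := by
  set x : ℝ[X] := C (1 / 2) * (X - 1) with hx
  set y : ℝ[X] := C (1 / 2) * (X + 1) with hy
  set g : ℕ → ℝ := fun m => genBinom (n + a) (n - m) * genBinom (n + a) m with hg
  have hrec : ∀ m < n, g (m + 1) * ((m + 1 : ℕ) * ((m + 1 : ℕ) + a))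
      = g m * ((n - m : ℕ) * ((n - m : ℕ) + a)) := by
    intro m hm
    obtain ⟨k, rfl⟩ : ∃ k, n = m + 1 + k := ⟨n - (m + 1), by omega⟩
    simp only [hg]
    have e1 := genBinom_succ_mul ((m + 1 + k : ℕ) + a) m
    have e2 := genBinom_succ_mul ((m + 1 + k : ℕ) + a) k
    rw [show m + 1 + k - (m + 1) = k by omega, show m + 1 + k - m = k + 1 by omega]
    push_cast at *
    linear_combination genBinom (m + 1 + k + a) k * (m + 1 + a) * e1 -
      genBinom (m + 1 + k + a) m * (k + 1 + a) * e2
  have h0 : jacPoly n a = ∑ m ∈ range (n + 1), C (g m) * (x ^ m * y ^ (n - m)) := rfl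
  rw [h0, gegOp_sum]
  have h1 : ∀ m ∈ range (n + 1), gegOp n (a + 1 / 2) (C (g m) * (x ^ m * y ^ (n - m))) =
      C (g m * (m * (m + a) + (n - m : ℕ) * ((n - m : ℕ) + a))) * (x ^ m * y ^ (n - m))
      - C (g m * (m * (m + a))) * (x ^ (m - 1) * y ^ (n - m + 1))
      - C (g m * ((n - m : ℕ) * ((n - m : ℕ) + a))) * (x ^ (m + 1) * y ^ (n - m - 1)) := by
    intro m hm
    obtain ⟨k, rfl⟩ : ∃ k, n = m + k := ⟨n - m, by have := mem_range.1 hm; omega⟩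
    rw [gegOp_C_mul, Nat.add_sub_cancel_left, gegOp_half_pow m k a x y hx hy]
    have e : ∀ v : ℝ, (C (g m * v) : ℝ[X]) = C (g m) * C v := fun v => C_mul
    rw [e, e, e]
    rw [show ((m + k : ℝ)) * (m + k + 2 * a + 1) - (2 * m * k + (a + 1) * (m + k)) =
      m * (m + a) + k * (k + a) by ring]
    generalize (C (g m) : ℝ[X]) = G
    ring
  rw [sum_congr rfl h1, sum_sub_distrib, sum_sub_distrib]
  have h2 : ∑ m ∈ range (n + 1), C (g m * (m * (m + a))) * (x ^ (m - 1) * y ^ (n - m + 1)) =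
      ∑ m ∈ range (n + 1), C (g m * ((n - m : ℕ) * ((n - m : ℕ) + a))) * (x ^ m * y ^ (n - m)) := by
    rw [sum_range_succ', sum_range_succ]
    simp only [Nat.cast_zero, zero_mul, mul_zero, map_zero, add_zero, Nat.sub_self]
    refine sum_congr rfl fun m hm => ?_
    have hm := mem_range.1 hm
    rw [hrec m hm, Nat.add_sub_cancel, show n - (m + 1) + 1 = n - m by omega]
  have h3 : ∑ m ∈ range (n + 1), C (g m * ((n - m : ℕ) * ((n - m : ℕ) + a))) *
        (x ^ (m + 1) * y ^ (n - m - 1)) =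
      ∑ m ∈ range (n + 1), C (g m * (m * (m + a))) * (x ^ m * y ^ (n - m)) := by
    rw [sum_range_succ, sum_range_succ' _ n]
    simp only [Nat.cast_zero, zero_mul, mul_zero, map_zero, add_zero, Nat.sub_self]
    refine sum_congr rfl fun m hm => ?_
    have hm := mem_range.1 hm
    rw [hrec m hm, show n - (m + 1) = n - m - 1 by omega]
  rw [h2, h3, ← sum_sub_distrib, ← sum_sub_distrib]
  refine sum_eq_zero fun m _ => ?_
  rw [mul_add, C_add]; ring

theorem coeff_gegPoly (n : ℕ) (l : ℝ) (i : ℕ) : (gegPoly n l).coeff i =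
    if i ≤ n ∧ (n - i) % 2 = 0 then gegCoef n l ((n - i) / 2) else 0 := by
  rw [gegPoly, finsetSum_coeff]
  simp only [coeff_monomial]
  split_ifs with h
  · rw [sum_eq_single ((n - i) / 2)]
    · rw [if_pos (by omega)]
    · intro k hk hne
      have := mem_range.1 hk
      rw [if_neg (by omega)]
    · intro hk
      exact absurd (mem_range.2 (by omega)) hk
  · refine sum_eq_zero fun k hk => ?_
    have := mem_range.1 hk
    rw [if_neg (by omega)]

theorem gegOp_gegPoly (n : ℕ) (l : ℝ) : gegOp n l (gegPoly n l) = 0 := by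
  ext j
  rw [coeff_gegOp, coeff_gegPoly, coeff_gegPoly, coeff_zero]
  by_cases h : j ≤ n ∧ (n - j) % 2 = 0
  swap
  · rw [if_neg (by omega), if_neg h]; ring
  rw [if_pos h]
  by_cases h2 : j = n
  · subst h2; rw [if_neg (by omega)]; simp
  obtain ⟨k, rfl⟩ : ∃ k, n = j + 2 * k + 2 := ⟨(n - j) / 2 - 1, by omega⟩
  rw [if_pos (by omega), show (j + 2 * k + 2 - (j + 2)) / 2 = k by omega,
    show (j + 2 * k + 2 - j) / 2 = k + 1 by omega]
  unfold gegCoef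
  rw [show j + 2 * k + 2 - k = j + k + 1 + 1 by omega,
    show j + 2 * k + 2 - 2 * k = j + 1 + 1 by omega,
    show j + 2 * k + 2 - (k + 1) = j + k + 1 by omega,
    show j + 2 * k + 2 - 2 * (k + 1) = j by omega, poch_succ _ (j + k + 1),
    Nat.factorial_succ, Nat.factorial_succ, Nat.factorial_succ]
  push_cast
  field_simp
  ring
end

theorem genBinom_eq_neg_poch (x : ℝ) (k : ℕ) :
    genBinom x k = (-1) ^ k * poch (-x) k / k.factorial := by
  rw [genBinom, poch, ← card_range k, ← prod_const, card_range, ← prod_mul_distrib]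
  congr 1
  exact prod_congr rfl fun i _ => by ring

theorem genBinom_vandermonde (x y : ℝ) (n : ℕ) :
    ∑ m ∈ range (n + 1), genBinom x (n - m) * genBinom y m = genBinom (x + y) n := by
  rw [genBinom_eq_neg_poch, neg_add, poch_vandermonde, mul_sum, sum_div]
  refine sum_congr rfl fun m hm => ?_
  obtain ⟨k, rfl⟩ : ∃ k, n = m + k := ⟨n - m, by have := mem_range.1 hm; omega⟩
  rw [Nat.add_sub_cancel_left, genBinom_eq_neg_poch, genBinom_eq_neg_poch,
    ← Nat.add_choose_mul_factorial_mul_factorial m k, Nat.choose_symm_add]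
  have h1 := Nat.factorial_ne_zero m
  have h2 := Nat.factorial_ne_zero k
  have h3 : (m + k).choose k ≠ 0 := (Nat.choose_pos (Nat.le_add_left k m)).ne'
  push_cast
  field_simp
  ring

section
open Polynomial

theorem natDegree_jacPoly_le (n : ℕ) (a : ℝ) : (jacPoly n a).natDegree ≤ n := by
  refine natDegree_sum_le_of_forall_le _ _ fun m hm => ?_
  obtain ⟨k, rfl⟩ : ∃ k, n = m + k := ⟨n - m, by have := mem_range.1 hm; omega⟩
  rw [Nat.add_sub_cancel_left]
  compute_degree

theorem coeff_jacPoly (n : ℕ) (a : ℝ) :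
    (jacPoly n a).coeff n = (1 / 2) ^ n * genBinom (n + a + (n + a)) n := by
  rw [← genBinom_vandermonde, jacPoly, finsetSum_coeff, mul_sum]
  refine sum_congr rfl fun m hm => ?_
  obtain ⟨k, rfl⟩ : ∃ k, n = m + k := ⟨n - m, by have := mem_range.1 hm; omega⟩
  rw [Nat.add_sub_cancel_left, coeff_C_mul]
  have hx : (C (1 / 2 : ℝ) * (X - 1)).natDegree ≤ 1 := by compute_degree
  have hy : (C (1 / 2 : ℝ) * (X + 1)).natDegree ≤ 1 := by compute_degree
  have hxm : ((C (1 / 2 : ℝ) * (X - 1)) ^ m).natDegree ≤ m := by compute_degree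
  have hyk : ((C (1 / 2 : ℝ) * (X + 1)) ^ k).natDegree ≤ k := by compute_degree
  have e1 := coeff_pow_of_natDegree_le hx (m := m)
  have e2 := coeff_pow_of_natDegree_le hy (m := k)
  rw [mul_one] at e1 e2
  rw [coeff_mul_add_eq_of_natDegree_le hxm hyk, e1, e2]
  simp only [coeff_C_mul, coeff_sub, coeff_add, coeff_X_one, coeff_one]
  norm_num
  rw [pow_add]; ring

theorem natDegree_gegPoly_le (n : ℕ) (l : ℝ) : (gegPoly n l).natDegree ≤ n :=
  natDegree_sum_le_of_forall_le _ _ fun _ _ =>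
    (natDegree_monomial_le _).trans (Nat.sub_le _ _)

theorem eval_jacPoly (n : ℕ) (a t : ℝ) : (jacPoly n a).eval t = jacobiP n a a t := by
  rw [jacPoly, jacobiP, eval_finsetSum]
  refine sum_congr rfl fun m _ => ?_
  simp only [eval_mul, eval_pow, eval_C, eval_sub, eval_add, eval_X, eval_one]
  ring

theorem gegPoly_eq_jacPoly {l : ℝ} (hl : 0 < l) (n : ℕ) :
    gegPoly n l = C (poch (2 * l) n / poch (l + 1 / 2) n) * jacPoly n (l - 1 / 2) := by
  refine sub_eq_zero.1 (eq_zero_of_gegOp_eq_zero (n := n) hl ?_ ?_ ?_)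
  · rw [sub_eq_add_neg, ← neg_one_mul, ← C_1, ← C_neg, gegOp_add, gegOp_C_mul, gegOp_C_mul,
      gegOp_gegPoly]
    have := gegOp_jacPoly n (l - 1 / 2)
    rw [sub_add_cancel] at this
    rw [this]; ring
  · refine (natDegree_sub_le _ _).trans (max_le (natDegree_gegPoly_le n l) ?_)
    exact (natDegree_C_mul_le _ _).trans (natDegree_jacPoly_le n _)
  · rw [coeff_sub, coeff_C_mul, coeff_jacPoly, coeff_gegPoly, if_pos (by simp), Nat.sub_self,
      Nat.zero_div, genBinom_eq_poch]
    have h1 := poch_two_mul l n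
    rw [two_mul n, poch_add] at h1
    have h2 := poch_pos (show 0 < l + 1 / 2 by positivity) n
    rw [show (n + (l - 1 / 2) + (n + (l - 1 / 2)) - n + 1 : ℝ) = 2 * l + n by ring]
    simp only [gegCoef, pow_zero, Nat.sub_zero, mul_zero, Nat.factorial_zero]
    have h3 := Nat.factorial_ne_zero n
    have h4 : (4 : ℝ) ^ n = 2 ^ n * 2 ^ n := by rw [← mul_pow]; norm_num
    rw [h4] at h1
    rw [one_div_pow]
    generalize poch (l + 1 / 2) n = q at *
    field_simp
    linear_combination -h1

theorem gegenC_eq_eval {l : ℝ} (hl : 0 < l) (n : ℕ) (t : ℝ) :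
    gegenC n l t = (gegPoly n l).eval t := by
  rw [gegPoly_eq_jacPoly hl, eval_mul, eval_C, eval_jacPoly, gegenC]

theorem gegenC_eq_sum {l : ℝ} (hl : 0 < l) (n : ℕ) (t : ℝ) :
    gegenC n l t = ∑ k ∈ range (n / 2 + 1), gegCoef n l k * t ^ (n - 2 * k) := by
  rw [gegenC_eq_eval hl, gegPoly, eval_finsetSum]
  simp only [eval_monomial]

theorem eval_gegPoly_one {l : ℝ} (hl : 0 < l) (n : ℕ) :
    (gegPoly n l).eval 1 = poch (2 * l) n / n.factorial := by
  rw [gegPoly_eq_jacPoly hl, eval_mul, eval_C, eval_jacPoly, jacobiP, sum_range_succ']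
  have h2 := poch_pos (show 0 < l + 1 / 2 by positivity) n
  have h3 : (n + (l - 1 / 2) - n + 1 : ℝ) = l + 1 / 2 := by ring
  rw [Nat.sub_zero, genBinom_eq_poch, genBinom_eq_poch, h3, poch_zero]
  generalize poch (l + 1 / 2) n = q at *
  simp
  field_simp

theorem eval_gegPoly_neg (n : ℕ) (l t : ℝ) :
    (gegPoly n l).eval (-t) = (-1) ^ n * (gegPoly n l).eval t := by
  rw [gegPoly, eval_finsetSum, eval_finsetSum, mul_sum]
  refine sum_congr rfl fun k hk => ?_
  have := mem_range.1 hk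
  obtain ⟨j, rfl⟩ : ∃ j, n = 2 * k + j := ⟨n - 2 * k, by omega⟩
  rw [eval_monomial, eval_monomial, Nat.add_sub_cancel_left, neg_pow, pow_add, pow_mul]
  norm_num
  ring

theorem gegPoly_ode (n : ℕ) (l t : ℝ) :
    (1 - t ^ 2) * (gegPoly n l).derivative.derivative.eval t
      - (2 * l + 1) * t * (gegPoly n l).derivative.eval t
      + n * (n + 2 * l) * (gegPoly n l).eval t = 0 := by
  have := congrArg (Polynomial.eval t) (gegOp_gegPoly n l)
  simpa [gegOp, -map_mul, -map_add] using this
end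

open Filter Topology in
theorem exists_poch_bounds {a : ℝ} (ha : 0 < a) : ∃ c C : ℝ, 0 < c ∧ 0 < C ∧ ∀ n : ℕ, 1 ≤ n →
    c * (n : ℝ) ^ (a - 1) * n.factorial ≤ poch a n ∧
      poch a n ≤ C * (n : ℝ) ^ (a - 1) * n.factorial := by
  set r : ℕ → ℝ := fun n => poch a n / ((n : ℝ) ^ (a - 1) * n.factorial) with hr
  have hG := Real.GammaSeq_tendsto_Gamma a
  have hΓ := Real.Gamma_pos_of_pos ha
  have hrat : Tendsto (fun n : ℕ => (n : ℝ) / (n + a)) atTop (𝓝 1) :=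
    tendsto_natCast_div_add_atTop a
  have hlim : Tendsto r atTop (𝓝 (1 / Gamma a)) := by
    refine (hrat.div hG hΓ.ne').congr' ?_
    filter_upwards [eventually_ge_atTop 1] with n hn
    have hn' : (0 : ℝ) < n := by exact_mod_cast hn
    have hp := poch_pos ha n
    have e : ∏ j ∈ range (n + 1), (a + j) = poch a n * (a + n) := by rw [← poch_succ]; rfl
    have e2 : (n : ℝ) ^ a = (n : ℝ) ^ (a - 1) * n := by
      rw [rpow_sub_one hn'.ne']; field_simp
    have h0 : (0 : ℝ) < (n : ℝ) ^ (a - 1) := by positivity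
    have h1 : (0 : ℝ) < a + n := by positivity
    simp only [hr, Pi.div_apply]
    rw [GammaSeq, e, e2, add_comm (n : ℝ) a]
    field_simp
  obtain ⟨C, hC⟩ := hlim.bddAbove_range
  obtain ⟨D, hD⟩ := (hlim.inv₀ (by positivity)).bddAbove_range
  have hpos : ∀ n : ℕ, 1 ≤ n → 0 < (n : ℝ) ^ (a - 1) * n.factorial := fun n hn => by
    have hn' : (0 : ℝ) < n := by exact_mod_cast hn
    positivity
  have hrpos : ∀ n : ℕ, 1 ≤ n → 0 < r n := fun n hn => div_pos (poch_pos ha n) (hpos n hn)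
  have hC' : ∀ n, r n ≤ C := fun n => hC ⟨n, rfl⟩
  have hD' : ∀ n, (r n)⁻¹ ≤ D := fun n => hD ⟨n, rfl⟩
  have hDpos : 0 < D := (inv_pos.2 (hrpos 1 le_rfl)).trans_le (hD' 1)
  refine ⟨D⁻¹, C, inv_pos.2 hDpos, (hrpos 1 le_rfl).trans_le (hC' 1), fun n hn => ?_⟩
  have e : poch a n = r n * ((n : ℝ) ^ (a - 1) * n.factorial) :=
    (div_mul_cancel₀ _ (hpos n hn).ne').symm
  rw [e, mul_assoc, mul_assoc]
  exact ⟨mul_le_mul_of_nonneg_right (inv_le_of_inv_le₀ (hrpos n hn) (hD' n)) (hpos n hn).le,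
    mul_le_mul_of_nonneg_right (hC' n) (hpos n hn).le⟩

/-- The value of the Gegenbauer polynomial at `t`. -/
noncomputable def gegV (n : ℕ) (l t : ℝ) : ℝ := (gegPoly n l).eval t

/-- The derivative of the Gegenbauer polynomial at `t`. -/
noncomputable def gegD (n : ℕ) (l t : ℝ) : ℝ := (gegPoly n l).derivative.eval t

/-- The quadratic energy `n(n+2l) G² + (1-t²) G'²` of the Gegenbauer equation. -/
noncomputable def gegQ (n : ℕ) (l t : ℝ) : ℝ :=
  n * (n + 2 * l) * gegV n l t ^ 2 + (1 - t ^ 2) * gegD n l t ^ 2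

theorem hasDerivAt_gegV (n : ℕ) (l t : ℝ) : HasDerivAt (gegV n l) (gegD n l t) t :=
  (gegPoly n l).hasDerivAt t

theorem continuous_gegV (n : ℕ) (l : ℝ) : Continuous (gegV n l) := (gegPoly n l).continuous

theorem exists_hasDerivAt_gegD (n : ℕ) (l t : ℝ) : ∃ g2 : ℝ, HasDerivAt (gegD n l) g2 t ∧
    (1 - t ^ 2) * g2 = (2 * l + 1) * t * gegD n l t - n * (n + 2 * l) * gegV n l t :=
  ⟨_, (gegPoly n l).derivative.hasDerivAt t, by
    have := gegPoly_ode n l t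
    rw [gegD, gegV]; linarith⟩

theorem hasDerivAt_gegQ (n : ℕ) (l t : ℝ) :
    HasDerivAt (gegQ n l) (4 * l * t * gegD n l t ^ 2) t := by
  obtain ⟨g2, h2, e2⟩ := exists_hasDerivAt_gegD n l t
  have h1 := hasDerivAt_gegV n l t
  have hs : HasDerivAt (fun t : ℝ => 1 - t ^ 2) (-(2 * t)) t := by
    simpa using ((hasDerivAt_pow 2 t).const_sub 1)
  refine (((h1.pow 2).const_mul ((n : ℝ) * (n + 2 * l))).add (hs.mul (h2.pow 2))).congr_deriv ?_
  norm_num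
  linear_combination (2 * gegD n l t) * e2

theorem gegQ_nonneg {n : ℕ} {l t : ℝ} (hl : 0 < l) (ht : t ^ 2 ≤ 1) : 0 ≤ gegQ n l t := by
  have : 0 ≤ 1 - t ^ 2 := by linarith
  unfold gegQ; positivity

theorem gegQ_le_one {n : ℕ} {l t : ℝ} (hl : 0 < l) (h0 : 0 ≤ t) (h1 : t ≤ 1) :
    gegQ n l t ≤ n * (n + 2 * l) * gegV n l 1 ^ 2 := by
  have hmono : MonotoneOn (gegQ n l) (Set.Icc 0 1) := by
    refine monotoneOn_of_deriv_nonneg (convex_Icc 0 1)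
      (fun x _ => (hasDerivAt_gegQ n l x).continuousAt.continuousWithinAt)
      (fun x _ => (hasDerivAt_gegQ n l x).differentiableAt.differentiableWithinAt) fun x hx => ?_
    rw [interior_Icc] at hx
    rw [(hasDerivAt_gegQ n l x).deriv]
    have := hx.1
    positivity
  have := hmono ⟨h0, h1⟩ ⟨zero_le_one, le_rfl⟩ h1
  refine this.trans_eq ?_
  simp [gegQ]

theorem gegQ_neg (n : ℕ) (l t : ℝ) : gegQ n l (-t) = gegQ n l t := by
  have hV : ∀ t, gegV n l (-t) = (-1) ^ n * gegV n l t := eval_gegPoly_neg n l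
  have hD : gegD n l (-t) = -((-1) ^ n * gegD n l t) := by
    have h1 : HasDerivAt (fun t => gegV n l (-t)) (gegD n l (-t) * (-1)) t :=
      HasDerivAt.comp t (hasDerivAt_gegV n l (-t)) (hasDerivAt_neg t)
    have h2 : HasDerivAt (fun t => gegV n l (-t)) ((-1) ^ n * gegD n l t) t := by
      simp only [hV]
      exact (hasDerivAt_gegV n l t).const_mul _
    have := h1.unique h2
    linarith
  have h1 : ((-1 : ℝ) ^ n) ^ 2 = 1 := by rw [← pow_mul, mul_comm, pow_mul]; simp
  rw [gegQ, gegQ, hV, hD, neg_sq, neg_sq, mul_pow, mul_pow, h1]; ring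

theorem two_mul_abs_gegV_mul_gegD_le {n : ℕ} {l t : ℝ} (hl : 0 < l) (ht : t ^ 2 < 1) :
    2 * (|gegV n l t * gegD n l t| * √(n * (n + 2 * l) * (1 - t ^ 2))) ≤ gegQ n l t := by
  have hs : 0 ≤ 1 - t ^ 2 := by linarith
  have hL : (0 : ℝ) ≤ n * (n + 2 * l) := by positivity
  have h := two_mul_le_add_sq (√(n * (n + 2 * l)) * |gegV n l t|) (√(1 - t ^ 2) * |gegD n l t|)
  rw [mul_pow, mul_pow, sq_sqrt hs, sq_sqrt hL, sq_abs, sq_abs] at h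
  rw [Real.sqrt_mul hL, abs_mul, gegQ]
  linarith

/-- The modified energy, whose logarithmic derivative is small away from the endpoints. -/
noncomputable def gegE (n : ℕ) (l t : ℝ) : ℝ :=
  (1 - t ^ 2) ^ l * (gegQ n l t - 2 * l * t * (gegV n l t * gegD n l t))

theorem hasDerivAt_gegE (n : ℕ) (l : ℝ) {t : ℝ} (ht : t ^ 2 < 1) :
    HasDerivAt (gegE n l) (-(2 * l * (1 - t ^ 2) ^ (l - 1) * (gegV n l t * gegD n l t))) t := by
  obtain ⟨g2, h2, e2⟩ := exists_hasDerivAt_gegD n l t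
  have h1 := hasDerivAt_gegV n l t
  have hs0 : 0 < 1 - t ^ 2 := by linarith
  have hs : HasDerivAt (fun t : ℝ => 1 - t ^ 2) (-(2 * t)) t := by
    simpa using ((hasDerivAt_pow 2 t).const_sub 1)
  have hsl := hs.rpow_const (p := l) (Or.inl hs0.ne')
  have ht1 := ((hasDerivAt_id t).const_mul (2 * l)).mul (h1.mul h2)
  refine (hsl.mul ((hasDerivAt_gegQ n l t).sub ht1)).congr_deriv ?_
  have e : (1 - t ^ 2) ^ l = (1 - t ^ 2) ^ (l - 1) * (1 - t ^ 2) := by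
    rw [rpow_sub_one hs0.ne']; field_simp
  rw [e]
  simp only [id, Pi.mul_apply, Pi.sub_apply, gegQ]
  linear_combination (-(2 * l * t * (1 - t ^ 2) ^ (l - 1) * gegV n l t)) * e2


theorem abs_gegV_mul_gegD_le {n : ℕ} {l t : ℝ} (hn : 1 ≤ n) (hl : 0 < l) (ht : t ^ 2 < 1) :
    2 * (|gegV n l t * gegD n l t| * (n * √(1 - t ^ 2))) ≤ gegQ n l t := by
  refine le_trans ?_ (two_mul_abs_gegV_mul_gegD_le hl ht)
  have hs : 0 ≤ 1 - t ^ 2 := by linarith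
  gcongr
  refine Real.le_sqrt_of_sq_le ?_
  rw [mul_pow, sq_sqrt hs]
  have : (0 : ℝ) ≤ n * (2 * l) := by positivity
  gcongr
  nlinarith

theorem gegE_bounds {n : ℕ} {l t : ℝ} (hn : 1 ≤ n) (hl : 0 < l) (h0 : 0 ≤ t) (ht : t ^ 2 < 1)
    (hnt : (2 * l) ^ 2 ≤ (n : ℝ) ^ 2 * (1 - t ^ 2)) :
    (1 - t ^ 2) ^ l * gegQ n l t ≤ 2 * gegE n l t ∧
      gegE n l t ≤ 2 * ((1 - t ^ 2) ^ l * gegQ n l t) := by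
  have hs : 0 < 1 - t ^ 2 := by linarith
  have hsl : 0 < (1 - t ^ 2) ^ l := rpow_pos_of_pos hs l
  have h1 := abs_gegV_mul_gegD_le hn hl ht
  have hQ := gegQ_nonneg (n := n) hl ht.le
  have h2 : 2 * l ≤ n * √(1 - t ^ 2) := by
    have := Real.le_sqrt_of_sq_le hnt
    rwa [Real.sqrt_mul (by positivity), Real.sqrt_sq (by positivity)] at this
  have ht1 : t ≤ 1 := by nlinarith
  have h3 : |2 * l * t * (gegV n l t * gegD n l t)| ≤ gegQ n l t / 2 := by
    rw [abs_mul, abs_of_nonneg (by positivity : 0 ≤ 2 * l * t)]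
    have ha := abs_nonneg (gegV n l t * gegD n l t)
    have h4 : 2 * l * t ≤ n * √(1 - t ^ 2) := by nlinarith
    nlinarith [mul_le_mul_of_nonneg_right h4 ha]
  have h4 := abs_le.1 h3
  unfold gegE
  constructor
  · nlinarith [mul_le_mul_of_nonneg_left h4.2 hsl.le]
  · nlinarith [mul_le_mul_of_nonneg_left h4.1 hsl.le, mul_nonneg hsl.le hQ]

theorem gegE_le {n : ℕ} {l t t1 : ℝ} (hn : 1 ≤ n) (hl : 0 < l) (h0 : 0 ≤ t) (htt : t ≤ t1)
    (ht1 : t1 ^ 2 < 1) (hnt : (2 * l) ^ 2 ≤ (n : ℝ) ^ 2 * (1 - t1 ^ 2)) :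
    gegE n l t ≤ exp 1 * gegE n l t1 := by
  have hn' : (1 : ℝ) ≤ n := by exact_mod_cast hn
  set h : ℝ → ℝ := fun t => 2 * l / n * (t * (1 - t ^ 2) ^ (-(1 / 2) : ℝ)) with hh
  have hsub : ∀ x, 0 ≤ x → x ≤ t1 → x ^ 2 < 1 ∧ (2 * l) ^ 2 ≤ (n : ℝ) ^ 2 * (1 - x ^ 2) := by
    intro x hx hx1
    have : x ^ 2 ≤ t1 ^ 2 := by gcongr
    refine ⟨by linarith, hnt.trans ?_⟩
    gcongr
  have hEnn : ∀ x, 0 ≤ x → x ≤ t1 → 0 ≤ gegE n l x := by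
    intro x hx hx1
    obtain ⟨a, b⟩ := hsub x hx hx1
    have h1 := (gegE_bounds hn hl hx a b).1
    have h2 := gegQ_nonneg (n := n) hl a.le
    have h3 : 0 < (1 - x ^ 2) ^ l := rpow_pos_of_pos (by linarith) l
    nlinarith [mul_nonneg h3.le h2]
  have hder : ∀ x, x ^ 2 < 1 → HasDerivAt h (2 * l / n * (1 - x ^ 2) ^ (-(3 / 2) : ℝ)) x := by
    intro x hx
    have hs0 : 0 < 1 - x ^ 2 := by linarith
    have hs : HasDerivAt (fun t : ℝ => 1 - t ^ 2) (-(2 * x)) x := by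
      simpa using ((hasDerivAt_pow 2 x).const_sub 1)
    have hsl := hs.rpow_const (p := -(1 / 2)) (Or.inl hs0.ne')
    refine (((hasDerivAt_id x).mul hsl).const_mul (2 * l / n)).congr_deriv ?_
    have e : (1 - x ^ 2) ^ (-(1 / 2) : ℝ) = (1 - x ^ 2) ^ (-(3 / 2) : ℝ) * (1 - x ^ 2) := by
      rw [show (-(1 / 2) : ℝ) = -(3 / 2) + 1 by norm_num, rpow_add_one hs0.ne']
    rw [show (-(1 / 2) - 1 : ℝ) = -(3 / 2) by norm_num, e]
    simp only [id]
    ring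
  have hmono : MonotoneOn (fun x => gegE n l x * exp (h x)) (Set.Icc 0 t1) := by
    have hd : ∀ x, x ^ 2 < 1 → HasDerivAt (fun x => gegE n l x * exp (h x)) _ x :=
      fun x hx => (hasDerivAt_gegE n l hx).mul (hder x hx).exp
    refine monotoneOn_of_deriv_nonneg (convex_Icc 0 t1)
      (fun x hx => (hd x (hsub x hx.1 hx.2).1).continuousAt.continuousWithinAt)
      (fun x hx => ?_) fun x hx => ?_
    · rw [interior_Icc] at hx
      exact (hd x (hsub x hx.1.le hx.2.le).1).differentiableAt.differentiableWithinAt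
    rw [interior_Icc] at hx
    obtain ⟨a, b⟩ := hsub x hx.1.le hx.2.le
    rw [(hd x a).deriv]
    have hs0 : 0 < 1 - x ^ 2 := by linarith
    have h1 := abs_gegV_mul_gegD_le hn hl a
    have h2 := (gegE_bounds hn hl hx.1.le a b).1
    have h3 : (1 - x ^ 2) ^ (l - 1) = (1 - x ^ 2) ^ l * ((1 - x ^ 2) ^ (-(3 / 2) : ℝ)) *
        √(1 - x ^ 2) := by
      rw [sqrt_eq_rpow, ← rpow_add hs0, ← rpow_add hs0]; congr 1; ring
    have h4 : 0 < (1 - x ^ 2) ^ (-(3 / 2) : ℝ) := rpow_pos_of_pos hs0 _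
    have h5 : 0 < (1 - x ^ 2) ^ l := rpow_pos_of_pos hs0 _
    have h6 : n * |2 * l * (1 - x ^ 2) ^ (l - 1) * (gegV n l x * gegD n l x)| ≤
        2 * l * (1 - x ^ 2) ^ (-(3 / 2) : ℝ) * gegE n l x := by
      rw [h3, abs_mul, abs_of_nonneg (by positivity)]
      calc _ = l * (1 - x ^ 2) ^ (-(3 / 2) : ℝ) * ((1 - x ^ 2) ^ l *
            (2 * (|gegV n l x * gegD n l x| * (n * √(1 - x ^ 2))))) := by ring
        _ ≤ l * (1 - x ^ 2) ^ (-(3 / 2) : ℝ) * ((1 - x ^ 2) ^ l * gegQ n l x) := by gcongr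
        _ ≤ l * (1 - x ^ 2) ^ (-(3 / 2) : ℝ) * (2 * gegE n l x) := by gcongr
        _ = _ := by ring
    have h7 : |2 * l * (1 - x ^ 2) ^ (l - 1) * (gegV n l x * gegD n l x)| ≤
        gegE n l x * (2 * l / n * (1 - x ^ 2) ^ (-(3 / 2) : ℝ)) := by
      rw [show gegE n l x * (2 * l / n * (1 - x ^ 2) ^ (-(3 / 2) : ℝ)) =
        (2 * l * (1 - x ^ 2) ^ (-(3 / 2) : ℝ) * gegE n l x) / n by ring, le_div_iff₀ (by linarith)]
      linarith
    have h8 := (abs_le.1 h7).2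
    have h9 := exp_pos (h x)
    nlinarith
  have hm := hmono ⟨h0, htt⟩ ⟨h0.trans htt, le_rfl⟩ htt
  simp only at hm
  have hh0 : 0 ≤ h t := by
    have : 0 < 1 - t ^ 2 := by linarith [(hsub t h0 htt).1]
    positivity
  have hh1 : h t1 ≤ 1 := by
    have hs0 : 0 < 1 - t1 ^ 2 := by linarith
    have h2 : 2 * l ≤ n * √(1 - t1 ^ 2) := by
      have := Real.le_sqrt_of_sq_le hnt
      rwa [Real.sqrt_mul (by positivity), Real.sqrt_sq (by positivity)] at this
    have hs1 : 0 < √(1 - t1 ^ 2) := Real.sqrt_pos.2 hs0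
    have ht1' : t1 ≤ 1 := by nlinarith
    simp only [hh]
    rw [rpow_neg hs0.le, ← sqrt_eq_rpow]
    rw [show 2 * l / n * (t1 * (√(1 - t1 ^ 2))⁻¹) = 2 * l * t1 / (n * √(1 - t1 ^ 2)) by
      field_simp, div_le_one (by positivity)]
    nlinarith
  have e1 := hEnn t h0 htt
  have e2 := hEnn t1 (h0.trans htt) le_rfl
  calc gegE n l t ≤ gegE n l t * exp (h t) := le_mul_of_one_le_right e1 (one_le_exp hh0)
    _ ≤ gegE n l t1 * exp (h t1) := hm
    _ ≤ gegE n l t1 * exp 1 := by gcongr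
    _ = _ := mul_comm _ _

theorem exists_gegV_one_le {l : ℝ} (hl : 0 < l) : ∃ C : ℝ, 0 < C ∧ ∀ n : ℕ, 1 ≤ n →
    n * (n + 2 * l) * gegV n l 1 ^ 2 ≤ C * (n : ℝ) ^ (4 * l) := by
  obtain ⟨_, C, _, hC, h⟩ := exists_poch_bounds (show 0 < 2 * l by positivity)
  refine ⟨(1 + 2 * l) * C ^ 2, by positivity, fun n hn => ?_⟩
  have hn' : (1 : ℝ) ≤ n := by exact_mod_cast hn
  have hn0 : (0 : ℝ) < n := by linarith
  have h1 : gegV n l 1 ≤ C * (n : ℝ) ^ (2 * l - 1) := by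
    rw [gegV, eval_gegPoly_one hl, div_le_iff₀ (by positivity)]
    exact (h n hn).2
  have h0 : 0 ≤ gegV n l 1 := by
    rw [gegV, eval_gegPoly_one hl]
    have := poch_pos (show 0 < 2 * l by positivity) n
    positivity
  have e : (n : ℝ) ^ (4 * l) = n ^ 2 * ((n : ℝ) ^ (2 * l - 1)) ^ 2 := by
    rw [← rpow_natCast, ← rpow_natCast, ← rpow_mul hn0.le, ← rpow_add hn0]
    congr 1; push_cast; ring
  calc n * (n + 2 * l) * gegV n l 1 ^ 2
      ≤ n * (n + 2 * l * n) * (C * (n : ℝ) ^ (2 * l - 1)) ^ 2 := by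
        have : 2 * l ≤ 2 * l * n := le_mul_of_one_le_right (by positivity) hn'
        gcongr
    _ = _ := by rw [e]; ring

theorem exists_gegQ_bound {l : ℝ} (hl : 0 < l) : ∃ C : ℝ, 0 < C ∧ ∀ n : ℕ, 1 ≤ n →
    ∀ t : ℝ, t ^ 2 ≤ 1 → (1 - t ^ 2 + 1 / (n : ℝ) ^ 2) ^ l * gegQ n l t ≤ C * (n : ℝ) ^ (2 * l) := by
  obtain ⟨K, hK, h⟩ := exists_gegV_one_le hl
  set B : ℝ := (4 * l ^ 2 + 1) ^ l * K with hB
  set D : ℝ := (1 + 1 / (4 * l ^ 2)) ^ l * (4 * exp 1 * (4 * l ^ 2) ^ l * K) with hD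
  have hB0 : 0 < B := by positivity
  have hD0 : 0 < D := by positivity
  have main : ∀ n : ℕ, 1 ≤ n → ∀ t : ℝ, 0 ≤ t → t ^ 2 ≤ 1 →
      (1 - t ^ 2 + 1 / (n : ℝ) ^ 2) ^ l * gegQ n l t ≤ (B + D) * (n : ℝ) ^ (2 * l) := by
    intro n hn t h0 ht
    have hn' : (1 : ℝ) ≤ n := by exact_mod_cast hn
    have hn0 : (0 : ℝ) < n := by linarith
    have ht1 : t ≤ 1 := by nlinarith
    have hQ := gegQ_nonneg (n := n) hl ht
    have hpow : ((1 : ℝ) / (n : ℝ) ^ 2) ^ l * (n : ℝ) ^ (4 * l) = (n : ℝ) ^ (2 * l) := by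
      rw [one_div, ← rpow_natCast, ← rpow_neg hn0.le, ← rpow_mul hn0.le, ← rpow_add hn0]
      congr 1; push_cast; ring
    have hs : 0 ≤ 1 - t ^ 2 := by linarith
    have hr : (0 : ℝ) < 1 / (n : ℝ) ^ 2 := by positivity
    rw [add_mul]
    by_cases hc : (n : ℝ) ^ 2 * (1 - t ^ 2) < (2 * l) ^ 2
    · have h1 : 1 - t ^ 2 + 1 / (n : ℝ) ^ 2 ≤ (4 * l ^ 2 + 1) * (1 / (n : ℝ) ^ 2) := by
        have : 1 - t ^ 2 ≤ (2 * l) ^ 2 / (n : ℝ) ^ 2 := by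
          rw [le_div_iff₀ (by positivity)]; linarith
        calc _ ≤ (2 * l) ^ 2 / (n : ℝ) ^ 2 + 1 / (n : ℝ) ^ 2 := by gcongr
          _ = _ := by ring
      calc (1 - t ^ 2 + 1 / (n : ℝ) ^ 2) ^ l * gegQ n l t
          ≤ ((4 * l ^ 2 + 1) * (1 / (n : ℝ) ^ 2)) ^ l * (K * (n : ℝ) ^ (4 * l)) := by
            gcongr
            exact (gegQ_le_one hl h0 ht1).trans (h n hn)
        _ = B * (n : ℝ) ^ (2 * l) := by
            rw [mul_rpow (by positivity) hr.le, ← hpow]; ring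
        _ ≤ _ := le_add_of_nonneg_right (by positivity)
    · push Not at hc
      have hln : (2 * l) ^ 2 / (n : ℝ) ^ 2 ≤ 1 - t ^ 2 := by
        rw [div_le_iff₀ (by positivity)]; linarith
      have hln0 : 0 < (2 * l) ^ 2 / (n : ℝ) ^ 2 := by positivity
      set t1 := √(1 - (2 * l) ^ 2 / (n : ℝ) ^ 2) with ht1d
      have ht1sq : t1 ^ 2 = 1 - (2 * l) ^ 2 / (n : ℝ) ^ 2 := Real.sq_sqrt (by nlinarith)
      have htt : t ≤ t1 := Real.le_sqrt_of_sq_le (by linarith)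
      have e1 : (1 : ℝ) - t1 ^ 2 = (2 * l) ^ 2 / (n : ℝ) ^ 2 := by rw [ht1sq]; ring
      have hnt : (2 * l) ^ 2 ≤ (n : ℝ) ^ 2 * (1 - t1 ^ 2) := by
        rw [e1]; field_simp; rfl
      have ht1lt : t1 ^ 2 < 1 := by linarith
      have h2 := (gegE_bounds hn hl h0 (by linarith) hc).1
      have h3 := gegE_le hn hl h0 htt ht1lt hnt
      have h4 := (gegE_bounds hn hl (h0.trans htt) ht1lt hnt).2
      have h5 : gegQ n l t1 ≤ K * (n : ℝ) ^ (4 * l) :=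
        (gegQ_le_one hl (h0.trans htt) (by nlinarith [h0.trans htt])).trans (h n hn)
      have h6 : (1 - t1 ^ 2) ^ l * (n : ℝ) ^ (4 * l) = (4 * l ^ 2) ^ l * (n : ℝ) ^ (2 * l) := by
        rw [e1, show (2 * l) ^ 2 / (n : ℝ) ^ 2 = 4 * l ^ 2 * (1 / (n : ℝ) ^ 2) by ring,
          mul_rpow (by positivity) hr.le, mul_assoc, hpow]
      have h7 : (1 - t ^ 2) ^ l * gegQ n l t ≤
          4 * exp 1 * (4 * l ^ 2) ^ l * K * (n : ℝ) ^ (2 * l) := by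
        calc (1 - t ^ 2) ^ l * gegQ n l t ≤ 2 * (exp 1 * (2 * ((1 - t1 ^ 2) ^ l *
              (K * (n : ℝ) ^ (4 * l))))) := by
              refine h2.trans ?_
              gcongr
              refine h3.trans ?_
              gcongr
              refine h4.trans ?_
              have : 0 ≤ 1 - t1 ^ 2 := by linarith
              gcongr
          _ = 4 * exp 1 * K * ((1 - t1 ^ 2) ^ l * (n : ℝ) ^ (4 * l)) := by ring
          _ = _ := by rw [h6]; ring
      have h8 : 1 - t ^ 2 + 1 / (n : ℝ) ^ 2 ≤ (1 + 1 / (4 * l ^ 2)) * (1 - t ^ 2) := by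
        have : 1 / (n : ℝ) ^ 2 ≤ 1 / (4 * l ^ 2) * (1 - t ^ 2) := by
          calc 1 / (n : ℝ) ^ 2 = 1 / (4 * l ^ 2) * ((2 * l) ^ 2 / (n : ℝ) ^ 2) := by
                field_simp; norm_num
            _ ≤ _ := by gcongr
        linarith
      calc (1 - t ^ 2 + 1 / (n : ℝ) ^ 2) ^ l * gegQ n l t
          ≤ ((1 + 1 / (4 * l ^ 2)) * (1 - t ^ 2)) ^ l * gegQ n l t := by gcongr
        _ = (1 + 1 / (4 * l ^ 2)) ^ l * ((1 - t ^ 2) ^ l * gegQ n l t) := by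
            rw [mul_rpow (by positivity) hs]; ring
        _ ≤ (1 + 1 / (4 * l ^ 2)) ^ l * (4 * exp 1 * (4 * l ^ 2) ^ l * K * (n : ℝ) ^ (2 * l)) := by
            gcongr
        _ = D * (n : ℝ) ^ (2 * l) := by rw [hD]; ring
        _ ≤ _ := le_add_of_nonneg_left (by positivity)
  refine ⟨B + D, by positivity, fun n hn t ht => ?_⟩
  rcases le_total 0 t with h0 | h0
  · exact main n hn t h0 ht
  · have := main n hn (-t) (by linarith) (by rwa [neg_sq])
    rwa [gegQ_neg, neg_sq] at this

/-- Pointwise bounds for the Gegenbauer polynomial and its derivative. -/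
theorem exists_gegV_bound {l : ℝ} (hl : 0 < l) : ∃ A : ℝ, 0 < A ∧ ∀ n : ℕ, 1 ≤ n →
    ∀ t : ℝ, t ^ 2 ≤ 1 →
      |gegV n l t| ≤ A * (n : ℝ) ^ (l - 1) * (1 - t ^ 2 + 1 / (n : ℝ) ^ 2) ^ (-(l / 2)) ∧
      (1 - t ^ 2) * |gegD n l t| ≤
        A * (n : ℝ) ^ l * (1 - t ^ 2 + 1 / (n : ℝ) ^ 2) ^ ((1 - l) / 2) := by
  obtain ⟨C, hC, h⟩ := exists_gegQ_bound hl
  refine ⟨√C, Real.sqrt_pos.2 hC, fun n hn t ht => ?_⟩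
  have hn' : (1 : ℝ) ≤ n := by exact_mod_cast hn
  have hn0 : (0 : ℝ) < n := by linarith
  have hs : 0 ≤ 1 - t ^ 2 := by linarith
  have hQ := h n hn t ht
  have hrs : 1 - t ^ 2 ≤ 1 - t ^ 2 + 1 / (n : ℝ) ^ 2 := le_add_of_nonneg_right (by positivity)
  have hr : 0 < 1 - t ^ 2 + 1 / (n : ℝ) ^ 2 := by positivity
  generalize 1 - t ^ 2 + 1 / (n : ℝ) ^ 2 = r at *
  have hQ' : gegQ n l t ≤ C * (n : ℝ) ^ (2 * l) * r ^ (-l) := by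
    rw [rpow_neg hr.le, ← div_eq_mul_inv, le_div_iff₀ (by positivity)]
    linarith
  have hL : (n : ℝ) ^ 2 ≤ n * (n + 2 * l) := by
    have : 0 < n * (2 * l) := by positivity
    nlinarith
  unfold gegQ at hQ'
  have h1 : 0 ≤ (1 - t ^ 2) * gegD n l t ^ 2 := by positivity
  have h2 : 0 ≤ n * (n + 2 * l) * gegV n l t ^ 2 := by positivity
  have hsC : √C ^ 2 = C := Real.sq_sqrt hC.le
  constructor
  · refine abs_le_of_sq_le_sq ?_ (by positivity)
    have e : (n : ℝ) ^ (2 * l) = ((n : ℝ) ^ (l - 1)) ^ 2 * n ^ 2 := by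
      rw [← rpow_natCast, ← rpow_natCast, ← rpow_mul hn0.le, ← rpow_add hn0]
      congr 1; push_cast; ring
    have e2 : r ^ (-l) = (r ^ (-(l / 2))) ^ 2 := by
      rw [← rpow_natCast, ← rpow_mul hr.le]; congr 1; push_cast; ring
    rw [mul_pow, mul_pow, hsC, ← e2]
    have h3 : (n : ℝ) ^ 2 * gegV n l t ^ 2 ≤ n * (n + 2 * l) * gegV n l t ^ 2 := by gcongr
    rw [e] at hQ'
    refine le_of_mul_le_mul_left ?_ (show (0 : ℝ) < n ^ 2 by positivity)
    linarith
  · refine (pow_le_pow_iff_left₀ (by positivity) (by positivity) two_ne_zero).1 ?_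
    have e : (n : ℝ) ^ (2 * l) = ((n : ℝ) ^ l) ^ 2 := by
      rw [← rpow_natCast, ← rpow_mul hn0.le]; congr 1; push_cast; ring
    have e2 : r ^ (-l) * r = (r ^ ((1 - l) / 2)) ^ 2 := by
      rw [← rpow_add_one hr.ne', ← rpow_natCast, ← rpow_mul hr.le]; congr 1; push_cast; ring
    rw [mul_pow, mul_pow, mul_pow, hsC, ← e2, ← e, sq_abs]
    calc (1 - t ^ 2) ^ 2 * gegD n l t ^ 2 = (1 - t ^ 2) * ((1 - t ^ 2) * gegD n l t ^ 2) := by ring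
      _ ≤ r * (C * (n : ℝ) ^ (2 * l) * r ^ (-l)) :=
        mul_le_mul hrs (by linarith) h1 hr.le
      _ = _ := by ring

/-- An oscillatory integral bound: absolute estimates on `[0, D]`, integration by parts on
`[D, 1]`. -/
theorem abs_integral_mul_le_of_antideriv {g W ω ω' : ℝ → ℝ} {k γ D A B K : ℝ} (hk : 0 < k)
    (hγ : 0 ≤ γ) (hD : 0 < D) (hA : 0 ≤ A) (hB : 0 ≤ B) (hK : 0 ≤ K) (hg : Continuous g)
    (hW : ∀ s, HasDerivAt W (g s) s) (hω : ∀ s ∈ Set.Ioc (0 : ℝ) 1, HasDerivAt ω (ω' s) s)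
    (hω' : ContinuousOn ω' (Set.Ioc 0 1))
    (bg : ∀ s ∈ Set.Ioc (0 : ℝ) 1, |g s| ≤ A * (D + s) ^ (-(k + γ)))
    (bW : ∀ s ∈ Set.Ioc (0 : ℝ) 1, |W s| ≤ B * (D + s) ^ (1 / 2 - (k + γ)))
    (bω : ∀ s ∈ Set.Ioc (0 : ℝ) 1, |ω s| ≤ K * s ^ (k - 1))
    (bω' : ∀ s ∈ Set.Ioc (0 : ℝ) 1, |ω' s| ≤ K * s ^ (k - 2)) :
    |∫ s in (0 : ℝ)..1, ω s * g s| ≤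
      A * K / k * D ^ (-γ) + 8 * (B * K) * D ^ (-(γ + 1 / 2)) := by
  have hωc : ContinuousOn ω (Set.Ioc 0 1) := fun s hs => (hω s hs).continuousAt.continuousWithinAt
  have hpt : ∀ s ∈ Set.Ioc (0 : ℝ) 1, ‖ω s * g s‖ ≤ A * K * D ^ (-(k + γ)) * s ^ (k - 1) := by
    intro s hs
    have hs0 := hs.1
    rw [norm_mul, Real.norm_eq_abs, Real.norm_eq_abs]
    calc |ω s| * |g s| ≤ (K * s ^ (k - 1)) * (A * D ^ (-(k + γ))) := by
          refine mul_le_mul (bω s hs) ((bg s hs).trans ?_) (abs_nonneg _) (by positivity)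
          refine mul_le_mul_of_nonneg_left ?_ hA
          exact rpow_le_rpow_of_nonpos hD (by linarith) (by linarith)
      _ = _ := by ring
  have hpow : ∀ c, 0 ≤ c → IntervalIntegrable
      (fun s : ℝ => A * K * D ^ (-(k + γ)) * s ^ (k - 1)) volume 0 c := fun c _ =>
    (intervalIntegral.intervalIntegrable_rpow' (by linarith)).const_mul _
  have hii : IntervalIntegrable (fun s => ω s * g s) volume 0 1 := by
    rw [intervalIntegrable_iff_integrableOn_Ioc_of_le zero_le_one]
    refine Integrable.mono' (g := fun s : ℝ => A * K * D ^ (-(k + γ)) * s ^ (k - 1)) ?_ ?_ ?_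
    · have := hpow 1 zero_le_one
      rwa [intervalIntegrable_iff_integrableOn_Ioc_of_le zero_le_one] at this
    · exact (hωc.mul hg.continuousOn).aestronglyMeasurable measurableSet_Ioc
    · exact (ae_restrict_mem measurableSet_Ioc).mono hpt
  have near : ∀ c, 0 < c → c ≤ 1 → c ≤ D →
      |∫ s in (0 : ℝ)..c, ω s * g s| ≤ A * K / k * D ^ (-γ) := by
    intro c hc hc1 hcD
    have h1 := intervalIntegral.norm_integral_le_of_norm_le hc.le
      (Filter.Eventually.of_forall fun s hs => hpt s ⟨hs.1, hs.2.trans hc1⟩) (hpow c hc.le)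
    rw [Real.norm_eq_abs, intervalIntegral.integral_const_mul,
      integral_rpow (Or.inl (by linarith)), sub_add_cancel, zero_rpow hk.ne', sub_zero] at h1
    refine h1.trans ?_
    calc A * K * D ^ (-(k + γ)) * (c ^ k / k) ≤ A * K * D ^ (-(k + γ)) * (D ^ k / k) := by gcongr
      _ = A * K / k * (D ^ (-(k + γ)) * D ^ k) := by ring
      _ = _ := by rw [← rpow_add hD]; congr 2; ring
  have hfar0 : 0 ≤ 8 * (B * K) * D ^ (-(γ + 1 / 2)) := by positivity
  rcases le_or_gt 1 D with h1D | hD1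
  · linarith [near 1 zero_lt_one le_rfl h1D]
  have hsub1 : IntervalIntegrable (fun s => ω s * g s) volume 0 D :=
    hii.mono_set (by
      rw [Set.uIcc_of_le hD.le, Set.uIcc_of_le zero_le_one]; exact Set.Icc_subset_Icc_right hD1.le)
  have hsub2 : IntervalIntegrable (fun s => ω s * g s) volume D 1 :=
    hii.mono_set (by
      rw [Set.uIcc_of_le hD1.le, Set.uIcc_of_le zero_le_one]; exact Set.Icc_subset_Icc_left hD.le)
  have hmem : ∀ s ∈ Set.Icc D 1, s ∈ Set.Ioc (0 : ℝ) 1 := fun s hs => ⟨hD.trans_le hs.1, hs.2⟩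
  have bW' : ∀ s ∈ Set.Icc D 1, |W s| ≤ B * (2 * s ^ (1 / 2 - (k + γ))) := by
    intro s hs
    have hs0 : 0 < s := hD.trans_le hs.1
    refine (bW s (hmem s hs)).trans (mul_le_mul_of_nonneg_left ?_ hB)
    have e1 : (D + s) ^ (1 / 2 : ℝ) ≤ 2 * s ^ (1 / 2 : ℝ) := by
      calc (D + s) ^ (1 / 2 : ℝ) ≤ (4 * s) ^ (1 / 2 : ℝ) := by
            gcongr; linarith [hs.1]
        _ = _ := by
            rw [mul_rpow (by norm_num) hs0.le, ← sqrt_eq_rpow 4,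
              show (4 : ℝ) = 2 ^ 2 by norm_num, Real.sqrt_sq (by norm_num)]
    have e2 : (D + s) ^ (-(k + γ)) ≤ s ^ (-(k + γ)) :=
      rpow_le_rpow_of_nonpos hs0 (by linarith) (by linarith)
    rw [sub_eq_add_neg, rpow_add (by linarith), rpow_add hs0, ← mul_assoc]
    gcongr
  have bnd : ∀ s ∈ Set.Icc D 1, |ω s * W s| ≤ 2 * (B * K) * D ^ (-(γ + 1 / 2)) := by
    intro s hs
    have hs0 : 0 < s := hD.trans_le hs.1
    rw [abs_mul]
    calc |ω s| * |W s| ≤ (K * s ^ (k - 1)) * (B * (2 * s ^ (1 / 2 - (k + γ)))) :=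
          mul_le_mul (bω s (hmem s hs)) (bW' s hs) (abs_nonneg _) (by positivity)
      _ = 2 * (B * K) * (s ^ (k - 1) * s ^ (1 / 2 - (k + γ))) := by ring
      _ = 2 * (B * K) * s ^ (-(γ + 1 / 2)) := by rw [← rpow_add hs0]; congr 2; ring
      _ ≤ _ := by
          refine mul_le_mul_of_nonneg_left ?_ (by positivity)
          exact rpow_le_rpow_of_nonpos hD hs.1 (by linarith)
  have hparts := intervalIntegral.integral_mul_deriv_eq_deriv_mul (a := D) (b := 1) (u := ω) (v := W)
    (u' := ω') (v' := g) (fun s hs => hω s (hmem s (by rwa [Set.uIcc_of_le hD1.le] at hs)))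
    (fun s _ => hW s)
    (ContinuousOn.intervalIntegrable (hω'.mono (by rw [Set.uIcc_of_le hD1.le]; exact hmem)))
    (hg.intervalIntegrable _ _)
  have hrem : |∫ s in D..1, ω' s * W s| ≤ 4 * (B * K) * D ^ (-(γ + 1 / 2)) := by
    have hpt2 : ∀ s ∈ Set.Ioc D 1, ‖ω' s * W s‖ ≤ 2 * (B * K) * D ^ (-γ) * s ^ (-(3 / 2) : ℝ) := by
      intro s hs
      have hs' : s ∈ Set.Icc D 1 := ⟨hs.1.le, hs.2⟩
      have hs0 : 0 < s := hD.trans hs.1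
      rw [Real.norm_eq_abs, abs_mul]
      calc |ω' s| * |W s| ≤ (K * s ^ (k - 2)) * (B * (2 * s ^ (1 / 2 - (k + γ)))) :=
            mul_le_mul (bω' s (hmem s hs')) (bW' s hs') (abs_nonneg _) (by positivity)
        _ = 2 * (B * K) * (s ^ (k - 2) * s ^ (1 / 2 - (k + γ))) := by ring
        _ = 2 * (B * K) * (s ^ (-γ) * s ^ (-(3 / 2) : ℝ)) := by
            rw [← rpow_add hs0, ← rpow_add hs0]; congr 2; ring
        _ ≤ 2 * (B * K) * (D ^ (-γ) * s ^ (-(3 / 2) : ℝ)) := by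
            have := rpow_le_rpow_of_nonpos hD hs.1.le (neg_nonpos.2 hγ)
            gcongr
        _ = _ := by ring
    have h0 : (0 : ℝ) ∉ Set.uIcc D 1 := by
      rw [Set.uIcc_of_le hD1.le]; exact fun h => absurd h.1 (not_le.2 hD)
    have h1 := intervalIntegral.norm_integral_le_of_norm_le hD1.le
      (Filter.Eventually.of_forall hpt2)
      ((intervalIntegral.intervalIntegrable_rpow (μ := volume) (Or.inr h0)).const_mul _)
    rw [Real.norm_eq_abs, intervalIntegral.integral_const_mul,
      integral_rpow (Or.inr ⟨by norm_num, h0⟩), one_rpow] at h1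
    refine h1.trans ?_
    rw [show (-(3 / 2) + 1 : ℝ) = -(1 / 2) by norm_num]
    calc 2 * (B * K) * D ^ (-γ) * ((1 - D ^ (-(1 / 2) : ℝ)) / -(1 / 2))
        ≤ 2 * (B * K) * D ^ (-γ) * (2 * D ^ (-(1 / 2) : ℝ)) := by
          gcongr
          rw [div_le_iff_of_neg (by norm_num)]; linarith
      _ = 4 * (B * K) * (D ^ (-γ) * D ^ (-(1 / 2) : ℝ)) := by ring
      _ = _ := by rw [← rpow_add hD]; congr 2; ring
  rw [← intervalIntegral.integral_add_adjacent_intervals hsub1 hsub2, hparts]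
  have n1 := abs_le.1 (near D hD hD1.le le_rfl)
  have n2 := abs_le.1 (bnd 1 ⟨hD1.le, le_rfl⟩)
  have n3 := abs_le.1 (bnd D ⟨le_rfl, hD1.le⟩)
  have n4 := abs_le.1 hrem
  rw [abs_le]
  constructor <;> linarith [n1.1, n1.2, n2.1, n2.2, n3.1, n3.2, n4.1, n4.2]

/-- The one-dimensional weight `(1+t)(1-t²)^(κ-1)`. -/
noncomputable def wOne (κ t : ℝ) : ℝ := (1 + t) * (1 - t ^ 2) ^ (κ - 1)

theorem wOne_nonneg {κ t : ℝ} (h0 : -1 ≤ t) (h1 : t ≤ 1) : 0 ≤ wOne κ t := by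
  have : 0 ≤ 1 - t ^ 2 := by nlinarith
  have : 0 ≤ 1 + t := by linarith
  unfold wOne; positivity

theorem measurable_wOne (κ : ℝ) : Measurable (wOne κ) := by
  unfold wOne; fun_prop

theorem integrableOn_wOne {κ : ℝ} (hκ : 0 < κ) :
    IntegrableOn (wOne κ) (Set.Icc (-1) 1) := by
  have h1 : IntervalIntegrable (fun t : ℝ => (1 - t) ^ (κ - 1)) volume (-1) 1 := by
    have := (intervalIntegral.intervalIntegrable_rpow' (a := 2) (b := 0)
      (show -1 < κ - 1 by linarith)).comp_sub_left 1
    norm_num at this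
    exact this
  have h2 : IntervalIntegrable (fun t : ℝ => (1 + t) ^ (κ - 1)) volume (-1) 1 := by
    have := (intervalIntegral.intervalIntegrable_rpow' (a := 0) (b := 2)
      (show -1 < κ - 1 by linarith)).comp_add_left 1
    norm_num at this
    exact this
  have h3 : IntervalIntegrable (fun t : ℝ => 2 * (1 + (1 - t) ^ (κ - 1) + (1 + t) ^ (κ - 1)))
      volume (-1) 1 := ((intervalIntegrable_const.add h1).add h2).const_mul 2
  rw [intervalIntegrable_iff_integrableOn_Icc_of_le (by norm_num)] at h3
  refine Integrable.mono' h3 (measurable_wOne κ).aestronglyMeasurable ?_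
  refine (ae_restrict_mem measurableSet_Icc).mono fun t ht => ?_
  rw [Real.norm_of_nonneg (wOne_nonneg ht.1 ht.2)]
  have ha : 0 ≤ 1 - t := by linarith [ht.2]
  have hb : 0 ≤ 1 + t := by linarith [ht.1]
  have hpa := rpow_nonneg ha (κ - 1)
  have hpb := rpow_nonneg hb (κ - 1)
  have e : 1 - t ^ 2 = (1 - t) * (1 + t) := by ring
  have key : (1 - t ^ 2) ^ (κ - 1) ≤ 1 + (1 - t) ^ (κ - 1) + (1 + t) ^ (κ - 1) := by
    rcases le_or_gt 1 κ with h | h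
    · have : (1 - t ^ 2) ^ (κ - 1) ≤ 1 :=
        rpow_le_one (by rw [e]; positivity) (by nlinarith) (by linarith)
      linarith
    · rcases le_total 0 t with h0 | h0
      · rcases ha.eq_or_lt with h' | h'
        · rw [e, ← h', zero_mul, zero_rpow (by linarith)]; positivity
        · have : (1 - t ^ 2) ^ (κ - 1) ≤ (1 - t) ^ (κ - 1) :=
            rpow_le_rpow_of_nonpos h' (by nlinarith) (by linarith)
          linarith
      · rcases hb.eq_or_lt with h' | h'
        · rw [e, ← h', mul_zero, zero_rpow (by linarith)]; positivity
        · have : (1 - t ^ 2) ^ (κ - 1) ≤ (1 + t) ^ (κ - 1) :=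
            rpow_le_rpow_of_nonpos h' (by nlinarith) (by linarith)
          linarith
  unfold wOne
  exact mul_le_mul (by linarith [ht.2]) key (rpow_nonneg (by rw [e]; positivity) _) (by norm_num)

theorem integrableOn_mul_wOne {κ : ℝ} (hκ : 0 < κ) {f : ℝ → ℝ} (hf : Continuous f) :
    IntegrableOn (fun t => f t * wOne κ t) (Set.Icc (-1) 1) :=
  (integrableOn_wOne hκ).continuousOn_mul hf.continuousOn isCompact_Icc

theorem rpow_mul_two_sub_le {κ s : ℝ} (hκ : 0 ≤ κ) (j : ℕ) (hs : 0 < s) (hs1 : s ≤ 1) :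
    (s * (2 - s)) ^ (κ - j) ≤ 2 ^ κ * s ^ (κ - j) := by
  have hq : 0 < s * (2 - s) := by nlinarith
  rw [rpow_sub hq, rpow_sub hs, rpow_natCast, rpow_natCast, ← mul_div_assoc,
    ← mul_rpow (by norm_num) hs.le]
  have : s * 1 ≤ s * (2 - s) := by gcongr; linarith
  have : s * (2 - s) ≤ 2 * s := by nlinarith
  gcongr
  linarith

/-- An antiderivative of the Gegenbauer polynomial. -/
noncomputable def gegW (n : ℕ) (l t : ℝ) : ℝ :=
  ((2 * l - 1) * t * gegV n l t - (1 - t ^ 2) * gegD n l t) / ((n + 1) * (n - 1 + 2 * l))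

theorem min_mul_sq_le {n : ℕ} {l : ℝ} (hn : 1 ≤ n) (hl : 0 < l) :
    min 1 (2 * l) * (n : ℝ) ^ 2 ≤ (n + 1) * (n - 1 + 2 * l) := by
  have hn' : (1 : ℝ) ≤ n := by exact_mod_cast hn
  have h1 := min_le_left 1 (2 * l)
  have h2 := min_le_right 1 (2 * l)
  have h3 : 0 < min 1 (2 * l) := lt_min one_pos (by positivity)
  generalize min 1 (2 * l) = c at *
  have a1 : 0 ≤ ((n : ℝ) - 1) * (n + 1) := mul_nonneg (by linarith) (by linarith)
  nlinarith [mul_le_mul_of_nonneg_right h1 a1]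

theorem hasDerivAt_gegW {n : ℕ} {l : ℝ} (hn : 1 ≤ n) (hl : 0 < l) (t : ℝ) :
    HasDerivAt (gegW n l) (gegV n l t) t := by
  obtain ⟨g2, h2, e2⟩ := exists_hasDerivAt_gegD n l t
  have h1 := hasDerivAt_gegV n l t
  have hn' : (1 : ℝ) ≤ n := by exact_mod_cast hn
  have hs : HasDerivAt (fun t : ℝ => 1 - t ^ 2) (-(2 * t)) t := by
    simpa using ((hasDerivAt_pow 2 t).const_sub 1)
  refine (((((hasDerivAt_id t).const_mul (2 * l - 1)).mul h1).sub (hs.mul h2)).div_const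
    ((n + 1) * (n - 1 + 2 * l))).congr_deriv ?_
  have h3 : (0 : ℝ) < (n + 1) * (n - 1 + 2 * l) := mul_pos (by linarith) (by linarith)
  rw [div_eq_iff h3.ne']
  simp only [id]
  linear_combination -e2

theorem exists_gegW_bound {l : ℝ} (hl : 0 < l) : ∃ B : ℝ, 0 < B ∧ ∀ n : ℕ, 1 ≤ n →
    ∀ t : ℝ, t ^ 2 ≤ 1 → |gegW n l t| ≤
      B * (n : ℝ) ^ (l - 2) * (1 - t ^ 2 + 1 / (n : ℝ) ^ 2) ^ (1 / 2 - l / 2) := by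
  obtain ⟨A, hA, h⟩ := exists_gegV_bound hl
  have hm : 0 < min 1 (2 * l) := lt_min one_pos (by positivity)
  refine ⟨(|2 * l - 1| * A + A) / min 1 (2 * l), by positivity, fun n hn t ht => ?_⟩
  have hn' : (1 : ℝ) ≤ n := by exact_mod_cast hn
  have hn0 : (0 : ℝ) < n := by linarith
  obtain ⟨hV, hD⟩ := h n hn t ht
  have hs : 0 ≤ 1 - t ^ 2 := by linarith
  have hrn : 1 / (n : ℝ) ^ 2 ≤ 1 - t ^ 2 + 1 / (n : ℝ) ^ 2 := le_add_of_nonneg_left hs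
  have hr : 0 < 1 - t ^ 2 + 1 / (n : ℝ) ^ 2 := by positivity
  generalize 1 - t ^ 2 + 1 / (n : ℝ) ^ 2 = r at *
  have hden := min_mul_sq_le hn hl
  have hden0 : 0 < min 1 (2 * l) * (n : ℝ) ^ 2 := by positivity
  rw [gegW, abs_div, abs_of_pos (hden0.trans_le hden)]
  have e1 : (n : ℝ) ^ (l - 1) ≤ (n : ℝ) ^ l * r ^ (1 / 2 : ℝ) := by
    rw [rpow_sub_one hn0.ne', div_eq_mul_inv]
    gcongr
    rw [← sqrt_eq_rpow]
    refine Real.le_sqrt_of_sq_le (le_trans (le_of_eq ?_) hrn)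
    rw [inv_pow, one_div]
  have e2 : (n : ℝ) ^ l * r ^ (1 / 2 : ℝ) * r ^ (-(l / 2)) =
      (n : ℝ) ^ l * r ^ (1 / 2 - l / 2) := by
    rw [mul_assoc, ← rpow_add hr]; rfl
  have e3 : (n : ℝ) ^ (l - 2) * n ^ 2 = (n : ℝ) ^ l := by
    rw [← rpow_natCast, ← rpow_add hn0]; congr 1; push_cast; ring
  have hnum : |(2 * l - 1) * t * gegV n l t - (1 - t ^ 2) * gegD n l t| ≤
      (|2 * l - 1| * A + A) * ((n : ℝ) ^ l * r ^ (1 / 2 - l / 2)) := by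
    refine (abs_sub _ _).trans ?_
    rw [abs_mul, abs_mul, abs_mul, abs_of_nonneg hs, add_mul]
    have ht1 : |t| ≤ 1 := abs_le_one_iff_mul_self_le_one.2 (by nlinarith)
    refine add_le_add ?_ ?_
    · calc |2 * l - 1| * |t| * |gegV n l t| ≤
            |2 * l - 1| * 1 * (A * ((n : ℝ) ^ l * r ^ (1 / 2 : ℝ)) * r ^ (-(l / 2))) := by
            gcongr
            refine hV.trans ?_
            gcongr
        _ = _ := by rw [← e2]; ring
    · refine hD.trans_eq ?_
      rw [mul_assoc]; congr 3; ring
  rw [div_le_iff₀ (hden0.trans_le hden)]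
  refine hnum.trans ?_
  calc (|2 * l - 1| * A + A) * ((n : ℝ) ^ l * r ^ (1 / 2 - l / 2))
      = (|2 * l - 1| * A + A) / min 1 (2 * l) * (n : ℝ) ^ (l - 2) * r ^ (1 / 2 - l / 2) *
        (min 1 (2 * l) * (n : ℝ) ^ 2) := by
        rw [← e3]; field_simp
    _ ≤ _ := by gcongr

theorem exists_wOne_reflect_bounds {k κ : ℝ} (hk : 0 < k) (hkκ : k ≤ κ) :
    ∃ (K : ℝ) (ω' : ℝ → ℝ), 0 < K ∧
      (∀ s ∈ Set.Ioc (0 : ℝ) 1, HasDerivAt (fun s => wOne κ (1 - s)) (ω' s) s) ∧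
      ContinuousOn ω' (Set.Ioc 0 1) ∧
      (∀ s ∈ Set.Ioc (0 : ℝ) 1, |wOne κ (1 - s)| ≤ K * s ^ (k - 1)) ∧
      ∀ s ∈ Set.Ioc (0 : ℝ) 1, |ω' s| ≤ K * s ^ (k - 2) := by
  refine ⟨(2 : ℝ) ^ κ * (2 + 4 * |κ - 1|), fun s => -1 * (s * (2 - s)) ^ (κ - 1) +
      (2 - s) * ((2 * (1 - s)) * (κ - 1) * (s * (2 - s)) ^ (κ - 2)), by positivity,
      ?_, ?_, ?_, ?_⟩
  · intro s hs
    have hq : 0 < s * (2 - s) := by nlinarith [hs.1, hs.2]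
    have h1 : HasDerivAt (fun s : ℝ => s * (2 - s)) (2 * (1 - s)) s :=
      ((hasDerivAt_id s).mul ((hasDerivAt_id s).const_sub 2)).congr_deriv (by simp only [id]; ring)
    have h2 := h1.rpow_const (p := κ - 1) (Or.inl hq.ne')
    have h3 := ((hasDerivAt_id s).const_sub 2).mul h2
    have e : (fun s => wOne κ (1 - s)) = fun s => (2 - s) * (s * (2 - s)) ^ (κ - 1) := by
      funext s; rw [wOne]; ring_nf
    rw [e]
    refine h3.congr_deriv ?_
    rw [show κ - 1 - 1 = κ - 2 by ring]; rfl
  · have hne : ∀ s ∈ Set.Ioc (0 : ℝ) 1, s * (2 - s) ≠ 0 := fun s hs =>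
      (show 0 < s * (2 - s) by nlinarith [hs.1, hs.2]).ne'
    have hc : ∀ p : ℝ, ContinuousOn (fun s : ℝ => (s * (2 - s)) ^ p) (Set.Ioc 0 1) := fun p =>
      ContinuousOn.rpow_const (by fun_prop) fun s hs => Or.inl (hne s hs)
    exact (continuousOn_const.mul (hc _)).add
      ((by fun_prop : ContinuousOn (fun s : ℝ => 2 - s) _).mul
        ((by fun_prop : ContinuousOn (fun s : ℝ => 2 * (1 - s) * (κ - 1)) _).mul (hc _)))
  · intro s hs
    have hs0 := hs.1
    have e : wOne κ (1 - s) = (2 - s) * (s * (2 - s)) ^ (κ - 1) := by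
      rw [wOne]; ring_nf
    have h1 := rpow_mul_two_sub_le (hk.le.trans hkκ) 1 hs.1 hs.2
    rw [Nat.cast_one] at h1
    have h2 : s ^ (κ - 1) ≤ s ^ (k - 1) := rpow_le_rpow_of_exponent_ge hs.1 hs.2 (by linarith)
    rw [abs_of_nonneg (wOne_nonneg (by linarith [hs.2]) (by linarith)), e]
    calc (2 - s) * (s * (2 - s)) ^ (κ - 1) ≤ 2 * (2 ^ κ * s ^ (k - 1)) := by
          refine mul_le_mul (by linarith) (h1.trans (by gcongr)) ?_ (by norm_num)
          exact rpow_nonneg (mul_nonneg hs.1.le (by linarith [hs.2])) _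
      _ = 2 ^ κ * 2 * s ^ (k - 1) := by ring
      _ ≤ _ := by
          gcongr; exact le_add_of_nonneg_right (by positivity)
  · intro s hs
    have hs0 := hs.1
    have h1 := rpow_mul_two_sub_le (hk.le.trans hkκ) 1 hs.1 hs.2
    have h2 := rpow_mul_two_sub_le (hk.le.trans hkκ) 2 hs.1 hs.2
    push_cast at h1 h2
    have h3 : s ^ (κ - 1) ≤ s ^ (k - 2) := rpow_le_rpow_of_exponent_ge hs.1 hs.2 (by linarith)
    have h4 : s ^ (κ - 2) ≤ s ^ (k - 2) := rpow_le_rpow_of_exponent_ge hs.1 hs.2 (by linarith)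
    have hq : 0 ≤ s * (2 - s) := mul_nonneg hs.1.le (by linarith [hs.2])
    refine (abs_add_le _ _).trans ?_
    rw [abs_mul, abs_mul (2 - s), abs_mul (2 * (1 - s) * (κ - 1)), abs_mul (2 * (1 - s)),
      abs_of_nonneg (rpow_nonneg hq (κ - 1)), abs_of_nonneg (rpow_nonneg hq (κ - 2)),
      abs_of_nonneg (show 0 ≤ 2 - s by linarith [hs.2]),
      abs_of_nonneg (show 0 ≤ 2 * (1 - s) by linarith [hs.2]), abs_neg, abs_one, one_mul]
    calc (s * (2 - s)) ^ (κ - 1) + (2 - s) * (2 * (1 - s) * |κ - 1| * (s * (2 - s)) ^ (κ - 2))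
        ≤ 2 ^ κ * s ^ (k - 2) + 2 * (2 * |κ - 1| * (2 ^ κ * s ^ (k - 2))) := by
          refine add_le_add (h1.trans (by gcongr)) ?_
          have := rpow_nonneg hq (κ - 2)
          have hs1 := hs.2
          refine mul_le_mul (by linarith) ?_ ?_ (by norm_num)
          · refine mul_le_mul ?_ (h2.trans (by gcongr)) this (by positivity)
            exact mul_le_mul_of_nonneg_right (by linarith) (abs_nonneg _)
          · exact mul_nonneg (mul_nonneg (by linarith) (abs_nonneg _)) this
      _ = 2 ^ κ * (1 + 4 * |κ - 1|) * s ^ (k - 2) := by ring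
      _ ≤ _ := by gcongr; norm_num

theorem exists_right_half_bound {l k κ u0 : ℝ} (hl : 0 < l) (hk : 0 < k) (hkκ : k ≤ κ)
    (h2k : 2 * k ≤ l) (hu0 : 0 < u0) (hu1 : u0 ≤ 1) : ∃ C : ℝ, 0 < C ∧ ∀ n : ℕ, 1 ≤ n →
    ∀ u b : ℝ, u0 ≤ u → |b| ≤ 1 - u →
      |∫ t in (0 : ℝ)..1, gegV n l (b + u * t) * wOne κ t| ≤
        C * (n : ℝ) ^ (2 * l - 1 - 2 * k) := by
  obtain ⟨A, hA, hGb⟩ := exists_gegV_bound hl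
  obtain ⟨B, hB, hWb⟩ := exists_gegW_bound hl
  set v := (u0 ^ 2) ^ (-(l / 2)) with hv
  have hv0 : 0 < v := by positivity
  obtain ⟨K, ω', hK0, hω1, hω2, hω3, hω4⟩ := exists_wOne_reflect_bounds hk hkκ
  refine ⟨A * v * K / k + 8 * (u0⁻¹ * (B * 2 * v) * K), by positivity, fun n hn u b hu hb => ?_⟩
  have hn' : (1 : ℝ) ≤ n := by exact_mod_cast hn
  have hn0 : (0 : ℝ) < n := by linarith
  obtain ⟨hb1, hb2⟩ := abs_le.1 hb
  have hupos : 0 < u := by linarith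
  set D := 1 - b - u + 1 / (n : ℝ) ^ 2 with hD
  have hDn : 1 / (n : ℝ) ^ 2 ≤ D := by rw [hD]; linarith
  have hn2 : 0 < 1 / (n : ℝ) ^ 2 := by positivity
  have hD0 : 0 < D := hn2.trans_le hDn
  set τ : ℝ → ℝ := fun s => b + u * (1 - s) with hτ
  have hτd : ∀ s, HasDerivAt τ (-u) s := fun s => by
    refine ((((hasDerivAt_id s).const_sub 1).const_mul u).const_add b).congr_deriv ?_
    ring
  have hWd : ∀ s, HasDerivAt (fun s => -u⁻¹ * gegW n l (τ s)) (gegV n l (τ s)) s := fun s =>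
    ((((hasDerivAt_gegW hn hl (τ s)).comp s (hτd s)).const_mul (-u⁻¹))).congr_deriv
      (by field_simp)
  have hr : ∀ s ∈ Set.Ioc (0 : ℝ) 1, τ s ^ 2 ≤ 1 ∧
      u0 ^ 2 * (D + s) ≤ 1 - τ s ^ 2 + 1 / (n : ℝ) ^ 2 ∧
      1 - τ s ^ 2 + 1 / (n : ℝ) ^ 2 ≤ 2 * (D + s) := by
    intro s hs
    have p1 : u0 ≤ 1 + τ s := by simp only [hτ]; nlinarith [hs.1, hs.2]
    have p2 : u0 * (1 - b - u + s) ≤ 1 - τ s := by simp only [hτ]; nlinarith [hs.1, hs.2]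
    have p3 : 1 - τ s ≤ 1 - b - u + s := by simp only [hτ]; nlinarith [hs.1, hs.2]
    have p4 : 1 + τ s ≤ 2 := by simp only [hτ]; nlinarith [hs.1, hs.2]
    have p5 : 0 ≤ 1 - b - u + s := by linarith [hs.1]
    have p6 : 0 ≤ u0 * (1 - b - u + s) := by positivity
    have e : 1 - τ s ^ 2 = (1 + τ s) * (1 - τ s) := by ring
    have q1 : u0 * (u0 * (1 - b - u + s)) ≤ 1 - τ s ^ 2 := by
      rw [e]; exact mul_le_mul p1 p2 p6 (by linarith)
    have q2 : 1 - τ s ^ 2 ≤ 2 * (1 - b - u + s) := by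
      rw [e]; exact mul_le_mul p4 p3 (by linarith) (by norm_num)
    have q3 : u0 ^ 2 * (1 / (n : ℝ) ^ 2) ≤ 1 / (n : ℝ) ^ 2 :=
      mul_le_of_le_one_left hn2.le (by nlinarith)
    refine ⟨by nlinarith [mul_nonneg hu0.le p6], ?_, ?_⟩ <;> rw [hD] <;> nlinarith
  have hrneg : ∀ s ∈ Set.Ioc (0 : ℝ) 1, (1 - τ s ^ 2 + 1 / (n : ℝ) ^ 2) ^ (-(l / 2)) ≤
      v * (D + s) ^ (-(l / 2)) := by
    intro s hs
    have hs0 := hs.1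
    rw [hv, ← mul_rpow (by positivity) (by positivity)]
    exact rpow_le_rpow_of_nonpos (by positivity) (hr s hs).2.1 (by linarith)
  have hγ : k + (l / 2 - k) = l / 2 := by ring
  have main := abs_integral_mul_le_of_antideriv (g := fun s => gegV n l (τ s))
    (W := fun s => -u⁻¹ * gegW n l (τ s)) (ω := fun s => wOne κ (1 - s))
    (ω' := ω')
    (k := k) (γ := l / 2 - k) (D := D) (A := A * (n : ℝ) ^ (l - 1) * v)
    (B := u0⁻¹ * (B * (n : ℝ) ^ (l - 2) * 2 * v)) (K := K) hk (by linarith) hD0 (by positivity)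
    (by positivity) hK0.le
    ((continuous_gegV n l).comp (continuous_iff_continuousAt.2 fun s => (hτd s).continuousAt))
    hWd hω1 hω2 ?_ ?_ hω3 hω4
  · have e1 : ∫ t in (0 : ℝ)..1, gegV n l (b + u * t) * wOne κ t =
        ∫ s in (0 : ℝ)..1, wOne κ (1 - s) * gegV n l (τ s) := by
      have := intervalIntegral.integral_comp_sub_left (a := 0) (b := 1)
        (fun t => gegV n l (b + u * t) * wOne κ t) 1
      rw [sub_self, sub_zero] at this
      rw [← this]
      simp only [hτ, mul_comm]
    rw [e1]
    refine main.trans ?_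
    have d1 : D ^ (-(l / 2 - k)) ≤ (n : ℝ) ^ (l - 2 * k) := by
      refine (rpow_le_rpow_of_nonpos hn2 hDn (by linarith)).trans_eq ?_
      rw [one_div, ← rpow_natCast, ← rpow_neg hn0.le, ← rpow_mul hn0.le]; congr 1; push_cast; ring
    have d2 : D ^ (-(l / 2 - k + 1 / 2)) ≤ (n : ℝ) ^ (l - 2 * k + 1) := by
      refine (rpow_le_rpow_of_nonpos hn2 hDn (by linarith)).trans_eq ?_
      rw [one_div, ← rpow_natCast, ← rpow_neg hn0.le, ← rpow_mul hn0.le]; congr 1; push_cast; ring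
    have f1 : (n : ℝ) ^ (l - 1) * (n : ℝ) ^ (l - 2 * k) = (n : ℝ) ^ (2 * l - 1 - 2 * k) := by
      rw [← rpow_add hn0]; congr 1; ring
    have f2 : (n : ℝ) ^ (l - 2) * (n : ℝ) ^ (l - 2 * k + 1) = (n : ℝ) ^ (2 * l - 1 - 2 * k) := by
      rw [← rpow_add hn0]; congr 1; ring
    calc _ ≤ A * (n : ℝ) ^ (l - 1) * v * K / k * (n : ℝ) ^ (l - 2 * k) +
          8 * (u0⁻¹ * (B * (n : ℝ) ^ (l - 2) * 2 * v) * K) * (n : ℝ) ^ (l - 2 * k + 1) := by gcongr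
      _ = A * v * K / k * ((n : ℝ) ^ (l - 1) * (n : ℝ) ^ (l - 2 * k)) +
          8 * (u0⁻¹ * (B * 2 * v) * K) * ((n : ℝ) ^ (l - 2) * (n : ℝ) ^ (l - 2 * k + 1)) := by ring
      _ = _ := by rw [f1, f2]; ring
  · intro s hs
    rw [hγ]
    refine (hGb n hn _ (hr s hs).1).1.trans ?_
    rw [mul_assoc _ v]
    exact mul_le_mul_of_nonneg_left (hrneg s hs) (by positivity)
  · intro s hs
    have hs0 := hs.1
    rw [hγ, abs_mul, abs_neg, abs_of_pos (inv_pos.2 hupos), mul_assoc u0⁻¹]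
    refine mul_le_mul (by gcongr) ?_ (abs_nonneg _) (by positivity)
    refine (hWb n hn _ (hr s hs).1).trans ?_
    rw [mul_assoc _ 2 v, mul_assoc _ (2 * v)]
    refine mul_le_mul_of_nonneg_left ?_ (by positivity)
    have hpos : 0 < 1 - τ s ^ 2 + 1 / (n : ℝ) ^ 2 := by linarith [(hr s hs).1]
    rw [show (1 / 2 - l / 2 : ℝ) = 1 / 2 + -(l / 2) by ring, rpow_add hpos, rpow_add (by positivity)]
    have e1 : (1 - τ s ^ 2 + 1 / (n : ℝ) ^ 2) ^ (1 / 2 : ℝ) ≤ 2 * (D + s) ^ (1 / 2 : ℝ) := by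
      calc _ ≤ (4 * (D + s)) ^ (1 / 2 : ℝ) := by
            have := (hr s hs).2.2
            gcongr; linarith
        _ = _ := by
            rw [mul_rpow (by norm_num) (by positivity), ← sqrt_eq_rpow 4,
              show (4 : ℝ) = 2 ^ 2 by norm_num, Real.sqrt_sq (by norm_num)]
    calc _ ≤ (2 * (D + s) ^ (1 / 2 : ℝ)) * (v * (D + s) ^ (-(l / 2))) := by
          gcongr; exact hrneg s hs
      _ = _ := by ring

theorem exists_left_half_bound {l k κ u0 : ℝ} (hl : 0 < l) (hk : 0 < k) (hkκ : k ≤ κ)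
    (h2k : 2 * k ≤ l) (hu0 : 0 < u0) (hu1 : u0 ≤ 1) : ∃ C : ℝ, 0 < C ∧ ∀ n : ℕ, 1 ≤ n →
    ∀ u b : ℝ, u0 ≤ u → |b| ≤ 1 - u →
      |∫ t in (-1 : ℝ)..0, gegV n l (b + u * t) * wOne κ t| ≤
        C * (n : ℝ) ^ (2 * l - 1 - 2 * k) := by
  obtain ⟨A, hA, hGb⟩ := exists_gegV_bound hl
  set v := (u0 ^ 2) ^ (-(l / 2)) with hv
  have hv0 : 0 < v := by positivity
  refine ⟨A * v * 2 ^ κ, by positivity, fun n hn u b hu hb => ?_⟩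
  have hn' : (1 : ℝ) ≤ n := by exact_mod_cast hn
  have hn0 : (0 : ℝ) < n := by linarith
  obtain ⟨hb1, hb2⟩ := abs_le.1 hb
  have hn2 : 0 < 1 / (n : ℝ) ^ 2 := by positivity
  have hmain := intervalIntegral.norm_integral_le_of_norm_le_const (a := -1) (b := 0)
    (f := fun t => gegV n l (b + u * t) * wOne κ t)
    (C := A * v * 2 ^ κ * (n : ℝ) ^ (2 * l - 1 - 2 * k)) ?_
  · norm_num at hmain ⊢
    exact hmain
  intro t ht
  rw [Set.uIoc_of_le (by norm_num)] at ht
  obtain ⟨s, rfl⟩ : ∃ s, t = s - 1 := ⟨t + 1, by ring⟩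
  have hs0 : 0 < s := by linarith [ht.1]
  have hs1 : s ≤ 1 := by linarith [ht.2]
  set τ := b + u * (s - 1) with hτ
  have p1 : u0 * s ≤ 1 + τ := by rw [hτ]; nlinarith
  have p2 : u0 ≤ 1 - τ := by rw [hτ]; nlinarith
  have e : 1 - τ ^ 2 = (1 + τ) * (1 - τ) := by ring
  have q1 : u0 * s * u0 ≤ 1 - τ ^ 2 := by
    rw [e]; exact mul_le_mul p1 p2 hu0.le (by nlinarith)
  have q0 : 0 ≤ u0 * s * u0 := by positivity
  have q3 : u0 ^ 2 * (1 / (n : ℝ) ^ 2) ≤ 1 / (n : ℝ) ^ 2 :=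
    mul_le_of_le_one_left hn2.le (by nlinarith)
  have hr : u0 ^ 2 * (s + 1 / (n : ℝ) ^ 2) ≤ 1 - τ ^ 2 + 1 / (n : ℝ) ^ 2 := by nlinarith
  have hG := (hGb n hn τ (by linarith)).1
  have hr2 : (1 - τ ^ 2 + 1 / (n : ℝ) ^ 2) ^ (-(l / 2)) ≤
      v * (s + 1 / (n : ℝ) ^ 2) ^ (-(l / 2)) := by
    rw [hv, ← mul_rpow (by positivity) (by positivity)]
    exact rpow_le_rpow_of_nonpos (by positivity) hr (by linarith)
  have hw : wOne κ (s - 1) ≤ 2 ^ κ * (s + 1 / (n : ℝ) ^ 2) ^ k := by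
    have e : wOne κ (s - 1) = s * (s * (2 - s)) ^ (κ - 1) := by rw [wOne]; ring_nf
    have h1 := rpow_mul_two_sub_le (hk.le.trans hkκ) 1 hs0 hs1
    rw [Nat.cast_one] at h1
    rw [e]
    calc s * (s * (2 - s)) ^ (κ - 1) ≤ s * (2 ^ κ * s ^ (κ - 1)) := by gcongr
      _ = 2 ^ κ * s ^ κ := by rw [rpow_sub_one hs0.ne']; field_simp
      _ ≤ 2 ^ κ * s ^ k := by
          have := rpow_le_rpow_of_exponent_ge hs0 hs1 hkκ
          gcongr
      _ ≤ _ := by gcongr; linarith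
  have hw0 : 0 ≤ wOne κ (s - 1) := wOne_nonneg (by linarith) (by linarith)
  have hS : 0 < s + 1 / (n : ℝ) ^ 2 := by positivity
  rw [norm_mul, Real.norm_eq_abs, Real.norm_of_nonneg hw0]
  calc |gegV n l τ| * wOne κ (s - 1) ≤
        (A * (n : ℝ) ^ (l - 1) * (v * (s + 1 / (n : ℝ) ^ 2) ^ (-(l / 2)))) *
          (2 ^ κ * (s + 1 / (n : ℝ) ^ 2) ^ k) := by
        refine mul_le_mul (hG.trans ?_) hw hw0 (by positivity)
        gcongr
    _ = A * v * 2 ^ κ * (n : ℝ) ^ (l - 1) *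
          ((s + 1 / (n : ℝ) ^ 2) ^ (-(l / 2)) * (s + 1 / (n : ℝ) ^ 2) ^ k) := by ring
    _ = A * v * 2 ^ κ * (n : ℝ) ^ (l - 1) * (s + 1 / (n : ℝ) ^ 2) ^ (-(l / 2) + k) := by
        rw [← rpow_add hS]
    _ ≤ A * v * 2 ^ κ * (n : ℝ) ^ (l - 1) * (1 / (n : ℝ) ^ 2) ^ (-(l / 2) + k) := by
        have := rpow_le_rpow_of_nonpos hn2 (show 1 / (n : ℝ) ^ 2 ≤ s + 1 / (n : ℝ) ^ 2 by linarith)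
          (show -(l / 2) + k ≤ 0 by linarith)
        gcongr
    _ = A * v * 2 ^ κ * ((n : ℝ) ^ (l - 1) * (n : ℝ) ^ (l - 2 * k)) := by
        rw [one_div, ← rpow_natCast, ← rpow_neg hn0.le, ← rpow_mul hn0.le, mul_assoc]
        congr 3; push_cast; ring
    _ = _ := by rw [← rpow_add hn0]; congr 2; ring

theorem exists_integral_gegV_wOne_bound {l k κ u0 : ℝ} (hl : 0 < l) (hk : 0 < k) (hkκ : k ≤ κ)
    (h2k : 2 * k ≤ l) (hu0 : 0 < u0) (hu1 : u0 ≤ 1) : ∃ C : ℝ, 0 < C ∧ ∀ n : ℕ, 1 ≤ n →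
    ∀ u b : ℝ, u0 ≤ u → |b| ≤ 1 - u →
      |∫ t in Set.Icc (-1) 1, gegV n l (b + u * t) * wOne κ t| ≤
        C * (n : ℝ) ^ (2 * l - 1 - 2 * k) := by
  obtain ⟨C1, hC1, h1⟩ := exists_right_half_bound hl hk hkκ h2k hu0 hu1
  obtain ⟨C2, hC2, h2⟩ := exists_left_half_bound hl hk hkκ h2k hu0 hu1
  refine ⟨C2 + C1, by positivity, fun n hn u b hu hb => ?_⟩
  have hi : IntervalIntegrable (fun t => gegV n l (b + u * t) * wOne κ t) volume (-1) 1 := by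
    rw [intervalIntegrable_iff_integrableOn_Icc_of_le (by norm_num)]
    exact integrableOn_mul_wOne (hk.trans_le hkκ) ((continuous_gegV n l).comp (by fun_prop))
  have hs1 : IntervalIntegrable (fun t => gegV n l (b + u * t) * wOne κ t) volume (-1) 0 :=
    hi.mono_set (by
      rw [Set.uIcc_of_le (by norm_num), Set.uIcc_of_le (by norm_num)]
      exact Set.Icc_subset_Icc_right (by norm_num))
  have hs2 : IntervalIntegrable (fun t => gegV n l (b + u * t) * wOne κ t) volume 0 1 :=
    hi.mono_set (by
      rw [Set.uIcc_of_le (by norm_num), Set.uIcc_of_le (by norm_num)]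
      exact Set.Icc_subset_Icc_left (by norm_num))
  rw [integral_Icc_eq_integral_Ioc, ← intervalIntegral.integral_of_le (by norm_num),
    ← intervalIntegral.integral_add_adjacent_intervals hs1 hs2, add_mul]
  exact (abs_add_le _ _).trans (add_le_add (h2 n hn u b hu hb) (h1 n hn u b hu hb))

theorem restrict_cube (m : ℕ) : (volume : Measure (Fin m → ℝ)).restrict (cube m) =
    Measure.pi fun _ => (volume : Measure ℝ).restrict (Set.Icc (-1) 1) := by
  rw [cube, volume_pi, Measure.restrict_pi_pi]

theorem isCompact_cube (m : ℕ) : IsCompact (cube m) := isCompact_univ_pi fun _ => isCompact_Icc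

theorem wprod_eq {m : ℕ} (κ t : Fin m → ℝ) : wprod κ t = ∏ i, wOne (κ i) (t i) := rfl

theorem integrableOn_wprod {m : ℕ} {κ : Fin m → ℝ} (hκ : ∀ i, 0 < κ i) :
    IntegrableOn (wprod κ) (cube m) := by
  rw [IntegrableOn, restrict_cube]
  exact Integrable.fintype_prod fun i => integrableOn_wOne (hκ i)

theorem integrableOn_mul_wprod {m : ℕ} {κ : Fin m → ℝ} (hκ : ∀ i, 0 < κ i)
    {f : (Fin m → ℝ) → ℝ} (hf : Continuous f) :
    IntegrableOn (fun t => f t * wprod κ t) (cube m) :=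
  (integrableOn_wprod hκ).continuousOn_mul hf.continuousOn (isCompact_cube m)

theorem exists_cube_bound_of_le {d : ℕ} {κ : Fin (d + 1) → ℝ} (hκ : ∀ i, 0 < κ i) {l k : ℝ}
    (hl : 0 < l) (hk : 0 < k) (hkκ : ∀ i, k ≤ κ i) (h2k : 2 * k ≤ l) {u0 : ℝ} (hu0 : 0 < u0)
    (hu1 : u0 ≤ 1) (i : Fin (d + 1)) :
    ∃ C : ℝ, 0 < C ∧ ∀ n : ℕ, 1 ≤ n → ∀ a : Fin (d + 1) → ℝ, (∀ j, 0 ≤ a j) → ∑ j, a j = 1 →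
      u0 ≤ a i → |∫ t in cube (d + 1), gegV n l (∑ j, a j * t j) * wprod κ t| ≤
        C * (n : ℝ) ^ (2 * l - 1 - 2 * k) := by
  obtain ⟨C, hC, h⟩ := exists_integral_gegV_wOne_bound hl hk (hkκ i) h2k hu0 hu1
  set J := ∫ t in cube d, wprod (fun j => κ (i.succAbove j)) t with hJ
  refine ⟨C * (|J| + 1), by positivity, fun n hn a ha hs hi => ?_⟩
  have hn0 : (0 : ℝ) < n := by exact_mod_cast hn
  set F : (Fin (d + 1) → ℝ) → ℝ := fun t => gegV n l (∑ j, a j * t j) * wprod κ t with hF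
  have hFi : IntegrableOn F (cube (d + 1)) :=
    integrableOn_mul_wprod hκ ((continuous_gegV n l).comp (by fun_prop))
  have hmp := measurePreserving_piFinSuccAbove
    (fun _ : Fin (d + 1) => (volume : Measure ℝ).restrict (Set.Icc (-1) 1)) i
  have e1 : ∫ t in cube (d + 1), F t = ∫ s in cube d, ∫ r in Set.Icc (-1) 1,
      F (i.insertNth r s) := by
    rw [restrict_cube, restrict_cube]
    have e := hmp.symm.integral_comp' (f := (MeasurableEquiv.piFinSuccAbove (fun _ => ℝ) i).symm) F
    rw [← e, integral_prod_symm]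
    · rfl
    · rw [IntegrableOn, restrict_cube] at hFi
      exact (hmp.symm.integrable_comp_emb
        (MeasurableEquiv.piFinSuccAbove (fun _ => ℝ) i).symm.measurableEmbedding).2 hFi
  have hwi : IntegrableOn (wprod fun j => κ (i.succAbove j)) (cube d) :=
    integrableOn_wprod fun j => hκ _
  rw [e1, ← Real.norm_eq_abs]
  refine (norm_integral_le_of_norm_le (hwi.const_mul (C * (n : ℝ) ^ (2 * l - 1 - 2 * k)))
    ?_).trans ?_
  · filter_upwards [ae_restrict_mem (isCompact_cube d).measurableSet] with s hsm
    have hs1 : ∀ j, |s j| ≤ 1 := fun j => abs_le.2 (hsm j trivial)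
    have e2 : ∀ r, F (i.insertNth r s) =
        gegV n l ((∑ j, a (i.succAbove j) * s j) + a i * r) * wOne (κ i) r *
          wprod (fun j => κ (i.succAbove j)) s := by
      intro r
      simp only [hF, wprod_eq]
      rw [Fin.sum_univ_succAbove _ i, Fin.prod_univ_succAbove _ i]
      simp only [Fin.insertNth_apply_succAbove, Fin.insertNth_apply_same]
      rw [add_comm, mul_assoc]
    simp only [e2]
    have hw0 : 0 ≤ wprod (fun j => κ (i.succAbove j)) s :=
      prod_nonneg fun j _ => wOne_nonneg (hsm j trivial).1 (hsm j trivial).2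
    rw [integral_mul_const, norm_mul, Real.norm_of_nonneg hw0, Real.norm_eq_abs]
    refine mul_le_mul_of_nonneg_right (h n hn (a i) _ hi ?_) hw0
    rw [Fin.sum_univ_succAbove _ i] at hs
    rw [← hs, add_sub_cancel_left]
    refine (abs_sum_le_sum_abs _ _).trans (sum_le_sum fun j _ => ?_)
    rw [abs_mul, abs_of_nonneg (ha _)]
    exact mul_le_of_le_one_right (ha _) (hs1 j)
  · rw [integral_const_mul, ← hJ, mul_assoc C, mul_comm _ J, ← mul_assoc]
    gcongr
    linarith [le_abs_self J]

theorem exists_cube_bound {d : ℕ} {κ : Fin (d + 1) → ℝ} (hκ : ∀ i, 0 < κ i) {l k : ℝ}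
    (hl : 0 < l) (hk : 0 < k) (hkκ : ∀ i, k ≤ κ i) (h2k : 2 * k ≤ l) :
    ∃ C : ℝ, 0 < C ∧ ∀ n : ℕ, 1 ≤ n → ∀ a : Fin (d + 1) → ℝ, (∀ j, 0 ≤ a j) → ∑ j, a j = 1 →
      |∫ t in cube (d + 1), gegV n l (∑ j, a j * t j) * wprod κ t| ≤
        C * (n : ℝ) ^ (2 * l - 1 - 2 * k) := by
  have hd : (0 : ℝ) < 1 / (d + 1) := by positivity
  have hd1 : (1 : ℝ) / (d + 1) ≤ 1 := by
    rw [div_le_one (by positivity)]; linarith [Nat.cast_nonneg (α := ℝ) d]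
  choose C hC h using exists_cube_bound_of_le hκ hl hk hkκ h2k hd hd1
  refine ⟨∑ i, C i, sum_pos (fun i _ => hC i) univ_nonempty, fun n hn a ha hs => ?_⟩
  obtain ⟨i, hi⟩ : ∃ i, (1 : ℝ) / (d + 1) ≤ a i := by
    by_contra! hcon
    have := sum_lt_sum_of_nonempty (s := univ) univ_nonempty fun i (_ : i ∈ univ) => hcon i
    rw [hs, sum_const, card_univ, Fintype.card_fin, nsmul_eq_mul] at this
    push_cast at this
    rw [mul_one_div_cancel (by positivity)] at this
    exact lt_irrefl _ this
  refine (h i n hn a ha hs hi).trans ?_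
  gcongr
  exact single_le_sum (fun j _ => (hC j).le) (mem_univ i)

/-- Normalised moments `(∫ t^m (1+t)(1-t²)^(c-3/2) dt) / (m! ∫ (1+t)(1-t²)^(c-3/2) dt)`, in closed
form. -/
noncomputable def epsCoef (c : ℝ) (m : ℕ) : ℝ :=
  1 / (2 ^ m * (m / 2).factorial * poch c ((m + 1) / 2))

/-- The moments of the even weight `(1-t²)^(κ-1)` on `[-1,1]`. -/
noncomputable def evenMoment (κ : ℝ) (m : ℕ) : ℝ :=
  ∫ t in Set.Icc (-1 : ℝ) 1, t ^ m * (1 - t ^ 2) ^ (κ - 1)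

theorem integrableOn_evenWeight {κ : ℝ} (hκ : 0 < κ) :
    IntegrableOn (fun t : ℝ => (1 - t ^ 2) ^ (κ - 1)) (Set.Icc (-1) 1) := by
  have h1 := integrableOn_wOne hκ
  have h2 : IntegrableOn (fun t => wOne κ (-t)) (Set.Icc (-1) 1) := by
    have := (Measure.measurePreserving_neg (volume : Measure ℝ)).integrableOn_comp_preimage
      (Homeomorph.neg ℝ).measurableEmbedding (f := wOne κ) (s := Set.Icc (-1) 1)
    simp only [Set.neg_preimage, Set.neg_Icc, neg_neg] at this
    exact this.2 h1
  refine IntegrableOn.congr_fun (Integrable.const_mul (h1.add h2) (1 / 2)) (fun t _ => ?_)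
    measurableSet_Icc
  simp only [Pi.add_apply, wOne, neg_sq]
  ring

theorem evenMoment_rec {κ : ℝ} (hκ : 0 < κ) (m : ℕ) :
    m * evenMoment κ (m - 1) = (m + 2 * κ) * evenMoment κ (m + 1) := by
  have hw := integrableOn_evenWeight hκ
  have hi : ∀ j : ℕ, IntegrableOn (fun t : ℝ => t ^ j * (1 - t ^ 2) ^ (κ - 1)) (Set.Icc (-1) 1) :=
    fun j => hw.continuousOn_mul (continuous_pow j).continuousOn isCompact_Icc
  have hi' : IntegrableOn (fun t : ℝ => m * (t ^ (m - 1) * (1 - t ^ 2) ^ (κ - 1)) -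
      (m + 2 * κ) * (t ^ (m + 1) * (1 - t ^ 2) ^ (κ - 1))) (Set.Icc (-1) 1) :=
    ((hi (m - 1)).const_mul _).sub ((hi (m + 1)).const_mul _)
  have key := intervalIntegral.integral_eq_sub_of_hasDerivAt_of_le (a := -1) (b := 1)
    (f := fun t : ℝ => t ^ m * (1 - t ^ 2) ^ κ)
    (f' := fun t : ℝ => m * (t ^ (m - 1) * (1 - t ^ 2) ^ (κ - 1)) -
      (m + 2 * κ) * (t ^ (m + 1) * (1 - t ^ 2) ^ (κ - 1))) (by norm_num)
    (Continuous.continuousOn (by fun_prop (disch := positivity))) ?_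
    ((intervalIntegrable_iff_integrableOn_Icc_of_le (by norm_num)).2 hi')
  · rw [intervalIntegral.integral_of_le (by norm_num), ← integral_Icc_eq_integral_Ioc,
      integral_sub ((hi (m - 1)).const_mul _) ((hi (m + 1)).const_mul _),
      integral_const_mul, integral_const_mul] at key
    norm_num [zero_rpow hκ.ne'] at key
    exact sub_eq_zero.1 key
  · intro t ht
    have hq : 0 < 1 - t ^ 2 := by nlinarith [ht.1, ht.2]
    have h1 : HasDerivAt (fun t : ℝ => 1 - t ^ 2) (-(2 * t)) t :=
      ((hasDerivAt_pow 2 t).const_sub 1).congr_deriv (by simp)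
    refine ((hasDerivAt_pow m t).mul (h1.rpow_const (p := κ) (Or.inl hq.ne'))).congr_deriv ?_
    have e : (1 - t ^ 2) ^ κ = (1 - t ^ 2) * (1 - t ^ 2) ^ (κ - 1) := by
      rw [rpow_sub_one hq.ne']; field_simp
    rw [e]
    cases m with
    | zero => simp; ring
    | succ m => simp only [Nat.add_sub_cancel]; push_cast; ring

theorem evenMoment_odd {κ : ℝ} (hκ : 0 < κ) (p : ℕ) : evenMoment κ (2 * p + 1) = 0 := by
  induction p with
  | zero =>
    have := evenMoment_rec hκ 0
    norm_num at this
    exact this.resolve_left hκ.ne'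
  | succ p ih =>
    have := evenMoment_rec hκ (2 * (p + 1))
    rw [show 2 * (p + 1) - 1 = 2 * p + 1 by omega, ih, mul_zero] at this
    exact (mul_eq_zero.1 this.symm).resolve_left (by positivity)

theorem evenMoment_even {κ : ℝ} (hκ : 0 < κ) (p : ℕ) :
    evenMoment κ (2 * p) =
      evenMoment κ 0 * ((2 * p).factorial / (4 ^ p * p.factorial * poch (κ + 1 / 2) p)) := by
  induction p with
  | zero => simp [poch_zero]
  | succ p ih =>
    have h := evenMoment_rec hκ (2 * p + 1)
    rw [Nat.add_sub_cancel, ih] at h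
    have h1 := poch_pos (show 0 < κ + 1 / 2 by positivity) p
    have h2 : (((2 * p + 1 : ℕ) : ℝ) + 2 * κ) ≠ 0 := by positivity
    have h3 : evenMoment κ (2 * (p + 1)) = ((2 * p + 1 : ℕ) : ℝ) * (evenMoment κ 0 *
        ((2 * p).factorial / (4 ^ p * p.factorial * poch (κ + 1 / 2) p))) /
          (((2 * p + 1 : ℕ) : ℝ) + 2 * κ) := by
      rw [eq_div_iff h2, h]; ring_nf
    rw [h3, poch_succ, show 2 * (p + 1) = 2 * p + 1 + 1 by ring, Nat.factorial_succ,
      Nat.factorial_succ, Nat.factorial_succ]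
    have h4 : κ + 1 / 2 + (p : ℝ) ≠ 0 := by positivity
    push_cast at h2 ⊢
    field_simp
    ring

theorem epsCoef_zero (c : ℝ) : epsCoef c 0 = 1 := by simp [epsCoef, poch_zero]

theorem epsCoef_even (c : ℝ) (p : ℕ) :
    epsCoef c (2 * p) = 1 / (4 ^ p * p.factorial * poch c p) := by
  rw [epsCoef, show 2 * p / 2 = p by omega, show (2 * p + 1) / 2 = p by omega, pow_mul]; norm_num

theorem epsCoef_odd (c : ℝ) (p : ℕ) :
    epsCoef c (2 * p + 1) = 1 / (2 * 4 ^ p * p.factorial * poch c (p + 1)) := by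
  rw [epsCoef, show (2 * p + 1) / 2 = p by omega, show (2 * p + 1 + 1) / 2 = p + 1 by omega,
    pow_succ, pow_mul]
  norm_num [mul_comm]

theorem integral_pow_mul_wOne {κ : ℝ} (hκ : 0 < κ) (m : ℕ) :
    ∫ t in Set.Icc (-1 : ℝ) 1, t ^ m * wOne κ t =
      (∫ t in Set.Icc (-1 : ℝ) 1, wOne κ t) * (m.factorial * epsCoef (κ + 1 / 2) m) := by
  have hw := integrableOn_evenWeight hκ
  have hi : ∀ j : ℕ, IntegrableOn (fun t : ℝ => t ^ j * (1 - t ^ 2) ^ (κ - 1)) (Set.Icc (-1) 1) :=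
    fun j => hw.continuousOn_mul (continuous_pow j).continuousOn isCompact_Icc
  have e : ∀ m : ℕ, ∫ t in Set.Icc (-1 : ℝ) 1, t ^ m * wOne κ t =
      evenMoment κ m + evenMoment κ (m + 1) := by
    intro m
    rw [evenMoment, evenMoment, ← integral_add (hi m) (hi (m + 1))]
    congr 1; funext t; rw [wOne]; ring
  have e0 : ∫ t in Set.Icc (-1 : ℝ) 1, wOne κ t = evenMoment κ 0 := by
    have := e 0
    rw [show 0 + 1 = 2 * 0 + 1 by norm_num, evenMoment_odd hκ, add_zero] at this
    simpa using this
  rw [e0, e]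
  obtain ⟨p, rfl | rfl⟩ := Nat.even_or_odd' m
  · rw [evenMoment_odd hκ, evenMoment_even hκ, epsCoef_even]; ring
  · rw [evenMoment_odd hκ, show 2 * p + 1 + 1 = 2 * (p + 1) by ring, evenMoment_even hκ,
      epsCoef_odd, show 2 * (p + 1) = 2 * p + 1 + 1 by ring, Nat.factorial_succ (2 * p + 1),
      Nat.factorial_succ p]
    have h1 := poch_pos (show 0 < κ + 1 / 2 by positivity) (p + 1)
    push_cast
    field_simp
    ring

theorem integral_wOne_pos {κ : ℝ} (hκ : 0 < κ) : 0 < ∫ t in Set.Icc (-1 : ℝ) 1, wOne κ t := by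
  rw [setIntegral_pos_iff_support_of_nonneg_ae]
  · refine lt_of_lt_of_le ?_ (measure_mono (s := Set.Ioo (-1 : ℝ) 1) ?_)
    · simp
    · intro t ht
      refine ⟨?_, ht.1.le, ht.2.le⟩
      have hq : 0 < 1 - t ^ 2 := by nlinarith [ht.1, ht.2]
      have h1 : 0 < 1 + t := by linarith [ht.1]
      have : 0 < wOne κ t := by unfold wOne; positivity
      exact this.ne'
  · filter_upwards [ae_restrict_mem measurableSet_Icc] with t ht
    exact wOne_nonneg ht.1 ht.2
  · exact integrableOn_wOne hκ

theorem PowerSeries.coeff_prod_univ {R ι : Type*} [CommRing R] [Fintype ι] [DecidableEq ι]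
    (f : ι → PowerSeries R) (n : ℕ) : PowerSeries.coeff n (∏ i, f i) =
      ∑ α ∈ piAntidiag univ n, ∏ i, PowerSeries.coeff (α i) (f i) := by
  rw [PowerSeries.coeff_prod]
  refine sum_bij' (fun l _ => (l : ι → ℕ)) (fun α _ => Finsupp.equivFunOnFinite.symm α)
    ?_ ?_ ?_ ?_ ?_
  · intro l hl; rw [mem_finsuppAntidiag] at hl; simpa using hl.1
  · intro α hα; rw [mem_piAntidiag] at hα; rw [mem_finsuppAntidiag]; exact ⟨hα.1, subset_univ _⟩
  · intro l _; ext i; rfl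
  · intro α _; rfl
  · intro l _; rfl

/-- The generating series of the normalised moments of `∑ i, u i * t i` on the cube. -/
noncomputable def momentSeries {d : ℕ} (κ u : Fin d → ℝ) : PowerSeries ℝ :=
  ∏ i, PowerSeries.rescale (u i) (PowerSeries.mk (epsCoef (κ i + 1 / 2)))

theorem coeff_momentSeries {d : ℕ} (κ u : Fin d → ℝ) (m : ℕ) :
    PowerSeries.coeff m (momentSeries κ u) =
      ∑ α ∈ piAntidiag univ m, ∏ i, (u i ^ α i * epsCoef (κ i + 1 / 2) (α i)) := by
  rw [momentSeries, PowerSeries.coeff_prod_univ]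
  simp only [PowerSeries.coeff_rescale, PowerSeries.coeff_mk]

theorem continuous_coeff_momentSeries {d : ℕ} (κ : Fin d → ℝ) (m : ℕ) :
    Continuous fun u => PowerSeries.coeff m (momentSeries κ u) := by
  simp only [coeff_momentSeries]
  fun_prop

theorem integral_wprod_eq {d : ℕ} (κ : Fin d → ℝ) :
    ∫ t in cube d, wprod κ t = ∏ i, ∫ t in Set.Icc (-1 : ℝ) 1, wOne (κ i) t := by
  rw [restrict_cube]
  exact integral_fintype_prod_eq_prod (fun i t => wOne (κ i) t)

theorem integral_wprod_pos {d : ℕ} {κ : Fin d → ℝ} (hκ : ∀ i, 0 < κ i) :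
    0 < ∫ t in cube d, wprod κ t := by
  rw [integral_wprod_eq]
  exact prod_pos fun i _ => integral_wOne_pos (hκ i)

theorem integral_sum_pow_mul_wprod {d : ℕ} {κ : Fin d → ℝ} (hκ : ∀ i, 0 < κ i) (u : Fin d → ℝ)
    (m : ℕ) : ∫ t in cube d, (∑ i, u i * t i) ^ m * wprod κ t =
      (∫ t in cube d, wprod κ t) * (m.factorial * PowerSeries.coeff m (momentSeries κ u)) := by
  have e : ∀ t : Fin d → ℝ, (∑ i, u i * t i) ^ m * wprod κ t =
      ∑ α ∈ piAntidiag univ m, (Nat.multinomial univ α * ∏ i, u i ^ α i) *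
        ∏ i, (t i ^ α i * wOne (κ i) (t i)) := by
    intro t
    rw [sum_pow_eq_sum_piAntidiag, sum_mul]
    refine sum_congr rfl fun α _ => ?_
    rw [wprod_eq]
    simp only [mul_pow, prod_mul_distrib]
    ring
  simp only [e]
  rw [restrict_cube, integral_finsetSum]
  · rw [← restrict_cube, coeff_momentSeries, mul_sum, mul_sum]
    refine sum_congr rfl fun α hα => ?_
    rw [integral_const_mul, restrict_cube,
      integral_fintype_prod_eq_prod (fun i t => t ^ α i * wOne (κ i) t), ← restrict_cube,
      integral_wprod_eq]
    simp only [integral_pow_mul_wOne (hκ _), prod_mul_distrib]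
    rw [mem_piAntidiag] at hα
    have h := Nat.multinomial_spec univ α
    rw [hα.1] at h
    have h' : (∏ i, ((α i).factorial : ℝ)) * Nat.multinomial univ α = m.factorial := by
      exact_mod_cast h
    rw [← h']
    ring
  · intro α _
    refine Integrable.const_mul ?_ _
    exact Integrable.fintype_prod (f := fun i t => t ^ α i * wOne (κ i) t)
      fun i => integrableOn_mul_wOne (hκ i) (continuous_pow _)

theorem lamK_pos {d : ℕ} (hd : 1 ≤ d) {κ : Fin (d + 1) → ℝ} (hκ : ∀ i, 0 < κ i) :
    0 < lamK d κ := by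
  have h1 : 0 < ∑ i, κ i := sum_pos (fun i _ => hκ i) univ_nonempty
  have h2 : (1 : ℝ) ≤ d := by exact_mod_cast hd
  unfold lamK; linarith

theorem hP_eq_sum {d : ℕ} (hd : 1 ≤ d) {κ : Fin (d + 1) → ℝ} (hκ : ∀ i, 0 < κ i) (n : ℕ)
    (x y : EuclideanSpace ℝ (Fin (d + 1))) : hP d κ n x y =
      ((n + lamK d κ) / lamK d κ) * ∑ k ∈ range (n / 2 + 1), gegCoef n (lamK d κ) k *
        ((n - 2 * k).factorial *
          PowerSeries.coeff (n - 2 * k) (momentSeries κ fun i => x i * y i)) := by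
  have hl := lamK_pos hd hκ
  have hw := integral_wprod_pos hκ
  rw [hP]
  simp only [gegenC_eq_sum hl, sum_mul]
  rw [integral_finsetSum]
  · have e : ∀ k, ∫ t in cube (d + 1), gegCoef n (lamK d κ) k *
        (∑ i, x i * y i * t i) ^ (n - 2 * k) * wprod κ t = (∫ t in cube (d + 1), wprod κ t) *
          (gegCoef n (lamK d κ) k * ((n - 2 * k).factorial *
          PowerSeries.coeff (n - 2 * k) (momentSeries κ fun i => x i * y i))) := by
      intro k
      simp only [mul_assoc]
      rw [integral_const_mul]
      have := integral_sum_pow_mul_wprod hκ (fun i => x i * y i) (n - 2 * k)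
      simp only [mul_assoc] at this
      rw [this]; ring
    simp only [e]
    rw [← mul_sum]
    field_simp
  · intro k _
    exact integrableOn_mul_wprod hκ (by fun_prop)

theorem poch_reflect (x : ℝ) (n : ℕ) : poch (1 - x - n) n = (-1) ^ n * poch x n := by
  induction n with
  | zero => simp [poch_zero]
  | succ n ih =>
    rw [poch_succ', poch_succ,
      show 1 - x - ((n + 1 : ℕ) : ℝ) + 1 = 1 - x - n by push_cast; ring, ih, pow_succ]
    push_cast; ring

theorem poch_neg_natCast (p k : ℕ) : poch (-(p : ℝ)) k =
    if k ≤ p then (-1 : ℝ) ^ k * p.factorial / (p - k).factorial else 0 := by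
  induction k with
  | zero => simp [poch_zero, Nat.factorial_ne_zero]
  | succ k ih =>
    rw [poch_succ, ih]
    by_cases h : k + 1 ≤ p
    · obtain ⟨r, rfl⟩ := Nat.exists_eq_add_of_le h
      rw [if_pos h, if_pos (by omega), show k + 1 + r - k = r + 1 by omega, Nat.add_sub_cancel_left,
        Nat.factorial_succ r]
      push_cast
      field_simp
      ring
    · rw [if_neg h]
      split_ifs with h1
      · rw [show k = p by omega]; simp
      · simp

theorem sum_inv_factorial_poch {c : ℝ} (hc : 0 < c) (p q : ℕ) :
    ∑ L ∈ range (q + 1), (if L ≤ p then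
      1 / ((L.factorial : ℝ) * (p - L).factorial * (q - L).factorial * poch c L) else 0) =
      poch c (p + q) / (poch c p * poch c q * p.factorial * q.factorial) := by
  have hv := poch_vandermonde (1 - c - q) (-(p : ℝ)) q
  rw [show 1 - c - q + -(p : ℝ) = 1 - (c + p) - q by ring, poch_reflect] at hv
  have hp := poch_pos hc p
  have hq := poch_pos hc q
  have hs : ((-1 : ℝ) ^ q) * (-1) ^ q = 1 := by rw [← mul_pow]; norm_num
  have e : poch (c + p) q = (-1) ^ q * ∑ k ∈ range (q + 1),
      q.choose k * poch (1 - c - q) (q - k) * poch (-(p : ℝ)) k := by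
    rw [← hv, ← mul_assoc, hs, one_mul]
  rw [poch_add, e, mul_sum, mul_sum, sum_div]
  refine sum_congr rfl fun k hk => ?_
  obtain ⟨r, rfl⟩ := Nat.exists_eq_add_of_le (Nat.lt_succ_iff.1 (mem_range.1 hk))
  rw [poch_neg_natCast]
  split_ifs with h
  · have hck := poch_pos hc k
    have hckr := poch_pos (show 0 < c + k by positivity) r
    have h1 : poch (1 - c - ((k + r : ℕ) : ℝ)) r = (-1) ^ r * poch (c + k) r := by
      rw [← poch_reflect]; congr 1; push_cast; ring
    have h2 : ((k + r).choose k : ℝ) = (k + r).factorial / (k.factorial * r.factorial) := by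
      rw [Nat.cast_choose ℝ (Nat.le_add_right k r), Nat.add_sub_cancel_left]
    have h3 : ((-1 : ℝ) ^ (k + r)) * ((-1) ^ r * (-1) ^ k) = 1 := by
      rw [← pow_add, ← pow_add, show k + r + (r + k) = 2 * (k + r) by ring, pow_mul]
      norm_num
    rw [Nat.add_sub_cancel_left, h1, h2, poch_add c k r]
    have h4 : poch c p * ((-1) ^ (k + r) * ((k + r).factorial / (k.factorial * r.factorial) *
        ((-1) ^ r * poch (c + k) r) * ((-1) ^ k * p.factorial / (p - k).factorial))) =
        ((-1) ^ (k + r) * ((-1) ^ r * (-1) ^ k)) * (poch c p * ((k + r).factorial /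
          (k.factorial * r.factorial) * poch (c + k) r * (p.factorial / (p - k).factorial))) := by
      ring
    rw [h4, h3, one_mul]
    field_simp
  · simp

/-- The power series of `exp (a t²)`. -/
noncomputable def gaussSeries (a : ℝ) : PowerSeries ℝ :=
  PowerSeries.expand 2 two_ne_zero (PowerSeries.rescale a (PowerSeries.exp ℝ))

theorem coeff_gaussSeries_even (a : ℝ) (n : ℕ) :
    PowerSeries.coeff (2 * n) (gaussSeries a) = a ^ n / n.factorial := by
  rw [gaussSeries, PowerSeries.coeff_expand_mul, PowerSeries.coeff_rescale, PowerSeries.coeff_exp]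
  simp [div_eq_mul_inv]

theorem coeff_gaussSeries_odd (a : ℝ) (n : ℕ) :
    PowerSeries.coeff (2 * n + 1) (gaussSeries a) = 0 := by
  rw [gaussSeries, PowerSeries.coeff_expand_of_not_dvd]
  omega

theorem coeff_gaussSeries_sq_mul (x a : ℝ) (n : ℕ) :
    PowerSeries.coeff n (gaussSeries (x ^ 2 * a)) =
      x ^ n * PowerSeries.coeff n (gaussSeries a) := by
  obtain ⟨p, rfl | rfl⟩ := Nat.even_or_odd' n
  · rw [coeff_gaussSeries_even, coeff_gaussSeries_even, mul_pow, pow_mul, mul_div_assoc]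
  · rw [coeff_gaussSeries_odd, coeff_gaussSeries_odd, mul_zero]

theorem gaussSeries_sum {ι : Type*} (s : Finset ι) (a : ι → ℝ) :
    ∏ i ∈ s, gaussSeries (a i) = gaussSeries (∑ i ∈ s, a i) := by
  classical
  induction s using Finset.induction_on with
  | empty => simp [gaussSeries, PowerSeries.rescale_zero]
  | insert i s hi ih =>
    rw [prod_insert hi, sum_insert hi, ih, gaussSeries, gaussSeries, gaussSeries, ← map_mul,
      PowerSeries.exp_mul_exp_eq_exp_add]

/-- The two-variable series `A(s) B(r) E(s r)`. -/
noncomputable def kernelSeries (A B E : PowerSeries ℝ) : PowerSeries (PowerSeries ℝ) :=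
  PowerSeries.C A * PowerSeries.map PowerSeries.C B *
    PowerSeries.rescale PowerSeries.X (PowerSeries.map PowerSeries.C E)

theorem coeff_kernelSeries (A B E : PowerSeries ℝ) (j m : ℕ) :
    PowerSeries.coeff j (PowerSeries.coeff m (kernelSeries A B E)) =
      ∑ p ∈ antidiagonal m, PowerSeries.coeff p.1 B * PowerSeries.coeff p.2 E *
        (if p.2 ≤ j then PowerSeries.coeff (j - p.2) A else 0) := by
  have h : PowerSeries.coeff m (kernelSeries A B E) = ∑ p ∈ antidiagonal m, A *
      (PowerSeries.coeff p.1 (PowerSeries.map PowerSeries.C B) *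
        PowerSeries.coeff p.2 (PowerSeries.rescale PowerSeries.X
          (PowerSeries.map PowerSeries.C E))) := by
    rw [← mul_sum, ← PowerSeries.coeff_mul, ← PowerSeries.coeff_C_mul, ← mul_assoc]; rfl
  rw [h, map_sum]
  refine sum_congr rfl fun p _ => ?_
  rw [PowerSeries.coeff_rescale, PowerSeries.coeff_map, PowerSeries.coeff_map]
  have : A * (PowerSeries.C (PowerSeries.coeff p.1 B) *
      (PowerSeries.X ^ p.2 * PowerSeries.C (PowerSeries.coeff p.2 E))) =
      PowerSeries.C (PowerSeries.coeff p.1 B * PowerSeries.coeff p.2 E) *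
        (A * PowerSeries.X ^ p.2) := by
    rw [map_mul]; ring
  rw [this, PowerSeries.coeff_C_mul, PowerSeries.coeff_mul_X_pow']

theorem kernelSeries_prod {ι : Type*} (s : Finset ι) (A B E : ι → PowerSeries ℝ) :
    ∏ i ∈ s, kernelSeries (A i) (B i) (E i) =
      kernelSeries (∏ i ∈ s, A i) (∏ i ∈ s, B i) (∏ i ∈ s, E i) := by
  simp only [kernelSeries, prod_mul_distrib, map_prod]

theorem sum_antidiagonal_even (F : ℕ → ℕ → ℝ) (m : ℕ) (hF : ∀ b l, F (2 * b + 1) l = 0) :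
    ∑ p ∈ antidiagonal m, F p.1 p.2 = ∑ b ∈ range (m / 2 + 1), F (2 * b) (m - 2 * b) := by
  symm
  rw [← sum_filter_add_sum_filter_not (antidiagonal m) (fun p => p.1 % 2 = 0)]
  rw [sum_eq_zero (s := filter (fun p => ¬ p.1 % 2 = 0) (antidiagonal m)), add_zero]
  · refine sum_bij' (fun b _ => (2 * b, m - 2 * b)) (fun p _ => p.1 / 2) ?_ ?_ ?_ ?_ ?_
    · intro b hb; rw [mem_range] at hb; simp only [mem_filter, HasAntidiagonal.mem_antidiagonal]; omega
    · intro p hp; simp only [mem_filter, HasAntidiagonal.mem_antidiagonal] at hp; rw [mem_range]; omega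
    · intro b _; simp
    · intro p hp
      simp only [mem_filter, HasAntidiagonal.mem_antidiagonal] at hp
      ext <;> simp only <;> omega
    · intro b _; rfl
  · intro p hp
    simp only [mem_filter] at hp
    rw [show p.1 = 2 * (p.1 / 2) + 1 by omega, hF]

/-- The moments `∫ y^n |y|^(2c-1) e^(-y²)`, normalised to be `1` for `n = 0`. -/
noncomputable def gaussMoment (c : ℝ) (n : ℕ) : ℝ := if n % 2 = 0 then poch c (n / 2) else 0

theorem epsCoef_mul_gaussMoment {c : ℝ} (hc : 0 < c) (α β : ℕ) :
    epsCoef c α * epsCoef c β * gaussMoment c (α + β) =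
      ∑ p ∈ antidiagonal β, PowerSeries.coeff p.1 (gaussSeries (1 / 4)) *
        (epsCoef c p.2 * (1 / 2) ^ p.2) *
        (if p.2 ≤ α then PowerSeries.coeff (α - p.2) (gaussSeries (1 / 4)) else 0) := by
  rw [sum_antidiagonal_even (fun b l => PowerSeries.coeff b (gaussSeries (1 / 4)) *
        (epsCoef c l * (1 / 2) ^ l) *
        (if l ≤ α then PowerSeries.coeff (α - l) (gaussSeries (1 / 4)) else 0)) β
    (fun b l => by simp only [coeff_gaussSeries_odd, zero_mul])]
  by_cases hpar : (α + β) % 2 = 0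
  · rw [gaussMoment, if_pos hpar]
    obtain ⟨q, rfl | rfl⟩ := Nat.even_or_odd' β
    · obtain ⟨p, rfl⟩ : ∃ p, α = 2 * p := ⟨α / 2, by omega⟩
      rw [show 2 * q / 2 = q by omega, show (2 * p + 2 * q) / 2 = p + q by omega,
        ← sum_range_reflect, epsCoef_even, epsCoef_even]
      have := sum_inv_factorial_poch hc p q
      have e : 1 / (4 ^ p * p.factorial * poch c p) * (1 / (4 ^ q * q.factorial * poch c q)) *
          poch c (p + q) = (1 / 4 ^ (p + q)) *
            (poch c (p + q) / (poch c p * poch c q * p.factorial * q.factorial)) := by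
        rw [pow_add]; field_simp
      rw [e, ← this, mul_sum]
      refine sum_congr rfl fun L hL => ?_
      have hL' := mem_range.1 hL
      rw [show q + 1 - 1 - L = q - L by omega, coeff_gaussSeries_even,
        show 2 * q - 2 * (q - L) = 2 * L by omega]
      by_cases h : L ≤ p
      · rw [if_pos h, if_pos (by omega), show 2 * p - 2 * L = 2 * (p - L) by omega,
          coeff_gaussSeries_even, epsCoef_even]
        obtain ⟨r, rfl⟩ := Nat.exists_eq_add_of_le h
        obtain ⟨r', rfl⟩ := Nat.exists_eq_add_of_le (Nat.lt_succ_iff.1 hL')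
        have := poch_pos hc L
        simp only [Nat.add_sub_cancel_left, pow_mul, pow_add, div_pow, one_pow]
        norm_num
        field_simp
      · rw [if_neg h, if_neg (by omega), mul_zero, mul_zero]
    · obtain ⟨p, rfl⟩ : ∃ p, α = 2 * p + 1 := ⟨α / 2, by omega⟩
      rw [show (2 * q + 1) / 2 = q by omega,
        show (2 * p + 1 + (2 * q + 1)) / 2 = p + q + 1 by omega,
        ← sum_range_reflect, epsCoef_odd, epsCoef_odd]
      have := sum_inv_factorial_poch (show 0 < c + 1 by positivity) p q
      have hp := poch_pos (show 0 < c + 1 by positivity) p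
      have hq := poch_pos (show 0 < c + 1 by positivity) q
      have e : 1 / (2 * 4 ^ p * p.factorial * poch c (p + 1)) *
          (1 / (2 * 4 ^ q * q.factorial * poch c (q + 1))) * poch c (p + q + 1) =
          (1 / (4 * c * 4 ^ (p + q))) * (poch (c + 1) (p + q) /
            (poch (c + 1) p * poch (c + 1) q * p.factorial * q.factorial)) := by
        rw [pow_add, poch_succ', poch_succ', poch_succ']; field_simp; ring
      rw [e, ← this, mul_sum]
      refine sum_congr rfl fun L hL => ?_
      have hL' := mem_range.1 hL
      rw [show q + 1 - 1 - L = q - L by omega, coeff_gaussSeries_even,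
        show 2 * q + 1 - 2 * (q - L) = 2 * L + 1 by omega]
      by_cases h : L ≤ p
      · rw [if_pos h, if_pos (by omega), show 2 * p + 1 - (2 * L + 1) = 2 * (p - L) by omega,
          coeff_gaussSeries_even, epsCoef_odd, poch_succ']
        obtain ⟨r, rfl⟩ := Nat.exists_eq_add_of_le h
        obtain ⟨r', rfl⟩ := Nat.exists_eq_add_of_le (Nat.lt_succ_iff.1 hL')
        have := poch_pos (show 0 < c + 1 by positivity) L
        simp only [Nat.add_sub_cancel_left, pow_mul, pow_add, div_pow, one_pow]
        norm_num
        field_simp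
        norm_num
      · rw [if_neg h, if_neg (by omega), mul_zero, mul_zero]
  · rw [gaussMoment, if_neg hpar, mul_zero]
    symm
    refine sum_eq_zero fun b hb => ?_
    have := mem_range.1 hb
    split_ifs with h
    · rw [show α - (β - 2 * b) = 2 * ((α - (β - 2 * b)) / 2) + 1 by omega, coeff_gaussSeries_odd,
        mul_zero]
    · rw [mul_zero]

theorem sum_prod_epsCoef_mul_gaussMoment {d : ℕ} {κ : Fin d → ℝ} (hκ : ∀ i, 0 < κ i)
    (x z : Fin d → ℝ) (j m : ℕ) :
    ∑ α ∈ piAntidiag univ j, ∑ β ∈ piAntidiag univ m, ∏ i, (x i ^ α i * z i ^ β i *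
      (epsCoef (κ i + 1 / 2) (α i) * epsCoef (κ i + 1 / 2) (β i) *
        gaussMoment (κ i + 1 / 2) (α i + β i))) =
      PowerSeries.coeff j (PowerSeries.coeff m (kernelSeries
        (gaussSeries ((∑ i, x i ^ 2) * (1 / 4))) (gaussSeries ((∑ i, z i ^ 2) * (1 / 4)))
        (PowerSeries.rescale (1 / 2) (momentSeries κ fun i => x i * z i)))) := by
  have e : kernelSeries
        (gaussSeries ((∑ i, x i ^ 2) * (1 / 4))) (gaussSeries ((∑ i, z i ^ 2) * (1 / 4)))
        (PowerSeries.rescale (1 / 2) (momentSeries κ fun i => x i * z i)) =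
      ∏ i, kernelSeries (gaussSeries (x i ^ 2 * (1 / 4))) (gaussSeries (z i ^ 2 * (1 / 4)))
        (PowerSeries.rescale (1 / 2) (PowerSeries.rescale (x i * z i)
          (PowerSeries.mk (epsCoef (κ i + 1 / 2))))) := by
    rw [kernelSeries_prod, gaussSeries_sum, gaussSeries_sum, sum_mul, sum_mul, momentSeries,
      map_prod]
  rw [e, PowerSeries.coeff_prod_univ, map_sum, sum_comm]
  refine sum_congr rfl fun β _ => ?_
  rw [PowerSeries.coeff_prod_univ]
  refine sum_congr rfl fun α _ => prod_congr rfl fun i _ => ?_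
  have hc : 0 < κ i + 1 / 2 := by have := hκ i; positivity
  rw [coeff_kernelSeries, epsCoef_mul_gaussMoment hc, mul_sum]
  refine sum_congr rfl fun p hp => ?_
  rw [HasAntidiagonal.mem_antidiagonal] at hp
  rw [coeff_gaussSeries_sq_mul, coeff_gaussSeries_sq_mul, PowerSeries.coeff_rescale,
    PowerSeries.coeff_rescale, PowerSeries.coeff_mk, mul_pow, ← hp]
  split_ifs with h
  · obtain ⟨r, hr⟩ := Nat.exists_eq_add_of_le h
    rw [hr, Nat.add_sub_cancel_left, pow_add, pow_add]; ring
  · simp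

theorem integral_eq_integral_toSphere_mul {E : Type*} [NormedAddCommGroup E] [NormedSpace ℝ E]
    [MeasurableSpace E] [BorelSpace E] [FiniteDimensional ℝ E] [Nontrivial E] (μ : Measure E)
    [μ.IsAddHaarMeasure] {f : E → ℝ} {F : Metric.sphere (0 : E) 1 → ℝ} {G : ℝ → ℝ}
    (h : ∀ (y : Metric.sphere (0 : E) 1) (r : ℝ), 0 < r → f (r • (y : E)) = F y * G r) :
    ∫ x, f x ∂μ = (∫ y, F y ∂μ.toSphere) *
      ∫ r in Set.Ioi (0 : ℝ), r ^ (Module.finrank ℝ E - 1) * G r := by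
  calc
    ∫ x, f x ∂μ = ∫ x : ({(0)}ᶜ : Set E), f x.1 ∂(μ.comap (↑)) := by
      rw [integral_subtype_comap (measurableSet_singleton _).compl fun x ↦ f x,
        restrict_compl_singleton]
    _ = ∫ x : ({(0)}ᶜ : Set E), (fun p : Metric.sphere (0 : E) 1 × Set.Ioi (0 : ℝ) =>
          F p.1 * G p.2) (homeomorphUnitSphereProd E x) ∂(μ.comap (↑)) := by
      refine integral_congr_ae (Filter.Eventually.of_forall fun x => ?_)
      simp only
      rw [← h _ _ (homeomorphUnitSphereProd E x).2.2, ← homeomorphUnitSphereProd_symm_apply_coe,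
        Homeomorph.symm_apply_apply]
    _ = ∫ p, F p.1 * G p.2 ∂μ.toSphere.prod (.volumeIoiPow (Module.finrank ℝ E - 1)) :=
      μ.measurePreserving_homeomorphUnitSphereProd.integral_comp
        (Homeomorph.measurableEmbedding _)
        (fun p : Metric.sphere (0 : E) 1 × Set.Ioi (0 : ℝ) => F p.1 * G p.2)
    _ = (∫ y, F y ∂μ.toSphere) *
          ∫ r : Set.Ioi (0 : ℝ), G r ∂.volumeIoiPow (Module.finrank ℝ E - 1) :=
      integral_prod_mul F fun r : Set.Ioi (0 : ℝ) => G r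
    _ = _ := by
      congr 1
      simp only [Measure.volumeIoiPow, ENNReal.ofReal]
      rw [integral_withDensity_eq_integral_smul,
        integral_subtype_comap measurableSet_Ioi
          fun a ↦ Real.toNNReal (a ^ (Module.finrank ℝ E - 1)) • G a,
        setIntegral_congr_fun measurableSet_Ioi fun x hx ↦ ?_]
      · rw [NNReal.smul_def, Real.coe_toNNReal _ (pow_nonneg hx.out.le _), smul_eq_mul]
      · exact (measurable_subtype_coe.pow_const _).real_toNNReal

theorem Gamma_add_natCast_eq_poch {c : ℝ} (hc : 0 < c) (n : ℕ) :
    Gamma (c + n) = Gamma c * poch c n := by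
  induction n with
  | zero => simp [poch_zero]
  | succ n ih =>
    rw [poch_succ, Nat.cast_succ, ← add_assoc, Gamma_add_one (by positivity), ih]; ring

theorem integral_rpow_mul_exp_neg_sq {q : ℝ} (hq : 0 < q) :
    ∫ x in Set.Ioi (0 : ℝ), x ^ (2 * q - 1) * exp (-x ^ 2) = Gamma q / 2 := by
  have := integral_rpow_mul_exp_neg_rpow (p := 2) (q := 2 * q - 1) two_pos (by linarith)
  simp only [rpow_two] at this
  rw [this, show (2 * q - 1 + 1) / 2 = q by ring]; ring

theorem integral_pow_mul_abs_rpow_mul_exp_neg_sq {k : ℝ} (hk : 0 < k) (n : ℕ) :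
    ∫ t : ℝ, t ^ n * |t| ^ (2 * k) * exp (-t ^ 2) =
      Gamma (k + 1 / 2) * gaussMoment (k + 1 / 2) n := by
  obtain ⟨p, rfl | rfl⟩ := Nat.even_or_odd' n
  · have h1 : ∀ t : ℝ, t ^ (2 * p) * |t| ^ (2 * k) * exp (-t ^ 2) =
        (fun s : ℝ => s ^ (2 * p) * s ^ (2 * k) * exp (-s ^ 2)) |t| := fun t => by
      simp only [pow_mul, sq_abs]
    simp_rw [h1]
    rw [integral_comp_abs (f := fun s : ℝ => s ^ (2 * p) * s ^ (2 * k) * exp (-s ^ 2)),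
      setIntegral_congr_fun (g := fun s : ℝ => s ^ (2 * (k + 1 / 2 + p) - 1) * exp (-s ^ 2))
        measurableSet_Ioi, integral_rpow_mul_exp_neg_sq (by positivity),
      Gamma_add_natCast_eq_poch (by positivity), gaussMoment, if_pos (by omega),
      show 2 * p / 2 = p by omega]
    · ring
    · intro s hs
      simp only
      rw [← rpow_natCast, ← rpow_add hs]
      congr 2
      push_cast; ring
  · have h := integral_neg_eq_self (fun t : ℝ => t ^ (2 * p + 1) * |t| ^ (2 * k) * exp (-t ^ 2))
      volume
    simp only [abs_neg, (odd_two_mul_add_one p).neg_pow, neg_mul, integral_neg,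
      even_two.neg_pow] at h
    rw [gaussMoment, if_neg (by omega)]
    linarith

theorem integral_prod_pow_mul_hsq_mul_exp {m : ℕ} {κ : Fin m → ℝ} (hκ : ∀ i, 0 < κ i)
    (α : Fin m → ℕ) :
    ∫ x : EuclideanSpace ℝ (Fin m), (∏ i, x i ^ α i) * hsq κ x * exp (-‖x‖ ^ 2) =
      ∏ i, (Gamma (κ i + 1 / 2) * gaussMoment (κ i + 1 / 2) (α i)) := by
  have h := (PiLp.volume_preserving_toLp (Fin m)).integral_comp
    (MeasurableEquiv.toLp 2 (Fin m → ℝ)).measurableEmbedding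
    (fun x : EuclideanSpace ℝ (Fin m) => (∏ i, x i ^ α i) * hsq κ x * exp (-‖x‖ ^ 2))
  rw [← h, ← prod_congr rfl fun i _ => integral_pow_mul_abs_rpow_mul_exp_neg_sq (hκ i) (α i),
    ← integral_fintype_prod_volume_eq_prod]
  refine integral_congr_ae (Filter.Eventually.of_forall fun x => ?_)
  simp only [hsq, EuclideanSpace.norm_sq_eq, norm_eq_abs, sq_abs, ← sum_neg_distrib, exp_sum,
    ← prod_mul_distrib]

/-- The normalised sphere moments. -/
theorem integral_sphere_prod_pow_mul {d : ℕ} (hd : 1 ≤ d) {κ : Fin (d + 1) → ℝ} (hκ : ∀ i, 0 < κ i)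
    (α : Fin (d + 1) → ℕ) :
    (∫ y : Metric.sphere (0 : EuclideanSpace ℝ (Fin (d + 1))) 1,
        (∏ i, (y : EuclideanSpace ℝ (Fin (d + 1))) i ^ α i) * hsq κ y ∂(sphereMeas d)) *
      (Gamma (lamK d κ + 1 + (∑ i, α i : ℕ) / 2) / 2) =
      ∏ i, (Gamma (κ i + 1 / 2) * gaussMoment (κ i + 1 / 2) (α i)) := by
  have hl := lamK_pos hd hκ
  rw [← integral_prod_pow_mul_hsq_mul_exp hκ, sphereMeas,
    integral_eq_integral_toSphere_mul volume (F := fun y =>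
      (∏ i, (y : EuclideanSpace ℝ (Fin (d + 1))) i ^ α i) * hsq κ y)
      (G := fun r => r ^ (∑ i, α i) * r ^ (2 * ∑ i, κ i) * exp (-r ^ 2)),
    ← integral_rpow_mul_exp_neg_sq (by positivity)]
  · congr 1
    refine setIntegral_congr_fun measurableSet_Ioi fun r hr => ?_
    simp only [finrank_euclideanSpace_fin, Nat.add_sub_cancel]
    rw [← rpow_natCast r d, ← rpow_natCast r (∑ i, α i), ← mul_assoc, ← mul_assoc,
      ← rpow_add hr, ← rpow_add hr, lamK]
    congr 2
    push_cast; ring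
  · intro y r hr
    have hn : ‖(y : EuclideanSpace ℝ (Fin (d + 1)))‖ = 1 := by simp
    rw [norm_smul, hn, mul_one, norm_eq_abs, sq_abs]
    simp only [hsq, PiLp.smul_apply, smul_eq_mul, mul_pow, abs_mul, abs_of_pos hr]
    simp_rw [mul_rpow hr.le (abs_nonneg _)]
    rw [prod_mul_distrib, prod_mul_distrib, prod_pow_eq_pow_sum, mul_sum,
      rpow_sum_of_pos hr]
    ring

/-- Integration against `h_κ²` on the sphere, normalised to total mass one. -/
noncomputable def sphAvg (d : ℕ) (κ : Fin (d + 1) → ℝ)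
    (f : Metric.sphere (0 : EuclideanSpace ℝ (Fin (d + 1))) 1 → ℝ) : ℝ :=
  (∫ y, hsq κ y ∂(sphereMeas d))⁻¹ * ∫ y, f y * hsq κ y ∂(sphereMeas d)

theorem integral_hsq_pos {d : ℕ} (hd : 1 ≤ d) {κ : Fin (d + 1) → ℝ} (hκ : ∀ i, 0 < κ i) :
    0 < ∫ y : Metric.sphere (0 : EuclideanSpace ℝ (Fin (d + 1))) 1, hsq κ y ∂(sphereMeas d) := by
  have h := integral_sphere_prod_pow_mul hd hκ 0
  have hl := lamK_pos hd hκ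
  simp only [Pi.zero_apply, pow_zero, prod_const_one, one_mul, sum_const_zero, Nat.cast_zero,
    zero_div, add_zero, gaussMoment, Nat.zero_mod, if_true, Nat.zero_div, poch_zero, mul_one] at h
  have h1 : 0 < ∏ i, Gamma (κ i + 1 / 2) :=
    prod_pos fun i _ => Gamma_pos_of_pos (by have := hκ i; positivity)
  rw [← h] at h1
  exact (pos_iff_pos_of_mul_pos h1).2 (by
    have := Gamma_pos_of_pos (show 0 < lamK d κ + 1 by positivity)
    positivity)

theorem sphAvg_prod_pow {d : ℕ} (hd : 1 ≤ d) {κ : Fin (d + 1) → ℝ} (hκ : ∀ i, 0 < κ i)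
    (α : Fin (d + 1) → ℕ) :
    sphAvg d κ (fun y => ∏ i, (y : EuclideanSpace ℝ (Fin (d + 1))) i ^ α i) =
      (∏ i, gaussMoment (κ i + 1 / 2) (α i)) / poch (lamK d κ + 1) ((∑ i, α i) / 2) := by
  have hl := lamK_pos hd hκ
  have h0 := integral_sphere_prod_pow_mul hd hκ 0
  have h1 := integral_sphere_prod_pow_mul hd hκ α
  have hpos := integral_hsq_pos hd hκ
  have hG := Gamma_pos_of_pos (show 0 < lamK d κ + 1 by positivity)
  simp only [Pi.zero_apply, pow_zero, prod_const_one, one_mul, sum_const_zero, Nat.cast_zero,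
    zero_div, add_zero, gaussMoment, Nat.zero_mod, if_true, Nat.zero_div, poch_zero, mul_one] at h0
  rw [prod_mul_distrib, ← h0] at h1
  have hp := poch_pos (show 0 < lamK d κ + 1 by positivity) ((∑ i, α i) / 2)
  rw [sphAvg]
  by_cases he : ∀ i, α i % 2 = 0
  · have hs : (∑ i, α i) % 2 = 0 := by
      rw [sum_nat_mod, sum_eq_zero (fun i _ => he i), Nat.zero_mod]
    have hc : (((∑ i, α i : ℕ)) : ℝ) / 2 = (((∑ i, α i) / 2 : ℕ) : ℝ) := by
      obtain ⟨q, hq⟩ := Nat.dvd_of_mod_eq_zero hs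
      rw [hq]; push_cast; simp
    rw [hc, Gamma_add_natCast_eq_poch (by positivity)] at h1
    rw [inv_mul_eq_div, div_eq_div_iff hpos.ne' hp.ne']
    refine mul_right_cancel₀ (half_pos hG).ne' ?_
    linear_combination h1
  · push Not at he
    obtain ⟨i, hi⟩ := he
    have hz : ∏ i, gaussMoment (κ i + 1 / 2) (α i) = 0 :=
      prod_eq_zero (mem_univ i) (by rw [gaussMoment, if_neg hi])
    rw [hz, mul_zero] at h1
    have hG' := Gamma_pos_of_pos (show 0 < lamK d κ + 1 + ((∑ i, α i : ℕ) : ℝ) / 2 by positivity)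
    rw [(mul_eq_zero_iff_right (by positivity)).1 h1, hz]
    simp

/-- The unit sphere `S^d`. -/
abbrev unitSph (d : ℕ) : Set (EuclideanSpace ℝ (Fin (d + 1))) := Metric.sphere 0 1

theorem continuous_hsq {m : ℕ} {κ : Fin m → ℝ} (hκ : ∀ i, 0 < κ i) : Continuous (hsq κ) := by
  unfold hsq
  refine continuous_finsetProd _ fun i _ => ?_
  exact Continuous.rpow_const (by fun_prop) fun x => Or.inr (by have := hκ i; positivity)

theorem hsq_nonneg {m : ℕ} (κ : Fin m → ℝ) (y : EuclideanSpace ℝ (Fin m)) : 0 ≤ hsq κ y :=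
  prod_nonneg fun _ _ => rpow_nonneg (abs_nonneg _) _

theorem integrable_mul_hsq {d : ℕ} {κ : Fin (d + 1) → ℝ} (hκ : ∀ i, 0 < κ i) {f : unitSph d → ℝ}
    (hf : Continuous f) : Integrable (fun y => f y * hsq κ y) (sphereMeas d) := by
  have hfin : IsFiniteMeasure (sphereMeas d) := by unfold sphereMeas; infer_instance
  exact (hf.mul ((continuous_hsq hκ).comp continuous_subtype_val)).integrable_of_hasCompactSupport
    (HasCompactSupport.of_compactSpace _)

section

variable {d : ℕ} {κ : Fin (d + 1) → ℝ}

theorem sphAvg_const_mul (c : ℝ) (f : unitSph d → ℝ) :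
    sphAvg d κ (fun y => c * f y) = c * sphAvg d κ f := by
  simp only [sphAvg, mul_assoc c, integral_const_mul]; ring

theorem sphAvg_sum (hκ : ∀ i, 0 < κ i) {ι : Type*} (s : Finset ι) (f : ι → unitSph d → ℝ)
    (hf : ∀ i ∈ s, Continuous (f i)) :
    sphAvg d κ (fun y => ∑ i ∈ s, f i y) = ∑ i ∈ s, sphAvg d κ (f i) := by
  simp only [sphAvg, sum_mul]
  rw [integral_finsetSum _ fun i hi => integrable_mul_hsq hκ (hf i hi), mul_sum]

theorem sphAvg_add (hκ : ∀ i, 0 < κ i) {f g : unitSph d → ℝ} (hf : Continuous f)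
    (hg : Continuous g) : sphAvg d κ (fun y => f y + g y) = sphAvg d κ f + sphAvg d κ g := by
  simp only [sphAvg, add_mul]
  rw [integral_add (integrable_mul_hsq hκ hf) (integrable_mul_hsq hκ hg), mul_add]

theorem sphAvg_mono (hκ : ∀ i, 0 < κ i) {f g : unitSph d → ℝ} (hf : Continuous f)
    (hg : Continuous g) (h : ∀ y, f y ≤ g y) : sphAvg d κ f ≤ sphAvg d κ g := by
  unfold sphAvg
  refine mul_le_mul_of_nonneg_left ?_
    (inv_nonneg.2 (integral_nonneg fun y => hsq_nonneg κ y))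
  exact integral_mono (integrable_mul_hsq hκ hf) (integrable_mul_hsq hκ hg)
    fun y => mul_le_mul_of_nonneg_right (h y) (hsq_nonneg κ y)

theorem sphAvg_one (hd : 1 ≤ d) (hκ : ∀ i, 0 < κ i) : sphAvg d κ (fun _ => 1) = 1 := by
  simp only [sphAvg, one_mul]
  exact inv_mul_cancel₀ (integral_hsq_pos hd hκ).ne'

theorem sum_sq_unitSph (x : unitSph d) : ∑ i, x.1 i ^ 2 = 1 := by
  have h : ‖x.1‖ = 1 := by simp
  have := EuclideanSpace.norm_sq_eq x.1
  simp only [norm_eq_abs, sq_abs, h] at this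
  linarith

/-- The degree `m` homogeneous part of the series whose terms build `hP`. -/
noncomputable def zonalTerm (κ : Fin (d + 1) → ℝ) (m : ℕ) (x y : unitSph d) : ℝ :=
  PowerSeries.coeff m (momentSeries κ fun i => x.1 i * y.1 i)

theorem continuous_zonalTerm (κ : Fin (d + 1) → ℝ) (m : ℕ) (x : unitSph d) :
    Continuous (zonalTerm κ m x) :=
  (continuous_coeff_momentSeries κ m).comp (by fun_prop)

theorem sphAvg_zonalTerm_mul (hd : 1 ≤ d) (hκ : ∀ i, 0 < κ i) (j m : ℕ) (x z : unitSph d) :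
    sphAvg d κ (fun y => zonalTerm κ j x y * zonalTerm κ m z y) =
      PowerSeries.coeff j (PowerSeries.coeff m (kernelSeries
        (gaussSeries (1 / 4)) (gaussSeries (1 / 4))
        (PowerSeries.rescale (1 / 2) (momentSeries κ fun i => x.1 i * z.1 i)))) /
        poch (lamK d κ + 1) ((j + m) / 2) := by
  have h := sum_prod_epsCoef_mul_gaussMoment hκ x.1 z.1 j m
  rw [sum_sq_unitSph, sum_sq_unitSph, one_mul] at h
  have e : ∀ y : unitSph d, zonalTerm κ j x y * zonalTerm κ m z y =
      ∑ α ∈ piAntidiag univ j, ∑ β ∈ piAntidiag univ m,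
        (∏ i, (x.1 i ^ α i * z.1 i ^ β i * (epsCoef (κ i + 1 / 2) (α i) *
          epsCoef (κ i + 1 / 2) (β i)))) * ∏ i, y.1 i ^ ((α + β) i) := by
    intro y
    rw [zonalTerm, zonalTerm, coeff_momentSeries, coeff_momentSeries, sum_mul_sum]
    refine sum_congr rfl fun α _ => sum_congr rfl fun β _ => ?_
    rw [← prod_mul_distrib, ← prod_mul_distrib]
    refine prod_congr rfl fun i _ => ?_
    rw [Pi.add_apply, pow_add]; ring
  simp_rw [e]
  rw [← h, sum_div, sphAvg_sum hκ _ _ fun α _ => by fun_prop]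
  refine sum_congr rfl fun α hα => ?_
  rw [sum_div, sphAvg_sum hκ _ _ fun β _ => by fun_prop]
  refine sum_congr rfl fun β hβ => ?_
  have hs : ∑ i, (α + β) i = j + m := by
    rw [← (mem_piAntidiag.1 hα).1, ← (mem_piAntidiag.1 hβ).1, ← sum_add_distrib]; rfl
  rw [sphAvg_const_mul, sphAvg_prod_pow hd hκ, hs, ← mul_div_assoc, ← prod_mul_distrib]
  simp only [Pi.add_apply, mul_assoc]

theorem hP_eq_sum_zonalTerm (hd : 1 ≤ d) (hκ : ∀ i, 0 < κ i) (n : ℕ) (x y : unitSph d) :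
    hP d κ n x y = ((n + lamK d κ) / lamK d κ) * ∑ k ∈ range (n / 2 + 1),
      gegCoef n (lamK d κ) k * ((n - 2 * k).factorial * zonalTerm κ (n - 2 * k) x y) :=
  hP_eq_sum hd hκ n x y

theorem continuous_hP (hd : 1 ≤ d) (hκ : ∀ i, 0 < κ i) (n : ℕ) (x : unitSph d) :
    Continuous fun y : unitSph d => hP d κ n x y := by
  simp only [hP_eq_sum_zonalTerm hd hκ]
  refine continuous_const.mul (continuous_finsetSum _ fun k _ => ?_)
  exact continuous_const.mul (continuous_const.mul (continuous_zonalTerm κ _ x))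

end

theorem sum_choose_mul_poch_div {l : ℝ} (hl : 0 < l) {n p K : ℕ} (h : p + K ≤ n) :
    ∑ k ∈ range (K + 1), (-1) ^ k * K.choose k * poch l (n - k) / poch (l + 1) (n - k - p) =
      poch l (n - K) / poch (l + 1) (n - p) * poch (p - K) K := by
  have hv := poch_vandermonde (l + n - K) (-(l + n - p)) K
  rw [show l + n - K + -(l + n - p) = (p : ℝ) - K by ring] at hv
  rw [hv, mul_sum]
  refine sum_congr rfl fun k hk => ?_
  obtain ⟨r, rfl⟩ := Nat.exists_eq_add_of_le (Nat.lt_succ_iff.1 (mem_range.1 hk))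
  obtain ⟨s, rfl⟩ := Nat.exists_eq_add_of_le h
  rw [show p + (k + r) + s - k = (p + s) + r by omega, show p + s + r - p = s + r by omega,
    show p + (k + r) + s - (k + r) = p + s by omega, show p + (k + r) + s - p = s + r + k by omega,
    Nat.add_sub_cancel_left, poch_add l, poch_add (l + 1) (s + r) k]
  have h1 : poch (-(l + ((p + (k + r) + s : ℕ) : ℝ) - p)) k =
      (-1) ^ k * poch (l + 1 + ((s + r : ℕ) : ℝ)) k := by
    rw [← poch_reflect]; congr 1; push_cast; ring
  have h2 : l + ((p + (k + r) + s : ℕ) : ℝ) - ((k + r : ℕ) : ℝ) = l + ((p + s : ℕ) : ℝ) := by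
    push_cast; ring
  have h3 := poch_pos (show 0 < l + 1 by positivity) (s + r)
  have h4 := poch_pos (show 0 < l + 1 + ((s + r : ℕ) : ℝ) by positivity) k
  rw [h1, h2]
  field_simp

theorem poch_sub_eq_zero {p K : ℕ} (hp : 1 ≤ p) (hK : p ≤ K) : poch ((p : ℝ) - K) K = 0 := by
  rw [show (p : ℝ) - K = -((K - p : ℕ) : ℝ) by rw [Nat.cast_sub hK]; ring, poch_neg_natCast,
    if_neg (by omega)]

theorem poch_neg_self (K : ℕ) : poch (-(K : ℝ)) K = (-1) ^ K * K.factorial := by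
  rw [poch_neg_natCast, if_pos le_rfl]; simp

theorem coeff_kernelSeries_gaussSeries (M : PowerSeries ℝ) (j m : ℕ) :
    PowerSeries.coeff j (PowerSeries.coeff m (kernelSeries (gaussSeries (1 / 4))
      (gaussSeries (1 / 4)) (PowerSeries.rescale (1 / 2) M))) =
      ∑ b ∈ range (m / 2 + 1), (1 / 4) ^ b / b.factorial *
        ((1 / 2) ^ (m - 2 * b) * PowerSeries.coeff (m - 2 * b) M) *
          (if m - 2 * b ≤ j then PowerSeries.coeff (j - (m - 2 * b)) (gaussSeries (1 / 4))
            else 0) := by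
  rw [coeff_kernelSeries]
  simp only [PowerSeries.coeff_rescale]
  rw [sum_antidiagonal_even (fun b l => PowerSeries.coeff b (gaussSeries (1 / 4)) *
    ((1 / 2) ^ l * PowerSeries.coeff l M) *
      (if l ≤ j then PowerSeries.coeff (j - l) (gaussSeries (1 / 4)) else 0)) m
    fun b l => by rw [coeff_gaussSeries_odd, zero_mul, zero_mul]]
  simp only [coeff_gaussSeries_even]

theorem coeff_kernelSeries_gaussSeries_of_odd (M : PowerSeries ℝ) {j m : ℕ}
    (h : (j + m) % 2 = 1) :
    PowerSeries.coeff j (PowerSeries.coeff m (kernelSeries (gaussSeries (1 / 4))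
      (gaussSeries (1 / 4)) (PowerSeries.rescale (1 / 2) M))) = 0 := by
  rw [coeff_kernelSeries_gaussSeries]
  refine sum_eq_zero fun b hb => ?_
  have := mem_range.1 hb
  split_ifs with h1
  · rw [show j - (m - 2 * b) = 2 * ((j - (m - 2 * b)) / 2) + 1 by omega, coeff_gaussSeries_odd,
      mul_zero]
  · rw [mul_zero]

theorem gegCoef_mul_factorial (n : ℕ) (l : ℝ) (k : ℕ) :
    gegCoef n l k * (n - 2 * k).factorial =
      (-1) ^ k * poch l (n - k) * 2 ^ (n - 2 * k) / k.factorial := by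
  rw [gegCoef]; field_simp

theorem sum_gegCoef_mul_kernel_aux {l : ℝ} (M : PowerSeries ℝ) {n p b : ℕ}
    (hb : 2 * (p + b) ≤ n) (k : ℕ) (hk : k ≤ n / 2) :
    gegCoef n l k * (n - 2 * k).factorial * ((1 / 4) ^ b / b.factorial *
        ((1 / 2) ^ (n - 2 * p - 2 * b) * PowerSeries.coeff (n - 2 * p - 2 * b) M) *
          (if n - 2 * p - 2 * b ≤ n - 2 * k then PowerSeries.coeff
            (n - 2 * k - (n - 2 * p - 2 * b)) (gaussSeries (1 / 4)) else 0) /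
      poch (l + 1) ((n - 2 * k + (n - 2 * p)) / 2)) =
      (1 / 4) ^ b / b.factorial * PowerSeries.coeff (n - 2 * p - 2 * b) M / (p + b).factorial *
        if k ≤ p + b then
          (-1) ^ k * (p + b).choose k * poch l (n - k) / poch (l + 1) (n - k - p) else 0 := by
  rw [gegCoef_mul_factorial, show (n - 2 * k + (n - 2 * p)) / 2 = n - k - p by omega]
  by_cases h : k ≤ p + b
  · rw [if_pos h, if_pos (by omega),
      show n - 2 * k - (n - 2 * p - 2 * b) = 2 * (p + b - k) by omega, coeff_gaussSeries_even,
      Nat.cast_choose ℝ h]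
    obtain ⟨s, hs⟩ := Nat.exists_eq_add_of_le hb
    obtain ⟨r, hr⟩ := Nat.exists_eq_add_of_le h
    have e : (2 : ℝ) ^ (n - 2 * k) * ((1 / 2) ^ (n - 2 * p - 2 * b) * (1 / 4) ^ (p + b - k)) = 1 := by
      rw [show n - 2 * k = 2 * r + s by omega, show n - 2 * p - 2 * b = s by omega,
        show p + b - k = r by omega, pow_add, pow_mul]
      have h2 : (2 : ℝ) ^ s * (1 / 2) ^ s = 1 := by rw [← mul_pow]; norm_num
      have h4 : ((2 : ℝ) ^ 2) ^ r * (1 / 4) ^ r = 1 := by rw [← mul_pow]; norm_num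
      linear_combination ((2 ^ 2) ^ r * (1 / 4) ^ r) * h2 + h4
    field_simp at e ⊢
    linear_combination (poch l (n - k) / poch (l + 1) (n - k - p) *
      PowerSeries.coeff (n - 2 * p - 2 * b) M) * e
  · rw [if_neg h, if_neg (by omega)]; simp

theorem sum_gegCoef_mul_kernel {l : ℝ} (hl : 0 < l) (M : PowerSeries ℝ) {n p : ℕ}
    (hp : 2 * p ≤ n) :
    ∑ k ∈ range (n / 2 + 1), gegCoef n l k * (n - 2 * k).factorial *
      (PowerSeries.coeff (n - 2 * k) (PowerSeries.coeff (n - 2 * p) (kernelSeries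
        (gaussSeries (1 / 4)) (gaussSeries (1 / 4)) (PowerSeries.rescale (1 / 2) M))) /
        poch (l + 1) ((n - 2 * k + (n - 2 * p)) / 2)) =
      if p = 0 then (∑ k ∈ range (n / 2 + 1), gegCoef n l k * (n - 2 * k).factorial *
        PowerSeries.coeff (n - 2 * k) M) / (2 ^ n * poch (l + 1) n) else 0 := by
  have e : ∀ k ∈ range (n / 2 + 1), gegCoef n l k * (n - 2 * k).factorial *
      (PowerSeries.coeff (n - 2 * k) (PowerSeries.coeff (n - 2 * p) (kernelSeries
        (gaussSeries (1 / 4)) (gaussSeries (1 / 4)) (PowerSeries.rescale (1 / 2) M))) /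
        poch (l + 1) ((n - 2 * k + (n - 2 * p)) / 2)) = ∑ b ∈ range ((n - 2 * p) / 2 + 1),
      (1 / 4) ^ b / b.factorial * PowerSeries.coeff (n - 2 * p - 2 * b) M / (p + b).factorial *
        if k ≤ p + b then
          (-1) ^ k * (p + b).choose k * poch l (n - k) / poch (l + 1) (n - k - p) else 0 := by
    intro k hk
    have hk' := mem_range.1 hk
    rw [coeff_kernelSeries_gaussSeries, sum_div, mul_sum]
    refine sum_congr rfl fun b hb => ?_
    have hb' := mem_range.1 hb
    exact sum_gegCoef_mul_kernel_aux M (by omega) k (by omega)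
  rw [sum_congr rfl e, sum_comm]
  have e2 : ∀ b ∈ range ((n - 2 * p) / 2 + 1), ∑ k ∈ range (n / 2 + 1),
      (1 / 4) ^ b / b.factorial * PowerSeries.coeff (n - 2 * p - 2 * b) M / (p + b).factorial *
        (if k ≤ p + b then
          (-1) ^ k * (p + b).choose k * poch l (n - k) / poch (l + 1) (n - k - p) else 0) =
      (1 / 4) ^ b / b.factorial * PowerSeries.coeff (n - 2 * p - 2 * b) M / (p + b).factorial *
        (poch l (n - (p + b)) / poch (l + 1) (n - p) * poch (p - (p + b : ℕ)) (p + b)) := by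
    intro b hb
    have hb' := mem_range.1 hb
    rw [← mul_sum, ← sum_choose_mul_poch_div hl (show p + (p + b) ≤ n by omega), ← sum_filter]
    congr 1
    refine sum_congr ?_ fun _ _ => rfl
    ext k
    simp only [mem_filter, mem_range]
    omega
  rw [sum_congr rfl e2]
  split_ifs with h
  · subst h
    rw [sum_div]
    refine sum_congr rfl fun b hb => ?_
    have hb' := mem_range.1 hb
    rw [gegCoef_mul_factorial, Nat.cast_zero, zero_sub, poch_neg_self]
    simp only [mul_zero, Nat.sub_zero, zero_add]
    have h1 := poch_pos (show 0 < l + 1 by positivity) n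
    have h2 : (2 : ℝ) ^ n = 2 ^ (n - 2 * b) * 4 ^ b := by
      rw [show (4 : ℝ) = 2 ^ 2 by norm_num, ← pow_mul, ← pow_add]; congr 1; omega
    rw [h2, one_div, inv_pow]
    field_simp
  · refine sum_eq_zero fun b _ => ?_
    rw [poch_sub_eq_zero (by omega) (by omega), mul_zero, mul_zero]

section

variable {d : ℕ} {κ : Fin (d + 1) → ℝ}

theorem sphAvg_hP_mul_zonalTerm_eq_sum (hd : 1 ≤ d) (hκ : ∀ i, 0 < κ i) (n m : ℕ)
    (x z : unitSph d) : sphAvg d κ (fun y => hP d κ n x y * zonalTerm κ m z y) =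
      (n + lamK d κ) / lamK d κ * ∑ k ∈ range (n / 2 + 1),
        gegCoef n (lamK d κ) k * (n - 2 * k).factorial *
      (PowerSeries.coeff (n - 2 * k) (PowerSeries.coeff m (kernelSeries
        (gaussSeries (1 / 4)) (gaussSeries (1 / 4)) (PowerSeries.rescale (1 / 2)
          (momentSeries κ fun i => x.1 i * z.1 i)))) /
        poch (lamK d κ + 1) ((n - 2 * k + m) / 2)) := by
  have e : ∀ y : unitSph d, hP d κ n x y * zonalTerm κ m z y =
      (n + lamK d κ) / lamK d κ * ∑ k ∈ range (n / 2 + 1),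
        gegCoef n (lamK d κ) k * (n - 2 * k).factorial *
          (zonalTerm κ (n - 2 * k) x y * zonalTerm κ m z y) := fun y => by
    rw [hP_eq_sum_zonalTerm hd hκ, mul_assoc, sum_mul]
    congr 1
    exact sum_congr rfl fun k _ => by ring
  have hc : ∀ j : ℕ, Continuous fun y => zonalTerm κ j x y * zonalTerm κ m z y := fun j =>
    (continuous_zonalTerm κ j x).mul (continuous_zonalTerm κ m z)
  simp_rw [e]
  rw [sphAvg_const_mul, sphAvg_sum hκ]
  · simp only [sphAvg_const_mul, sphAvg_zonalTerm_mul hd hκ]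
  · exact fun k _ => continuous_const.mul (hc _)

theorem sphAvg_hP_mul_zonalTerm_self (hd : 1 ≤ d) (hκ : ∀ i, 0 < κ i) (n : ℕ)
    (x z : unitSph d) : sphAvg d κ (fun y => hP d κ n x y * zonalTerm κ n z y) =
      hP d κ n x z / (2 ^ n * poch (lamK d κ + 1) n) := by
  have h := sum_gegCoef_mul_kernel (lamK_pos hd hκ) (momentSeries κ fun i => x.1 i * z.1 i)
    (n := n) (p := 0) (by omega)
  rw [mul_zero, Nat.sub_zero, if_pos rfl] at h
  rw [sphAvg_hP_mul_zonalTerm_eq_sum hd hκ, h, hP_eq_sum hd hκ, mul_div_assoc]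
  simp only [mul_assoc]

theorem sphAvg_hP_mul_zonalTerm_of_lt (hd : 1 ≤ d) (hκ : ∀ i, 0 < κ i) {n m : ℕ} (hmn : m < n)
    (x z : unitSph d) : sphAvg d κ (fun y => hP d κ n x y * zonalTerm κ m z y) = 0 := by
  rw [sphAvg_hP_mul_zonalTerm_eq_sum hd hκ]
  by_cases hpar : (n + m) % 2 = 1
  · rw [sum_eq_zero, mul_zero]
    intro k hk
    have := mem_range.1 hk
    rw [coeff_kernelSeries_gaussSeries_of_odd _ (by omega), zero_div, mul_zero]
  · obtain ⟨p, rfl, hp⟩ : ∃ p, m = n - 2 * p ∧ 2 * p ≤ n := ⟨(n - m) / 2, by omega, by omega⟩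
    have h := sum_gegCoef_mul_kernel (lamK_pos hd hκ) (momentSeries κ fun i => x.1 i * z.1 i)
      hp
    rw [h, if_neg (by omega), mul_zero]

theorem sphAvg_hP_mul_hP (hd : 1 ≤ d) (hκ : ∀ i, 0 < κ i) (n : ℕ) (x z : unitSph d) :
    sphAvg d κ (fun y => hP d κ n x y * hP d κ n z y) = hP d κ n x z := by
  have hl := lamK_pos hd hκ
  have e : ∀ y : unitSph d, hP d κ n x y * hP d κ n z y =
      (n + lamK d κ) / lamK d κ * ∑ k ∈ range (n / 2 + 1),
        gegCoef n (lamK d κ) k * (n - 2 * k).factorial *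
          (hP d κ n x y * zonalTerm κ (n - 2 * k) z y) := fun y => by
    rw [hP_eq_sum_zonalTerm hd hκ n z, mul_left_comm, mul_sum]
    congr 1
    exact sum_congr rfl fun k _ => by ring
  simp_rw [e]
  rw [sphAvg_const_mul, sphAvg_sum hκ, sum_eq_single 0]
  · rw [sphAvg_const_mul, mul_zero, Nat.sub_zero, sphAvg_hP_mul_zonalTerm_self hd hκ]
    have h := gegCoef_mul_factorial n (lamK d κ) 0
    rw [mul_zero, Nat.sub_zero] at h
    have h1 : lamK d κ * poch (lamK d κ + 1) n = poch (lamK d κ) n * (lamK d κ + n) := by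
      rw [← poch_succ', poch_succ]
    have h2 := poch_pos (show 0 < lamK d κ + 1 by positivity) n
    rw [h]
    simp only [pow_zero, Nat.factorial_zero, Nat.cast_one]
    field_simp
    linear_combination (-hP d κ n x z) * h1
  · intro k hk hk0
    have := mem_range.1 hk
    rw [sphAvg_const_mul, sphAvg_hP_mul_zonalTerm_of_lt hd hκ (by omega), mul_zero]
  · intro h; simp at h
  · exact fun k _ => continuous_const.mul
      ((continuous_hP hd hκ n x).mul (continuous_zonalTerm κ _ z))

end

section

variable {d : ℕ} {κ : Fin (d + 1) → ℝ}

theorem sq_sphAvg_le (hd : 1 ≤ d) (hκ : ∀ i, 0 < κ i) {f : unitSph d → ℝ} (hf : Continuous f) :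
    sphAvg d κ f ^ 2 ≤ sphAvg d κ fun y => f y ^ 2 := by
  set a := sphAvg d κ f with ha
  have h : sphAvg d κ (fun y => 2 * a * f y) ≤ sphAvg d κ (fun y => f y ^ 2 + a ^ 2 * 1) :=
    sphAvg_mono hκ (by fun_prop) (by fun_prop) fun y => by nlinarith [sq_nonneg (f y - a)]
  rw [sphAvg_const_mul, sphAvg_add hκ (by fun_prop) (by fun_prop), sphAvg_const_mul,
    sphAvg_one hd hκ, ← ha] at h
  linarith

theorem exists_hP_self_le (hd : 1 ≤ d) (hκ : ∀ i, 0 < κ i) : ∃ C : ℝ, 0 < C ∧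
    ∀ n : ℕ, 1 ≤ n → ∀ x : unitSph d, hP d κ n x x ≤ C * (n : ℝ) ^ (2 * sigmaK d κ) := by
  have hl := lamK_pos hd hκ
  set k := univ.inf' univ_nonempty κ with hk
  have hkκ : ∀ i, k ≤ κ i := fun i => inf'_le _ (mem_univ i)
  have hk0 : 0 < k := (lt_inf'_iff _).2 fun i _ => hκ i
  have hd' : (1 : ℝ) ≤ d := by exact_mod_cast hd
  have h2k : 2 * k ≤ lamK d κ := by
    have h1 : ∑ _i : Fin (d + 1), k ≤ ∑ i, κ i := sum_le_sum fun i _ => hkκ i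
    rw [sum_const, card_univ, Fintype.card_fin, nsmul_eq_mul] at h1
    push_cast at h1
    unfold lamK
    nlinarith
  obtain ⟨C, hC, hb⟩ := exists_cube_bound hκ hl hk0 hkκ h2k
  have hw := integral_wprod_pos hκ
  refine ⟨(∫ t in cube (d + 1), wprod κ t)⁻¹ * ((1 + lamK d κ) / lamK d κ) * C, by positivity,
    fun n hn x => ?_⟩
  have hn' : (1 : ℝ) ≤ n := by exact_mod_cast hn
  have h := hb n hn (fun i => x.1 i ^ 2) (fun i => sq_nonneg _) (sum_sq_unitSph x)
  have e : 2 * sigmaK d κ = (2 * lamK d κ - 1 - 2 * k) + 1 := by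
    rw [sigmaK, lamK, ← hk]; ring
  rw [e, rpow_add_one (by positivity), hP]
  simp only [gegenC_eq_eval hl, ← sq]
  have h1 : ((n : ℝ) + lamK d κ) / lamK d κ ≤ (1 + lamK d κ) / lamK d κ * n := by
    rw [div_mul_eq_mul_div]
    gcongr
    nlinarith
  calc _ ≤ (∫ t in cube (d + 1), wprod κ t)⁻¹ * ((1 + lamK d κ) / lamK d κ * n) *
        (C * (n : ℝ) ^ (2 * lamK d κ - 1 - 2 * k)) := by
        refine mul_le_mul_of_nonneg ?_ ((le_abs_self _).trans h) (by positivity) (by positivity)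
        exact mul_le_mul_of_nonneg_left h1 (by positivity)
    _ = _ := by ring

theorem exists_sphAvg_abs_hP_le (hd : 1 ≤ d) (hκ : ∀ i, 0 < κ i) : ∃ C : ℝ, 0 < C ∧
    ∀ n : ℕ, 1 ≤ n → ∀ x : unitSph d,
      sphAvg d κ (fun y => |hP d κ n x y|) ≤ C * (n : ℝ) ^ sigmaK d κ := by
  obtain ⟨C, hC, h⟩ := exists_hP_self_le hd hκ
  refine ⟨√C, sqrt_pos.2 hC, fun n hn x => ?_⟩
  have h1 := sq_sphAvg_le hd hκ (continuous_hP hd hκ n x).abs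
  simp only [sq_abs, sq (hP d κ n _ _), sphAvg_hP_mul_hP hd hκ] at h1
  refine le_of_sq_le_sq ?_ (by positivity)
  rw [mul_pow, sq_sqrt hC.le, ← rpow_natCast ((n : ℝ) ^ _), ← rpow_mul (by positivity),
    Nat.cast_ofNat, mul_comm (sigmaK d κ)]
  exact h1.trans (h n hn x)

theorem zonalTerm_single (j : Fin (d + 1)) {e : unitSph d}
    (he : e.1 = EuclideanSpace.single j 1) (m : ℕ) (y : unitSph d) :
    zonalTerm κ m e y = y.1 j ^ m * epsCoef (κ j + 1 / 2) m := by
  rw [zonalTerm, momentSeries, prod_eq_single j]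
  · simp [he, PowerSeries.coeff_rescale]
  · intro i _ hi
    simp [he, hi, PowerSeries.rescale_zero, epsCoef_zero]
  · simp

theorem epsCoef_pos {c : ℝ} (hc : 0 < c) (m : ℕ) : 0 < epsCoef c m := by
  have := poch_pos hc ((m + 1) / 2)
  unfold epsCoef; positivity

theorem abs_apply_unitSph_le (y : unitSph d) (j : Fin (d + 1)) : |y.1 j| ≤ 1 := by
  have h := single_le_sum (f := fun i => y.1 i ^ 2) (fun i _ => sq_nonneg _) (mem_univ j)
  rw [sum_sq_unitSph] at h
  exact abs_le_one_iff_mul_self_le_one.2 (by rw [← sq]; exact h)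

theorem sphAvg_hP_mul_eval (hd : 1 ≤ d) (hκ : ∀ i, 0 < κ i) (j : Fin (d + 1)) {e : unitSph d}
    (he : e.1 = EuclideanSpace.single j 1) (n : ℕ) (p : Polynomial ℝ) (hp : p.natDegree ≤ n) :
    sphAvg d κ (fun y => hP d κ n e y * p.eval (y.1 j)) =
      p.coeff n * (hP d κ n e e /
        (2 ^ n * poch (lamK d κ + 1) n * epsCoef (κ j + 1 / 2) n)) := by
  have hε := fun m => epsCoef_pos (show 0 < κ j + 1 / 2 by have := hκ j; positivity) m
  have e1 : ∀ y : unitSph d, hP d κ n e y * p.eval (y.1 j) = ∑ m ∈ range (n + 1),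
      p.coeff m / epsCoef (κ j + 1 / 2) m * (hP d κ n e y * zonalTerm κ m e y) := fun y => by
    rw [Polynomial.eval_eq_sum_range' (Nat.lt_succ_of_le hp), mul_sum]
    refine sum_congr rfl fun m _ => ?_
    rw [zonalTerm_single j he]
    have := hε m
    generalize epsCoef (κ j + 1 / 2) m = ε at this ⊢
    field_simp
  simp_rw [e1]
  rw [sphAvg_sum hκ, sum_range_succ, sum_eq_zero, zero_add, sphAvg_const_mul,
    sphAvg_hP_mul_zonalTerm_self hd hκ]
  · have := hε n
    field_simp
  · intro m hm
    rw [sphAvg_const_mul, sphAvg_hP_mul_zonalTerm_of_lt hd hκ (mem_range.1 hm), mul_zero]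
  · exact fun m _ => continuous_const.mul
      ((continuous_hP hd hκ n e).mul (continuous_zonalTerm κ _ e))

theorem le_sphAvg_abs_hP (hd : 1 ≤ d) (hκ : ∀ i, 0 < κ i) (j : Fin (d + 1)) {e : unitSph d}
    (he : e.1 = EuclideanSpace.single j 1) (n : ℕ) :
    2 ^ (n - 1) * (hP d κ n e e / (2 ^ n * poch (lamK d κ + 1) n * epsCoef (κ j + 1 / 2) n)) ≤
      sphAvg d κ fun y => |hP d κ n e y| := by
  have hdeg : (Polynomial.Chebyshev.T ℝ n).natDegree = n := by simp
  have hlead : (Polynomial.Chebyshev.T ℝ n).coeff n = 2 ^ (n - 1) := by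
    have := Polynomial.Chebyshev.leadingCoeff_T ℝ n
    rw [Polynomial.leadingCoeff, hdeg] at this
    simpa using this
  rw [← hlead, ← sphAvg_hP_mul_eval hd hκ j he n _ hdeg.le]
  refine sphAvg_mono hκ ((continuous_hP hd hκ n e).mul
    ((Polynomial.continuous _).comp (by fun_prop))) (continuous_hP hd hκ n e).abs fun y => ?_
  refine (le_abs_self _).trans ?_
  rw [abs_mul]
  exact mul_le_of_le_one_right (abs_nonneg _)
    (Polynomial.Chebyshev.abs_eval_T_real_le_one n (abs_apply_unitSph_le y j))

end

theorem sum_gegCoef_mul_epsCoef (l : ℝ) {c : ℝ} (hc : 0 < c) (N s : ℕ) (hs : s ≤ 1) :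
    ∑ k ∈ range ((2 * N + s) / 2 + 1), gegCoef (2 * N + s) l k * ((2 * N + s - 2 * k).factorial *
        epsCoef c (2 * N + s - 2 * k)) =
      epsCoef c (2 * N + s) * (2 ^ (2 * N + s) * poch l (N + s) * poch (l + 1 - c) N) := by
  have hv := poch_vandermonde (l + (N + s : ℕ)) (1 - c - (N + s : ℕ)) N
  rw [show l + (N + s : ℕ) + (1 - c - (N + s : ℕ)) = l + 1 - c by ring] at hv
  rw [hv, mul_sum, mul_sum, show (2 * N + s) / 2 = N by omega]
  refine sum_congr rfl fun k hk => ?_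
  obtain ⟨r, rfl⟩ := Nat.exists_eq_add_of_le (Nat.lt_succ_iff.1 (mem_range.1 hk))
  have h1 : poch (1 - c - ((k + r + s : ℕ) : ℝ)) k = (-1) ^ k * poch (c + (r + s : ℕ)) k := by
    rw [← poch_reflect]; congr 1; push_cast; ring
  have h2 := poch_pos hc (r + s)
  have h3 := poch_pos (show 0 < c + (r + s : ℕ) by positivity) k
  rw [← mul_assoc, gegCoef_mul_factorial, h1, epsCoef, epsCoef,
    show 2 * (k + r) + s - 2 * k = 2 * r + s by omega, show (2 * r + s) / 2 = r by omega,
    show (2 * r + s + 1) / 2 = r + s by omega, show (2 * (k + r) + s) / 2 = k + r by omega,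
    show (2 * (k + r) + s + 1) / 2 = r + s + k by omega, Nat.add_sub_cancel_left,
    show 2 * (k + r) + s - k = k + r + s + r by omega, poch_add l, poch_add c (r + s) k,
    Nat.cast_choose ℝ (Nat.le_add_right k r), Nat.add_sub_cancel_left]
  field_simp

theorem half_ratio_le {l μ : ℝ} (hl : 0 < l) (hμ : 0 < μ) (N s : ℕ) (hs : s ≤ 1) :
    poch l N * poch (μ + 1 / 2) N / (2 * (poch (l / 2) N * poch (l / 2 + 1 / 2) N)) ≤
      2 ^ (2 * N + s) * poch l (N + s) * poch (μ + 1 / 2) N / (2 * poch l (2 * N + s)) := by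
  have h := poch_two_mul (l / 2) N
  rw [show 2 * (l / 2) = l by ring] at h
  have h1 := poch_pos (show 0 < l / 2 by positivity) N
  have h2 := poch_pos (show 0 < l / 2 + 1 / 2 by positivity) N
  have h3 := poch_pos hl N
  have h4 := poch_pos (show 0 < μ + 1 / 2 by positivity) N
  have h5 : (2 : ℝ) ^ (2 * N) = 4 ^ N := by rw [pow_mul]; norm_num
  obtain rfl | rfl : s = 0 ∨ s = 1 := by omega
  · rw [add_zero, add_zero, h, h5]
    apply le_of_eq
    field_simp
  · rw [poch_succ, poch_succ, h, pow_succ, h5, div_le_div_iff₀ (by positivity) (by positivity)]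
    push_cast
    have : l + 2 * (N : ℝ) ≤ 2 * (l + N) := by linarith
    calc _ = (2 * 4 ^ N * poch l N * poch (μ + 1 / 2) N * poch (l / 2) N *
          poch (l / 2 + 1 / 2) N) * (l + 2 * N) := by ring
      _ ≤ (2 * 4 ^ N * poch l N * poch (μ + 1 / 2) N * poch (l / 2) N *
          poch (l / 2 + 1 / 2) N) * (2 * (l + N)) := by gcongr
      _ = _ := by ring

theorem exists_le_half_ratio {l μ : ℝ} (hl : 0 < l) (hμ : 0 < μ) : ∃ c : ℝ, 0 < c ∧ ∀ N : ℕ,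
    c * ((N : ℝ) + 1) ^ μ ≤
      poch l N * poch (μ + 1 / 2) N / (2 * (poch (l / 2) N * poch (l / 2 + 1 / 2) N)) := by
  obtain ⟨c1, _, hc1, _, h1⟩ := exists_poch_bounds hl
  obtain ⟨c2, _, hc2, _, h2⟩ := exists_poch_bounds (show 0 < μ + 1 / 2 by positivity)
  obtain ⟨_, C3, _, hC3, h3⟩ := exists_poch_bounds (show 0 < l / 2 by positivity)
  obtain ⟨_, C4, _, hC4, h4⟩ := exists_poch_bounds (show 0 < l / 2 + 1 / 2 by positivity)
  refine ⟨min (1 / 2) (c1 * c2 / (2 * (C3 * C4)) / 2 ^ μ), by positivity, fun N => ?_⟩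
  rcases Nat.eq_zero_or_pos N with rfl | hN
  · simp only [poch_zero, Nat.cast_zero, zero_add, one_rpow, mul_one]
    exact min_le_left _ _
  have hN' : (1 : ℝ) ≤ N := by exact_mod_cast hN
  have p3 := poch_pos (show 0 < l / 2 by positivity) N
  have p4 := poch_pos (show 0 < l / 2 + 1 / 2 by positivity) N
  have p1 := poch_pos hl N
  have p2 := poch_pos (show 0 < μ + 1 / 2 by positivity) N
  calc _ ≤ c1 * c2 / (2 * (C3 * C4)) / 2 ^ μ * (2 * (N : ℝ)) ^ μ := by
        gcongr
        · exact min_le_right _ _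
        · linarith
    _ = (c1 * (N : ℝ) ^ (l - 1) * N.factorial) * (c2 * (N : ℝ) ^ (μ + 1 / 2 - 1) * N.factorial) /
        (2 * ((C3 * (N : ℝ) ^ (l / 2 - 1) * N.factorial) *
          (C4 * (N : ℝ) ^ (l / 2 + 1 / 2 - 1) * N.factorial))) := by
        have e : (N : ℝ) ^ (l - 1) * (N : ℝ) ^ (μ + 1 / 2 - 1) =
            (N : ℝ) ^ μ * ((N : ℝ) ^ (l / 2 - 1) * (N : ℝ) ^ (l / 2 + 1 / 2 - 1)) := by
          rw [← rpow_add (by positivity), ← rpow_add (by positivity), ← rpow_add (by positivity)]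
          congr 1; ring
        rw [mul_rpow (by norm_num) (by positivity), show c1 * c2 / (2 * (C3 * C4)) / 2 ^ μ *
          (2 ^ μ * (N : ℝ) ^ μ) = c1 * c2 * (N : ℝ) ^ μ / (2 * (C3 * C4)) by field_simp,
          div_eq_div_iff (by positivity) (by positivity)]
        linear_combination (-(2 * c1 * c2 * C3 * C4 * N.factorial ^ 2)) * e
    _ ≤ _ := by
        gcongr
        · exact (h1 N hN).1
        · exact (h2 N hN).1
        · exact (h3 N hN).2
        · exact (h4 N hN).2

section

variable {d : ℕ} {κ : Fin (d + 1) → ℝ}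

theorem exists_le_sphAvg_abs_hP (hd : 1 ≤ d) (hκ : ∀ i, 0 < κ i) : ∃ c : ℝ, 0 < c ∧
    ∃ e : unitSph d, ∀ n : ℕ, 1 ≤ n →
      c * (n : ℝ) ^ sigmaK d κ ≤ sphAvg d κ fun y => |hP d κ n e y| := by
  have hl := lamK_pos hd hκ
  obtain ⟨j, -, hj⟩ := exists_mem_eq_inf' (univ_nonempty (α := Fin (d + 1))) κ
  have hσ : sigmaK d κ = lamK d κ - κ j := by rw [sigmaK, lamK, hj]; ring
  have hd' : (1 : ℝ) ≤ d := by exact_mod_cast hd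
  have hμ : 0 < sigmaK d κ := by
    obtain ⟨i, hi⟩ : ∃ i, i ≠ j := by
      have : Nontrivial (Fin (d + 1)) := Fin.nontrivial_iff_two_le.2 (by omega)
      exact exists_ne j
    have h1 : κ j < ∑ i, κ i := by
      rw [← add_sum_erase _ _ (mem_univ j)]
      exact lt_add_of_pos_right _ (sum_pos (fun i _ => hκ i) ⟨i, by simp [hi]⟩)
    rw [hσ, lamK]; linarith
  set μ := sigmaK d κ with hμd
  obtain ⟨c, hc, hN⟩ := exists_le_half_ratio hl hμ
  let e : unitSph d := ⟨EuclideanSpace.single j 1, by simp⟩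
  refine ⟨c / 2 ^ μ, by positivity, e, fun n hn => ?_⟩
  refine le_trans ?_ (le_sphAvg_abs_hP hd hκ j (e := e) rfl n)
  obtain ⟨N, s, hs, rfl⟩ : ∃ N s, s ≤ 1 ∧ n = 2 * N + s := ⟨n / 2, n % 2, by omega, by omega⟩
  have hcj : 0 < κ j + 1 / 2 := by have := hκ j; positivity
  have hε := epsCoef_pos hcj (2 * N + s)
  have hee : ∀ m, zonalTerm κ m e e = epsCoef (κ j + 1 / 2) m := fun m => by
    rw [zonalTerm_single j (e := e) rfl]; simp [e]
  have hP1 := hP_eq_sum_zonalTerm hd hκ (2 * N + s) e e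
  simp only [hee] at hP1
  rw [sum_gegCoef_mul_epsCoef _ hcj N s hs,
    show lamK d κ + 1 - (κ j + 1 / 2) = μ + 1 / 2 by rw [hσ]; ring] at hP1
  have h1 : lamK d κ * poch (lamK d κ + 1) (2 * N + s) =
      poch (lamK d κ) (2 * N + s) * (lamK d κ + (2 * N + s : ℕ)) := by
    rw [← poch_succ', poch_succ]
  have hp := poch_pos hl (2 * N + s)
  have hp' := poch_pos (show 0 < lamK d κ + 1 by positivity) (2 * N + s)
  have h2 : (2 : ℝ) ^ (2 * N + s) = 2 ^ (2 * N + s - 1) * 2 := by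
    rw [← pow_succ]; congr 1; omega
  have key : 2 ^ (2 * N + s - 1) * (hP d κ (2 * N + s) e e / (2 ^ (2 * N + s) *
      poch (lamK d κ + 1) (2 * N + s) * epsCoef (κ j + 1 / 2) (2 * N + s))) =
      2 ^ (2 * N + s) * poch (lamK d κ) (N + s) * poch (μ + 1 / 2) N /
        (2 * poch (lamK d κ) (2 * N + s)) := by
    have h3 : poch (lamK d κ + 1) (2 * N + s) =
      poch (lamK d κ) (2 * N + s) * (lamK d κ + (2 * N + s : ℕ)) / lamK d κ := by
      rw [← h1]; field_simp
    have h4 : 0 < lamK d κ + (2 * N + s : ℕ) := by positivity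
    rw [hP1, h3]
    generalize epsCoef (κ j + 1 / 2) (2 * N + s) = ε at hε ⊢
    rw [add_comm (((2 * N + s : ℕ)) : ℝ)]
    generalize lamK d κ + ((2 * N + s : ℕ) : ℝ) = w at h4 ⊢
    rw [h2]
    field_simp
  rw [key]
  refine le_trans ?_ (half_ratio_le hl hμ N s hs)
  refine le_trans ?_ (hN N)
  have h5 : ((2 * N + s : ℕ) : ℝ) ≤ 2 * ((N : ℝ) + 1) := by
    have : (s : ℝ) ≤ 1 := by exact_mod_cast hs
    push_cast; linarith
  calc c / 2 ^ μ * ((2 * N + s : ℕ) : ℝ) ^ μ ≤ c / 2 ^ μ * (2 * ((N : ℝ) + 1)) ^ μ := by gcongr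
    _ = _ := by
      rw [mul_rpow (by norm_num) (by positivity)]
      field_simp

end

/-- the norm `Π_n = sup_x a_κ ∫ |P_n(h_κ²;x,y)| h_κ²(y) dω(y)` of the
orthogonal projection satisfies `c₁ n^{σ_κ} ≤ Π_n ≤ c₂ n^{σ_κ}` for all `n ≥ 1`. -/
theorem projection_norm_sphere (d : ℕ) (hd : 1 ≤ d) (κ : Fin (d + 1) → ℝ)
    (hκ : ∀ i, 0 < κ i) :
    ∃ c₁ c₂ : ℝ, 0 < c₁ ∧ 0 < c₂ ∧ ∀ n : ℕ, 1 ≤ n →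
      c₁ * (n : ℝ) ^ sigmaK d κ ≤
        (⨆ x : Metric.sphere (0 : EuclideanSpace ℝ (Fin (d + 1))) 1,
          (∫ y, hsq κ y ∂(sphereMeas d))⁻¹ *
            ∫ y, |hP d κ n x y| * hsq κ y ∂(sphereMeas d)) ∧
      (⨆ x : Metric.sphere (0 : EuclideanSpace ℝ (Fin (d + 1))) 1,
          (∫ y, hsq κ y ∂(sphereMeas d))⁻¹ *
            ∫ y, |hP d κ n x y| * hsq κ y ∂(sphereMeas d)) ≤
        c₂ * (n : ℝ) ^ sigmaK d κ := by
  obtain ⟨c₂, hc₂, hub⟩ := exists_sphAvg_abs_hP_le hd hκ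
  obtain ⟨c₁, hc₁, e, hlb⟩ := exists_le_sphAvg_abs_hP hd hκ
  refine ⟨c₁, c₂, hc₁, hc₂, fun n hn => ⟨?_, ?_⟩⟩
  · have hbdd : BddAbove (Set.range fun x : unitSph d => sphAvg d κ fun y => |hP d κ n x y|) :=
      ⟨_, Set.forall_mem_range.2 (hub n hn)⟩
    exact (hlb n hn).trans (le_ciSup hbdd e)
  · have : Nonempty (unitSph d) := ⟨e⟩
    exact ciSup_le (hub n hn)
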